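/- Assume (β,h) satisfy the AT condition. For v ∈ (−1,1)^N let D_v ∈ ℝ^{N×N} be diagonal with (D_v)_{ij} = δ_{ij}/(1−v_i²), and for ε > 0 and k ∈ ℕ let S_{N,ε,k} = {(u,v) ∈ ℝ^N × (−1,1)^N : ‖u‖² = 1, ‖v − m^(k)‖² ≤ Nε}, where m^(k) is Bolthausen's iterative TAP solution. Then there exists a constant c = c_{β,h} > 0, independent of N, such that for every c' < c there exists ε₀ > 0 so that for every 0 < ε ≤ ε₀ there exists k₀ with: for every k ≥ k₀, ℙ( inf_{(u,v) ∈ S_{N,ε,k}} ( u, ( D_v + β²(1−q) − (2β²/N) v⊗v − β G ) u ) ≥ c' ) → 1 as N → ∞. -/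

import Mathlib

open MeasureTheory ProbabilityTheory Real Filter

noncomputable section

namespace SK

/-- The spin value `±1` encoded by a Boolean. -/
def spin (b : Bool) : ℝ := if b then 1 else -1

/-- SK Hamiltonian with coupling matrix `g`, inverse temperature `β` and external
field vector `hv`:  `H(σ) = β ∑_{i<j} g_{ij} σ_i σ_j + ∑_i hv_i σ_i`. -/
def hamiltonian (N : ℕ) (β : ℝ) (g : Fin N → Fin N → ℝ) (hv : Fin N → ℝ)
    (σ : Fin N → ℝ) : ℝ :=
  β * ∑ i : Fin N, ∑ j : Fin N, (if i < j then g i j * σ i * σ j else 0)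
    + ∑ i : Fin N, hv i * σ i

/-- Partition function `Z_N`. -/
def partitionZ (N : ℕ) (β : ℝ) (g : Fin N → Fin N → ℝ) (hv : Fin N → ℝ) : ℝ :=
  ∑ s : Fin N → Bool, Real.exp (hamiltonian N β g hv (fun i => spin (s i)))

/-- Gibbs expectation `⟨f⟩`. -/
def gibbs (N : ℕ) (β : ℝ) (g : Fin N → Fin N → ℝ) (hv : Fin N → ℝ)
    (f : (Fin N → ℝ) → ℝ) : ℝ :=
  (∑ s : Fin N → Bool, f (fun i => spin (s i)) *
      Real.exp (hamiltonian N β g hv (fun i => spin (s i)))) / partitionZ N β g hv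

/-- Magnetization `m_i = ⟨σ_i⟩`. -/
def mag (N : ℕ) (β : ℝ) (g : Fin N → Fin N → ℝ) (hv : Fin N → ℝ) (i : Fin N) : ℝ :=
  gibbs N β g hv (fun σ => σ i)

/-- Two point correlation `m_{ij} = ⟨σ_i σ_j⟩ - ⟨σ_i⟩⟨σ_j⟩`. -/
def corr (N : ℕ) (β : ℝ) (g : Fin N → Fin N → ℝ) (hv : Fin N → ℝ) (i j : Fin N) : ℝ :=
  gibbs N β g hv (fun σ => σ i * σ j) - mag N β g hv i * mag N β g hv j

/-- Operator (ℓ²→ℓ²) norm of an `N×N` real matrix. -/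
def opNorm (N : ℕ) (A : Fin N → Fin N → ℝ) : ℝ :=
  sSup {x : ℝ | ∃ u : Fin N → ℝ, (∑ i, u i ^ 2) = 1 ∧
    x = Real.sqrt (∑ i, (∑ j, A i j * u j) ^ 2)}

/-- `q ↦ E tanh²(h + β √q Z)`, `Z` standard Gaussian. -/
def qtanh (β h q : ℝ) : ℝ :=
  ∫ z, Real.tanh (h + β * Real.sqrt q * z) ^ 2 ∂(gaussianReal 0 1)

/-- `q` is the (unique) solution in `(0,1)` of `q = E tanh²(h + β √q Z)`. -/
def isFixedq (β h q : ℝ) : Prop := 0 < q ∧ q < 1 ∧ q = qtanh β h q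

/-- The de Almeida–Thouless condition `β² E sech⁴(h + β √q Z) < 1`. -/
def ATcond (β h q : ℝ) : Prop :=
  β ^ 2 * ∫ z, (Real.cosh (h + β * Real.sqrt q * z))⁻¹ ^ 4 ∂(gaussianReal 0 1) < 1

/-- The functional `Φ(m, q')` from condition (AT+). -/
def Phi (β h q m q' : ℝ) : ℝ :=
  Real.log 2 + β ^ 2 / 4 * (1 - q') ^ 2 - β ^ 2 / 4 * m * (q' ^ 2 - q ^ 2)
    + (1 / m) * ∫ z, Real.log (∫ z', Real.cosh (h + β * Real.sqrt q * z
        + β * Real.sqrt (q' - q) * z') ^ m ∂(gaussianReal 0 1)) ∂(gaussianReal 0 1)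

/-- Condition (AT+): `(∂_m Φ)(m, q')|_{m=1} < 0` for all `q < q' ≤ 1`. -/
def ATplus (β h q : ℝ) : Prop :=
  ∀ q' : ℝ, q < q' → q' ≤ 1 → deriv (fun m => Phi β h q m q') 1 < 0

/-- `G` is a GOE random matrix: symmetric, zero diagonal, and the entries above the
diagonal are i.i.d. centered Gaussians of variance `1/N`. -/
def IsGOE (N : ℕ) {Ω : Type*} [MeasurableSpace Ω] (P : Measure Ω)
    (G : Ω → Fin N → Fin N → ℝ) : Prop :=
  (∀ ω i j, G ω i j = G ω j i) ∧ (∀ ω i, G ω i i = 0) ∧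
  iIndepFun (m := fun _ : {p : Fin N × Fin N // p.1 < p.2} => (inferInstance : MeasurableSpace ℝ))
    (fun p ω => G ω p.1.1 p.1.2) P ∧
  ∀ p : {p : Fin N × Fin N // p.1 < p.2},
    Measure.map (fun ω => G ω p.1.1 p.1.2) P = gaussianReal 0 (N : NNReal)⁻¹


/-! ### Bolthausen's iterative TAP solution -/

/-- Euclidean inner product on `ℝ^N`. -/
def dotp (N : ℕ) (u v : Fin N → ℝ) : ℝ := ∑ i, u i * v i

/-- Matrix-vector multiplication. -/
def mulVec (N : ℕ) (A : Fin N → Fin N → ℝ) (u : Fin N → ℝ) : Fin N → ℝ :=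
  fun i => ∑ j, A i j * u j

/-- Symmetrization `(W + Wᵀ)/√2`. -/
def symmG (N : ℕ) (W : Fin N → Fin N → ℝ) : Fin N → Fin N → ℝ :=
  fun i j => (W i j + W j i) / Real.sqrt 2

/-- `γ₁ = E tanh (h + β √q Z)`. -/
def gamma1 (β h q : ℝ) : ℝ :=
  ∫ z, Real.tanh (h + β * Real.sqrt q * z) ∂(gaussianReal 0 1)

/-- `ψ(t) = E tanh(h + β√t Z + β√(q-t) Z') tanh(h + β√t Z + β√(q-t) Z'')` for independent
standard Gaussians `Z, Z', Z''`. -/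
def psiFun (β h q t : ℝ) : ℝ :=
  ∫ z, ∫ z', ∫ z'',
      Real.tanh (h + β * Real.sqrt t * z + β * Real.sqrt (q - t) * z')
        * Real.tanh (h + β * Real.sqrt t * z + β * Real.sqrt (q - t) * z'')
    ∂(gaussianReal 0 1) ∂(gaussianReal 0 1) ∂(gaussianReal 0 1)

/-- The triple `(α_k, γ_k, Γ_k²)` of Bolthausen's recursion; the natural index `k`
corresponds to the step `k + 1` (so `boltSeq _ _ _ 0 = (α₁, γ₁, Γ₁²)`). -/
def boltSeq (β h q : ℝ) : ℕ → ℝ × ℝ × ℝ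
  | 0 => (Real.sqrt q * gamma1 β h q, gamma1 β h q, gamma1 β h q ^ 2)
  | k + 1 =>
      let p := boltSeq β h q k
      let a := psiFun β h q p.1
      let g := (a - p.2.2) / Real.sqrt (q - p.2.2)
      (a, g, p.2.2 + g ^ 2)

/-- `α_k` (for `k ≥ 1`). -/
def alphaSeq (β h q : ℝ) (k : ℕ) : ℝ := (boltSeq β h q (k - 1)).1

/-- `γ_k` (for `k ≥ 1`). -/
def gammaSeq (β h q : ℝ) (k : ℕ) : ℝ := (boltSeq β h q (k - 1)).2.1

/-- `Γ_k²` (for `k ≥ 1`), with the convention `Γ₀² = 0`. -/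
def GammaSq (β h q : ℝ) (k : ℕ) : ℝ :=
  if k = 0 then 0 else (boltSeq β h q (k - 1)).2.2

/-- State of Bolthausen's TAP iteration after step `k`: the matrix `W^{(k)}`, the
orthonormal vectors `φ^{(s)}` and the cavity vectors `ζ^{(s)}` for `1 ≤ s ≤ k`, and the
iterate `m^{(k)}`. -/
structure TapState (N : ℕ) where
  W : Fin N → Fin N → ℝ
  phi : ℕ → Fin N → ℝ
  zeta : ℕ → Fin N → ℝ
  m : Fin N → ℝ

/-- Initial state (step `1`): `W^{(1)} = W`, `φ^{(1)} = N^{-1/2} 𝟏`, `m^{(1)} = √q 𝟏`,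
`ζ^{(1)} = G^{(1)} N^{1/2} φ^{(1)}`. -/
def tapInit (N : ℕ) (q : ℝ) (W0 : Fin N → Fin N → ℝ) : TapState N :=
  let φ1 : Fin N → ℝ := fun _ => (Real.sqrt N)⁻¹
  { W := W0
    phi := fun s => if s = 1 then φ1 else 0
    zeta := fun s =>
      if s = 1 then mulVec N (symmG N W0) (fun i => Real.sqrt N * φ1 i) else 0
    m := fun _ => Real.sqrt q }

/-- One step of the TAP iteration: from the state after step `k` (with `k ≥ 1`) to the
state after step `k+1`. -/
def tapStep (N : ℕ) (β h q : ℝ) (k : ℕ) (st : TapState N) : TapState N :=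
  -- the cavity field z^{(k+1)} = ∑_{s=1}^{k-1} γ_s ζ^{(s)} + √(q - Γ_{k-1}²) ζ^{(k)}
  let z : Fin N → ℝ := fun i =>
    (∑ s ∈ Finset.Icc 1 (k - 1), gammaSeq β h q s * st.zeta s i)
      + Real.sqrt (q - GammaSq β h q (k - 1)) * st.zeta k i
  -- m^{(k+1)} = tanh (h 𝟏 + β z^{(k+1)})
  let m' : Fin N → ℝ := fun i => Real.tanh (h + β * z i)
  -- Gram–Schmidt: φ^{(k+1)}
  let v : Fin N → ℝ := fun i =>
    m' i - ∑ s ∈ Finset.Icc 1 k, dotp N m' (st.phi s) * st.phi s i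
  let φ' : Fin N → ℝ := fun i => v i / Real.sqrt (dotp N v v)
  -- W^{(k+1)} = W^{(k)} - ρ^{(k)}
  let Wφ := mulVec N st.W (st.phi k)
  let WTφ := mulVec N (fun i j => st.W j i) (st.phi k)
  let W' : Fin N → Fin N → ℝ := fun i j =>
    st.W i j - (Wφ i * st.phi k j + st.phi k i * WTφ j
      - dotp N Wφ (st.phi k) * st.phi k i * st.phi k j)
  -- ζ^{(k+1)} = G^{(k+1)} N^{1/2} φ^{(k+1)}
  let ζ' : Fin N → ℝ := mulVec N (symmG N W') (fun i => Real.sqrt N * φ' i)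
  { W := W'
    phi := Function.update st.phi (k + 1) φ'
    zeta := Function.update st.zeta (k + 1) ζ'
    m := m' }

/-- The state after step `k+1` (natural index `k`). -/
def tapState (N : ℕ) (β h q : ℝ) (W0 : Fin N → Fin N → ℝ) : ℕ → TapState N
  | 0 => tapInit N q W0
  | k + 1 => tapStep N β h q (k + 1) (tapState N β h q W0 k)

/-- Bolthausen's iterative TAP solution `m^{(k)}` (for `k ≥ 1`). -/
def mTAP (N : ℕ) (β h q : ℝ) (W0 : Fin N → Fin N → ℝ) (k : ℕ) : Fin N → ℝ :=
  (tapState N β h q W0 (k - 1)).m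

/-- `W` is a random matrix with zero diagonal whose off-diagonal entries are i.i.d.
centered Gaussians of variance `1/N` (no symmetry constraint). -/
def IsWGauss (N : ℕ) {Ω : Type*} [MeasurableSpace Ω] (P : Measure Ω)
    (W : Ω → Fin N → Fin N → ℝ) : Prop :=
  (∀ ω i, W ω i i = 0) ∧
  iIndepFun (m := fun _ : {p : Fin N × Fin N // p.1 ≠ p.2} => (inferInstance : MeasurableSpace ℝ))
    (fun p ω => W ω p.1.1 p.1.2) P ∧
  ∀ p : {p : Fin N × Fin N // p.1 ≠ p.2},
    Measure.map (fun ω => W ω p.1.1 p.1.2) P = gaussianReal 0 (N : NNReal)⁻¹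

/-! ### Gaussian basics -/

/-- standard Gaussian -/
abbrev gm : Measure ℝ := gaussianReal 0 1

/-- iid standard Gaussians indexed by `ι` -/
abbrev gI (ι : Type) : Measure (ι → ℝ) := Measure.infinitePi (fun _ : ι => gm)

lemma hasDerivAt_tanh (x : ℝ) : HasDerivAt Real.tanh (1 - Real.tanh x ^ 2) x := by
  have h : Real.tanh = fun x => Real.sinh x / Real.cosh x := by
    funext x; exact Real.tanh_eq_sinh_div_cosh x
  have h1 := (Real.hasDerivAt_sinh x).div (Real.hasDerivAt_cosh x) (Real.cosh_pos x).ne'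
  have h2 : 1 - Real.tanh x ^ 2
      = (Real.cosh x * Real.cosh x - Real.sinh x * Real.sinh x) / Real.cosh x ^ 2 := by
    rw [Real.tanh_eq_sinh_div_cosh]
    have := (Real.cosh_pos x).ne'
    field_simp
  rw [h2, h]
  exact h1

lemma continuous_tanh : Continuous Real.tanh :=
  continuous_iff_continuousAt.2 fun x => (hasDerivAt_tanh x).continuousAt

@[fun_prop]
lemma measurable_tanh : Measurable Real.tanh := continuous_tanh.measurable

lemma sech_sq (x : ℝ) : (Real.cosh x)⁻¹ ^ 2 = 1 - Real.tanh x ^ 2 := by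
  have h := Real.cosh_sq x
  have := (Real.cosh_pos x).ne'
  rw [Real.tanh_eq_sinh_div_cosh]
  field_simp
  linarith

lemma tanh_sq_le_one (x : ℝ) : Real.tanh x ^ 2 ≤ 1 := (Real.tanh_sq_lt_one x).le

lemma tanh_abs_le_one (x : ℝ) : |Real.tanh x| ≤ 1 := (Real.abs_tanh_lt_one x).le

lemma gaussianPDFReal_hasDerivAt (x : ℝ) :
    HasDerivAt (gaussianPDFReal 0 1) (- x * gaussianPDFReal 0 1 x) x := by
  have h1 : HasDerivAt (fun x : ℝ => (√(2 * π * (1 : NNReal)))⁻¹ *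
      rexp (-(x - 0) ^ 2 / (2 * (1 : NNReal)))) ((√(2 * π * (1 : NNReal)))⁻¹ *
      (rexp (-(x - 0) ^ 2 / (2 * (1 : NNReal))) * (-x))) x := by
    refine HasDerivAt.const_mul _ (HasDerivAt.exp ?_)
    have : HasDerivAt (fun x : ℝ => -(x - 0) ^ 2 / (2 * ((1 : NNReal) : ℝ)))
      (-(2 * (x - 0) ^ (2 - 1) * 1) / (2 * ((1 : NNReal) : ℝ))) x := by
      refine HasDerivAt.div_const (HasDerivAt.neg ?_) _
      exact ((hasDerivAt_id x).sub_const 0).pow 2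
    convert this using 1
    simp
    ring
  rw [gaussianPDFReal_def]
  convert h1 using 1
  simp only []
  ring

lemma integrable_gm_iff {f : ℝ → ℝ} :
    Integrable f gm ↔ Integrable (fun x => gaussianPDFReal 0 1 x * f x) := by
  rw [gm, gaussianReal_of_var_ne_zero 0 one_ne_zero]
  have hm : Measurable (gaussianPDF 0 1) := measurable_gaussianPDF 0 1
  rw [integrable_withDensity_iff_integrable_smul' hm
    (by filter_upwards with x using gaussianPDF_lt_top)]
  simp [gaussianPDF, gaussianPDFReal_nonneg, smul_eq_mul]

/-- one dimensional Stein identity -/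
lemma stein {f f' : ℝ → ℝ} (hf : ∀ x, HasDerivAt f (f' x) x)
    (h0 : Integrable f gm) (h1 : Integrable (fun x => x * f x) gm) (h2 : Integrable f' gm) :
    ∫ x, x * f x ∂gm = ∫ x, f' x ∂gm := by
  have key := integral_mul_deriv_eq_deriv_mul_of_integrable
    (u := f) (u' := f') (v := gaussianPDFReal 0 1) (v' := fun x => - x * gaussianPDFReal 0 1 x)
    (fun x _ => hf x) (fun x _ => gaussianPDFReal_hasDerivAt x)
    ((integrable_gm_iff.1 h1).neg.congr (by filter_upwards with x; simp; ring))
    ((integrable_gm_iff.1 h2).congr (by filter_upwards with x; simp; ring))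
    ((integrable_gm_iff.1 h0).congr (by filter_upwards with x; simp; ring))
  rw [gm, integral_gaussianReal_eq_integral_smul one_ne_zero,
    integral_gaussianReal_eq_integral_smul one_ne_zero]
  simp only [smul_eq_mul]
  have e1 : ∀ x, gaussianPDFReal 0 1 x * (x * f x) = -(f x * (-x * gaussianPDFReal 0 1 x)) := by
    intro x; ring
  have e2 : ∀ x, gaussianPDFReal 0 1 x * f' x = f' x * gaussianPDFReal 0 1 x := by
    intro x; ring
  simp only [e1, e2]
  rw [integral_neg, key, neg_neg]

lemma integrable_exp_abs (c : ℝ) : Integrable (fun x => rexp (c * |x|)) gm := by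
  have h := (integrable_exp_mul_gaussianReal (μ := 0) (v := 1) c).add
    (integrable_exp_mul_gaussianReal (μ := 0) (v := 1) (-c))
  refine h.mono' (by fun_prop) ?_
  filter_upwards with x
  rw [Real.norm_eq_abs, abs_of_pos (exp_pos _)]
  simp only [Pi.add_apply]
  rcases abs_cases x with ⟨h, _⟩ | ⟨h, _⟩
  · rw [h]; linarith [exp_pos (-c * x)]
  · rw [h]
    have : c * -x = -c * x := by ring
    rw [this]; linarith [exp_pos (c * x)]

lemma abs_pow_le_exp (n : ℕ) (x : ℝ) : |x| ^ n ≤ rexp (n * |x|) := by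
  rw [Real.exp_nat_mul]
  exact pow_le_pow_left₀ (abs_nonneg _) (by linarith [add_one_le_exp |x|]) _

lemma integrable_of_pow_bound {f : ℝ → ℝ} (hf : Measurable f) (C : ℝ) (n : ℕ)
    (hb : ∀ x, |f x| ≤ C * |x| ^ n) : Integrable f gm := by
  refine ((integrable_exp_abs n).const_mul |C|).mono' hf.aestronglyMeasurable ?_
  filter_upwards with x
  rw [Real.norm_eq_abs]
  refine (hb x).trans ?_
  calc C * |x| ^ n ≤ |C| * |x| ^ n := by gcongr; exact le_abs_self C
    _ ≤ _ := by gcongr; exact abs_pow_le_exp n x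

lemma integral_sq_gm : ∫ x, x ^ 2 ∂gm = 1 := by
  have := stein (f := fun x => x) (f' := fun _ => 1) (fun x => hasDerivAt_id x)
    (integrable_of_pow_bound measurable_id 1 1 (by intro x; simp))
    (integrable_of_pow_bound (by fun_prop) 1 2 (by intro x; simp [abs_mul, sq]))
    (integrable_const _)
  simp at this
  simpa [sq] using this

/-! ### joint laws -/

lemma charFun_gI {ι : Type} (S : Finset ι) (a : ι → ℝ) :
    ∫ x, Complex.exp ((∑ s ∈ S, a s * x s : ℝ) * Complex.I) ∂(gI ι)
      = Complex.exp (-(∑ s ∈ S, a s ^ 2 : ℝ) / 2) := by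
  have h1 : ∫ x, Complex.exp ((∑ s ∈ S, a s * x s : ℝ) * Complex.I) ∂(gI ι)
     = ∫ y, (∏ s : S, Complex.exp ((a s * y s : ℝ) * Complex.I))
        ∂(Measure.pi (fun _ : S => gm)) := by
    have := Measure.infinitePi_map_restrict (fun _ : ι => gm) (I := S)
    rw [← this, integral_map]
    · apply integral_congr_ae
      filter_upwards with x
      rw [← Complex.exp_sum]
      congr 1
      rw [← Finset.sum_mul]
      congr 1
      push_cast
      exact (Finset.sum_coe_sort S (fun s => (a s : ℂ) * (x s : ℂ))).symm
    · exact (Finset.measurable_restrict S).aemeasurable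
    · apply Measurable.aestronglyMeasurable
      fun_prop
  rw [h1, integral_fintype_prod_eq_prod (f := fun (s : S) (y : ℝ) =>
    Complex.exp ((a s * y : ℝ) * Complex.I))]
  have h2 : ∀ s : S, ∫ y, Complex.exp ((a s * y : ℝ) * Complex.I) ∂gm
      = Complex.exp (-((a s : ℝ) : ℂ) ^ 2 / 2) := by
    intro s
    have := charFun_gaussianReal (μ := 0) (v := 1) (a s)
    rw [charFun_apply_real] at this
    simp at this
    rw [neg_div, ← this]
    apply integral_congr_ae
    filter_upwards with x
    push_cast
    rfl
  simp_rw [h2]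
  rw [← Complex.exp_sum]
  congr 1
  push_cast
  rw [Finset.sum_coe_sort S (fun s => -(a s : ℂ) ^ 2 / 2)]
  rw [neg_div, Finset.sum_div, ← Finset.sum_neg_distrib]
  simp [neg_div]

/-- equality of joint laws of Gaussian linear forms with the same Gram matrix -/
lemma law_eq {ι ι' κ : Type} [Fintype κ] (S : Finset ι) (S' : Finset ι')
    (a : κ → ι → ℝ) (b : κ → ι' → ℝ)
    (hab : ∀ k l, ∑ s ∈ S, a k s * a l s = ∑ s ∈ S', b k s * b l s) :
    (gI ι).map (fun x k => ∑ s ∈ S, a k s * x s)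
      = (gI ι').map (fun x k => ∑ s ∈ S', b k s * x s) := by
  classical
  have hm1 : Measurable (fun (x : ι → ℝ) (k : κ) => ∑ s ∈ S, a k s * x s) := by fun_prop
  have hm2 : Measurable (fun (x : ι' → ℝ) (k : κ) => ∑ s ∈ S', b k s * x s) := by fun_prop
  have : IsProbabilityMeasure ((gI ι).map (fun x k => ∑ s ∈ S, a k s * x s)) :=
    Measure.isProbabilityMeasure_map hm1.aemeasurable
  have : IsProbabilityMeasure ((gI ι').map (fun x k => ∑ s ∈ S', b k s * x s)) :=
    Measure.isProbabilityMeasure_map hm2.aemeasurable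
  apply Measure.ext_of_charFunDual
  funext L
  have hL : ∀ y : κ → ℝ, L y = ∑ k, L (Pi.single k 1) * y k := by
    intro y
    have := L.toLinearMap.pi_apply_eq_sum_univ y
    simp only [ContinuousLinearMap.coe_coe] at this
    rw [this]
    refine Finset.sum_congr rfl fun k _ => ?_
    rw [smul_eq_mul, mul_comm]
    congr 2
    funext j
    simp [Pi.single_apply, eq_comm]
  have gen : ∀ {ι : Type} (S : Finset ι) (a : κ → ι → ℝ),
      charFunDual ((gI ι).map (fun x k => ∑ s ∈ S, a k s * x s)) L
      = Complex.exp (-(∑ k, ∑ l, L (Pi.single k 1) * L (Pi.single l 1) *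
          ∑ s ∈ S, a k s * a l s : ℝ) / 2) := by
    intro ι S a
    rw [charFunDual_apply, integral_map (Measurable.aemeasurable (by fun_prop))
      (Measurable.aestronglyMeasurable (by fun_prop))]
    have e : ∀ x : ι → ℝ, L (fun k => ∑ s ∈ S, a k s * x s)
        = ∑ s ∈ S, (∑ k, L (Pi.single k 1) * a k s) * x s := by
      intro x
      rw [hL]
      simp_rw [Finset.mul_sum, Finset.sum_mul]
      rw [Finset.sum_comm]
      simp_rw [mul_assoc]
    simp_rw [e]
    rw [charFun_gI S]
    have e2 : ∑ s ∈ S, (∑ k, L (Pi.single k 1) * a k s) ^ 2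
        = ∑ k, ∑ l, L (Pi.single k 1) * L (Pi.single l 1) * ∑ s ∈ S, a k s * a l s := by
      simp_rw [sq, Finset.sum_mul_sum, Finset.mul_sum]
      rw [Finset.sum_comm]
      refine Finset.sum_congr rfl fun k _ => ?_
      rw [Finset.sum_comm]
      refine Finset.sum_congr rfl fun l _ => Finset.sum_congr rfl fun s _ => ?_
      ring
    rw [e2]
  rw [gen S a, gen S' b]
  simp_rw [hab]

lemma map_update_gI {ι : Type} [DecidableEq ι] (k : ι) :
    ((gI ι).prod gm).map (fun p : (ι → ℝ) × ℝ => Function.update p.1 k p.2) = gI ι := by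
  have hm : Measurable (fun p : (ι → ℝ) × ℝ => Function.update p.1 k p.2) := by
    refine measurable_pi_lambda _ fun i => ?_
    by_cases h : i = k
    · subst h; simp only [Function.update_self]; fun_prop
    · simp only [Function.update_of_ne h]; fun_prop
  apply Measure.eq_infinitePi
  intro s t ht
  rw [Measure.map_apply hm (MeasurableSet.pi s.countable_toSet (fun i _ => ht i))]
  by_cases hk : k ∈ s
  · have : (fun p : (ι → ℝ) × ℝ => Function.update p.1 k p.2) ⁻¹' ((s : Set ι).pi t)
      = (((s.erase k : Finset ι) : Set ι).pi t) ×ˢ (t k) := by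
      ext ⟨x, z⟩
      simp only [Set.mem_preimage, Set.mem_pi, Finset.mem_coe, Set.mem_prod, Finset.mem_erase]
      constructor
      · intro h
        refine ⟨fun i hi => ?_, by simpa using h k hk⟩
        simpa [Function.update_of_ne hi.1] using h i hi.2
      · rintro ⟨h1, h2⟩ i hi
        by_cases e : i = k
        · subst e; simpa using h2
        · simpa [Function.update_of_ne e] using h1 i ⟨e, hi⟩
    rw [this, Measure.prod_prod, Measure.infinitePi_pi _ (fun i _ => ht i), mul_comm,
      Finset.mul_prod_erase s (fun i => gm (t i)) hk]
  · have : (fun p : (ι → ℝ) × ℝ => Function.update p.1 k p.2) ⁻¹' ((s : Set ι).pi t)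
      = ((s : Set ι).pi t) ×ˢ Set.univ := by
      ext ⟨x, z⟩
      simp only [Set.mem_preimage, Set.mem_pi, Finset.mem_coe, Set.mem_prod, Set.mem_univ,
        and_true]
      refine forall₂_congr fun i hi => ?_
      have : i ≠ k := by rintro rfl; exact hk hi
      rw [Function.update_of_ne this]
    rw [this, Measure.prod_prod, Measure.infinitePi_pi _ (fun i _ => ht i)]
    simp

lemma measurable_update_pair {ι : Type} [DecidableEq ι] (k : ι) :
    Measurable (fun p : (ι → ℝ) × ℝ => Function.update p.1 k p.2) := by
  refine measurable_pi_lambda _ fun i => ?_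
  by_cases h : i = k
  · subst h; simp only [Function.update_self]; fun_prop
  · simp only [Function.update_of_ne h]; fun_prop

lemma integral_update {ι : Type} [DecidableEq ι] (k : ι) {f : (ι → ℝ) → ℝ}
    (hf : Integrable f (gI ι)) :
    ∫ x, f x ∂(gI ι) = ∫ x, ∫ z, f (Function.update x k z) ∂gm ∂(gI ι) := by
  conv_lhs => rw [← map_update_gI k]
  rw [integral_map (measurable_update_pair k).aemeasurable
    (by rw [map_update_gI]; exact hf.1)]
  rw [integral_prod]
  have : Integrable f (((gI ι).prod gm).map
    (fun p : (ι → ℝ) × ℝ => Function.update p.1 k p.2)) := by rw [map_update_gI]; exact hf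
  exact (integrable_map_measure this.1 (measurable_update_pair k).aemeasurable).1 this

lemma integrable_exp_coord {ι : Type} (k : ι) (c : ℝ) :
    Integrable (fun x : ι → ℝ => rexp (c * |x k|)) (gI ι) := by
  have h := integrable_exp_abs c
  rw [← Measure.infinitePi_map_eval (fun _ : ι => gm) k] at h
  exact (integrable_map_measure h.1 (measurable_pi_apply k).aemeasurable).1 h

lemma integral_coord {ι : Type} (k : ι) {f : ℝ → ℝ} (hf : Measurable f) :
    ∫ x, f (x k) ∂(gI ι) = ∫ z, f z ∂gm := by
  conv_rhs => rw [← Measure.infinitePi_map_eval (fun _ : ι => gm) k]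
  rw [integral_map (measurable_pi_apply k).aemeasurable hf.aestronglyMeasurable]

/-! ### Gaussian interpolation -/

lemma integrable_coord_mul {ι : Type} (k : ι) {f : (ι → ℝ) → ℝ} (hf : Measurable f) (C : ℝ)
    (hb : ∀ x, |f x| ≤ C) : Integrable (fun x => x k * f x) (gI ι) := by
  refine ((integrable_exp_coord k 1).const_mul C).mono' (by fun_prop) ?_
  filter_upwards with x
  have h0 : 0 ≤ C := (abs_nonneg _).trans (hb x)
  rw [Real.norm_eq_abs, abs_mul, mul_comm]
  have := abs_pow_le_exp 1 (x k)
  simp only [pow_one, Nat.cast_one] at this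
  exact mul_le_mul (hb x) this (abs_nonneg _) h0

lemma integrable_bdd {α : Type*} [MeasurableSpace α] {μ : Measure α} [IsFiniteMeasure μ]
    {f : α → ℝ} (hf : Measurable f) (C : ℝ) (hb : ∀ x, |f x| ≤ C) : Integrable f μ :=
  Integrable.of_bound hf.aestronglyMeasurable C (by filter_upwards with x using hb x)

lemma stein_multi {ι : Type} [DecidableEq ι] (k : ι) {f f' : (ι → ℝ) → ℝ}
    (hf : Measurable f) (hf' : Measurable f') (C : ℝ) (hb : ∀ x, |f x| ≤ C)
    (hb' : ∀ x, |f' x| ≤ C)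
    (hd : ∀ x z, HasDerivAt (fun z => f (Function.update x k z)) (f' (Function.update x k z)) z) :
    ∫ x, x k * f x ∂(gI ι) = ∫ x, f' x ∂(gI ι) := by
  rw [integral_update k (integrable_coord_mul k hf C hb),
    integral_update k (integrable_bdd hf' C hb')]
  apply integral_congr_ae
  filter_upwards with x
  have hu : Measurable (fun z => Function.update x k z) :=
    (measurable_update_pair k).comp (measurable_const.prodMk measurable_id)
  simp only [Function.update_self]
  apply stein (hd x)
  · exact integrable_bdd (hf.comp hu) C (fun z => hb _)
  · refine integrable_of_pow_bound (measurable_id.mul (hf.comp hu)) C 1 (fun z => ?_)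
    simp only [id, pow_one, abs_mul, Pi.mul_apply]
    rw [mul_comm]
    exact mul_le_mul_of_nonneg_right (hb _) (abs_nonneg _)
  · exact integrable_bdd (hf'.comp hu) C (fun z => hb' _)

lemma prod_abs_le_pow {κ : Type} [Fintype κ] (s : Finset κ) (f : κ → ℝ) {C : ℝ}
    (hC : 1 ≤ C) (hf : ∀ i, |f i| ≤ C) : |∏ i ∈ s, f i| ≤ C ^ (Fintype.card κ) := by
  rw [Finset.abs_prod]
  calc ∏ i ∈ s, |f i| ≤ ∏ i ∈ s, C := Finset.prod_le_prod (fun i _ => abs_nonneg _) fun i _ => hf i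
    _ = C ^ s.card := by simp
    _ ≤ _ := pow_le_pow_right₀ hC (Finset.card_le_univ s)

section interp
variable {ι κ : Type} [Fintype ι] [DecidableEq ι] [Fintype κ] [DecidableEq κ]

/-- interpolated linear form -/
def ylin (c d : κ → ι → ℝ) (θ : ℝ) (i : κ) (x : ι → ℝ) : ℝ :=
  ∑ k, (Real.sin θ * c i k + Real.cos θ * d i k) * x k

/-- derivative in `θ` of the interpolated form -/
def ylin' (c d : κ → ι → ℝ) (θ : ℝ) (i : κ) (x : ι → ℝ) : ℝ :=
  ∑ k, (Real.cos θ * c i k - Real.sin θ * d i k) * x k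

@[fun_prop]
lemma measurable_ylin (c d : κ → ι → ℝ) (θ : ℝ) (i : κ) : Measurable (ylin c d θ i) := by
  unfold ylin; fun_prop

@[fun_prop]
lemma measurable_ylin' (c d : κ → ι → ℝ) (θ : ℝ) (i : κ) : Measurable (ylin' c d θ i) := by
  unfold ylin'; fun_prop

lemma hasDerivAt_ylin (c d : κ → ι → ℝ) (θ : ℝ) (i : κ) (x : ι → ℝ) :
    HasDerivAt (fun θ => ylin c d θ i x) (ylin' c d θ i x) θ := by
  unfold ylin ylin'
  refine HasDerivAt.fun_sum fun k _ => HasDerivAt.mul_const ?_ _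
  have := ((Real.hasDerivAt_sin θ).mul_const (c i k)).add
    ((Real.hasDerivAt_cos θ).mul_const (d i k))
  refine this.congr_deriv ?_
  ring

lemma hasDerivAt_ylin_coord (c d : κ → ι → ℝ) (θ : ℝ) (i : κ) (x : ι → ℝ) (k : ι) (z : ℝ) :
    HasDerivAt (fun z => ylin c d θ i (Function.update x k z))
      (Real.sin θ * c i k + Real.cos θ * d i k) z := by
  unfold ylin
  have : ∀ z, ∑ j, (Real.sin θ * c i j + Real.cos θ * d i j) * Function.update x k z j
      = (Real.sin θ * c i k + Real.cos θ * d i k) * z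
        + ∑ j ∈ Finset.univ.erase k, (Real.sin θ * c i j + Real.cos θ * d i j) * x j := by
    intro z
    rw [← Finset.add_sum_erase _ _ (Finset.mem_univ k), Function.update_self]
    congr 1
    refine Finset.sum_congr rfl fun j hj => ?_
    rw [Function.update_of_ne (Finset.ne_of_mem_erase hj)]
  simp_rw [this]
  have := ((hasDerivAt_id z).const_mul (Real.sin θ * c i k + Real.cos θ * d i k)).add_const
    (∑ j ∈ Finset.univ.erase k, (Real.sin θ * c i j + Real.cos θ * d i j) * x j)
  simpa using this

variable (c d : κ → ι → ℝ) (h h1 h2 : κ → ℝ → ℝ) (C : ℝ)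

/-- term with two derivatives -/
def ffun (θ : ℝ) (i j : κ) (x : ι → ℝ) : ℝ :=
  h1 i (ylin c d θ i x) * (h1 j (ylin c d θ j x)
    * ∏ l ∈ (Finset.univ.erase i).erase j, h l (ylin c d θ l x))

lemma interp_hasDerivAt (hC : 1 ≤ C)
    (hd1 : ∀ i y, HasDerivAt (h i) (h1 i y) y) (hd2 : ∀ i y, HasDerivAt (h1 i) (h2 i y) y)
    (b0 : ∀ i y, |h i y| ≤ C) (b1 : ∀ i y, |h1 i y| ≤ C) (b2 : ∀ i y, |h2 i y| ≤ C)
    (m2 : ∀ i, Measurable (h2 i))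
    (hcd : ∀ i j, ∑ k, c i k * d j k = 0) (hn : ∀ i, ∑ k, c i k ^ 2 = ∑ k, d i k ^ 2) (θ : ℝ) :
    HasDerivAt (fun θ => ∫ x, ∏ i, h i (ylin c d θ i x) ∂(gI ι))
      (∑ i, ∑ j ∈ Finset.univ.erase i, Real.sin θ * Real.cos θ *
        (∑ k, c i k * c j k - ∑ k, d i k * d j k) * ∫ x, ffun c d h h1 θ i j x ∂(gI ι)) θ := by
  have m0 : ∀ i, Measurable (h i) := fun i =>
    (continuous_iff_continuousAt.2 fun x => (hd1 i x).continuousAt).measurable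
  have m1 : ∀ i, Measurable (h1 i) := fun i =>
    (continuous_iff_continuousAt.2 fun x => (hd2 i x).continuousAt).measurable
  have C0 : 0 ≤ C := by linarith
  set n := Fintype.card κ
  -- the theta-derivative
  set D : ℝ → (ι → ℝ) → ℝ := fun θ x => ∑ i, (∏ j ∈ Finset.univ.erase i, h j (ylin c d θ j x)) *
    (h1 i (ylin c d θ i x) * ylin' c d θ i x) with hD
  have hder : HasDerivAt (fun θ => ∫ x, ∏ i, h i (ylin c d θ i x) ∂(gI ι))
      (∫ x, D θ x ∂(gI ι)) θ := by
    refine (hasDerivAt_integral_of_dominated_loc_of_deriv_le (F := fun θ x =>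
      ∏ i, h i (ylin c d θ i x)) (F' := D) (s := Set.univ) (μ := gI ι)
      (bound := fun x => ∑ i, C ^ n * (C * ∑ k, (|c i k| + |d i k|) * rexp (1 * |x k|)))
      Filter.univ_mem ?_ ?_ ?_ ?_ ?_ ?_).2
    · filter_upwards with θ
      apply Measurable.aestronglyMeasurable
      exact Finset.measurable_fun_prod _ fun i _ => (m0 i).comp (measurable_ylin c d θ i)
    · refine integrable_bdd (Finset.measurable_fun_prod _ fun i _ =>
        (m0 i).comp (measurable_ylin c d θ i)) (C ^ n) fun x => ?_
      exact prod_abs_le_pow _ _ hC (fun i => b0 i _)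
    · apply Measurable.aestronglyMeasurable
      refine Finset.measurable_fun_sum _ fun i _ => Measurable.mul ?_ (Measurable.mul ?_ ?_)
      · exact Finset.measurable_fun_prod _ fun i _ => (m0 i).comp (measurable_ylin c d θ i)
      · exact (m1 i).comp (measurable_ylin c d θ i)
      · fun_prop
    · filter_upwards with x θ' _
      rw [Real.norm_eq_abs]
      refine (Finset.abs_sum_le_sum_abs _ _).trans (Finset.sum_le_sum fun i _ => ?_)
      rw [abs_mul, abs_mul]
      refine mul_le_mul (prod_abs_le_pow _ _ hC fun i => b0 i _)
        (mul_le_mul (b1 i _) ?_ (abs_nonneg _) C0) (by positivity) (by positivity)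
      unfold ylin'
      refine (Finset.abs_sum_le_sum_abs _ _).trans (Finset.sum_le_sum fun k _ => ?_)
      rw [abs_mul]
      refine mul_le_mul ?_ ?_ (abs_nonneg _) (by positivity)
      · refine (abs_sub _ _).trans (add_le_add ?_ ?_)
        · rw [abs_mul]
          exact mul_le_of_le_one_left (abs_nonneg _) (abs_cos_le_one _)
        · rw [abs_mul]
          exact mul_le_of_le_one_left (abs_nonneg _) (abs_sin_le_one _)
      · simpa using abs_pow_le_exp 1 (x k)
    · refine integrable_finsetSum _ fun i _ => Integrable.const_mul (Integrable.const_mul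
        (integrable_finsetSum _ fun k _ => ?_) _) _
      exact (integrable_exp_coord k 1).const_mul _
    · filter_upwards with x θ' _
      have := HasDerivAt.fun_finsetProd (u := Finset.univ) (f := fun i θ => h i (ylin c d θ i x))
        (f' := fun i => h1 i (ylin c d θ' i x) * ylin' c d θ' i x) (x := θ')
        (fun i _ => (hd1 i _).comp θ' (hasDerivAt_ylin c d θ' i x))
      simpa [hD, smul_eq_mul] using this
  refine hder.congr_deriv ?_
  -- Stein
  set Ψ : κ → (ι → ℝ) → ℝ := fun i x => h1 i (ylin c d θ i x) *
    ∏ j ∈ Finset.univ.erase i, h j (ylin c d θ j x) with hΨ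
  have mΨ : ∀ i, Measurable (Ψ i) := fun i => Measurable.mul
    ((m1 i).comp (measurable_ylin c d θ i))
    (Finset.measurable_fun_prod _ fun i _ => (m0 i).comp (measurable_ylin c d θ i))
  have bΨ : ∀ i x, |Ψ i x| ≤ C * C ^ n := by
    intro i x
    rw [hΨ, abs_mul]
    exact mul_le_mul (b1 i _) (prod_abs_le_pow _ _ hC fun i => b0 i _) (abs_nonneg _) C0
  set P2 : κ → (ι → ℝ) → ℝ := fun i x => h2 i (ylin c d θ i x) *
    ∏ j ∈ Finset.univ.erase i, h j (ylin c d θ j x) with hP2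
  have mP2 : ∀ i, Measurable (P2 i) := fun i => Measurable.mul
    ((m2 i).comp (measurable_ylin c d θ i))
    (Finset.measurable_fun_prod _ fun i _ => (m0 i).comp (measurable_ylin c d θ i))
  have bP2 : ∀ i x, |P2 i x| ≤ C * C ^ n := by
    intro i x
    rw [hP2, abs_mul]
    exact mul_le_mul (b2 i _) (prod_abs_le_pow _ _ hC fun i => b0 i _) (abs_nonneg _) C0
  have mff : ∀ i j, Measurable (ffun c d h h1 θ i j) := fun i j => Measurable.mul
    ((m1 i).comp (measurable_ylin c d θ i)) (Measurable.mul
    ((m1 j).comp (measurable_ylin c d θ j))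
    (Finset.measurable_fun_prod _ fun i _ => (m0 i).comp (measurable_ylin c d θ i)))
  have bff : ∀ i j x, |ffun c d h h1 θ i j x| ≤ C * (C * C ^ n) := by
    intro i j x
    rw [ffun, abs_mul, abs_mul]
    exact mul_le_mul (b1 i _) (mul_le_mul (b1 j _) (prod_abs_le_pow _ _ hC fun i => b0 i _)
      (abs_nonneg _) C0) (by positivity) C0
  set e : κ → ι → ℝ := fun i k => Real.sin θ * c i k + Real.cos θ * d i k with he
  set v : κ → ι → ℝ := fun i k => Real.cos θ * c i k - Real.sin θ * d i k with hv
  set Ψ' : κ → ι → (ι → ℝ) → ℝ := fun i k x => e i k * P2 i x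
    + ∑ j ∈ Finset.univ.erase i, e j k * ffun c d h h1 θ i j x with hΨ'
  have hst : ∀ i k, ∫ x, x k * Ψ i x ∂(gI ι) = ∫ x, Ψ' i k x ∂(gI ι) := by
    intro i k
    have B2 : ∀ x, |Ψ' i k x| ≤ |e i k| * (C * C ^ n)
      + ∑ j ∈ Finset.univ.erase i, |e j k| * (C * (C * C ^ n)) := by
      intro x
      refine (abs_add_le _ _).trans (add_le_add ?_ ((Finset.abs_sum_le_sum_abs _ _).trans
        (Finset.sum_le_sum fun j _ => ?_)))
      · rw [abs_mul]; exact mul_le_mul_of_nonneg_left (bP2 i x) (abs_nonneg _)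
      · rw [abs_mul]; exact mul_le_mul_of_nonneg_left (bff i j x) (abs_nonneg _)
    refine stein_multi k (mΨ i) ?_ (max (C * C ^ n) (|e i k| * (C * C ^ n)
      + ∑ j ∈ Finset.univ.erase i, |e j k| * (C * (C * C ^ n))))
      (fun x => (bΨ i x).trans (le_max_left _ _)) (fun x => (B2 x).trans (le_max_right _ _)) ?_
    · refine Measurable.add ((mP2 i).const_mul _)
        (Finset.measurable_fun_sum _ fun j _ => (mff i j).const_mul _)
    · intro x z
      have hy := fun j => hasDerivAt_ylin_coord c d θ j x k z
      have A := HasDerivAt.fun_finsetProd (u := Finset.univ.erase i)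
        (f := fun j z => h j (ylin c d θ j (Function.update x k z)))
        (f' := fun j => h1 j (ylin c d θ j (Function.update x k z)) * e j k) (x := z)
        (fun j _ => (hd1 j _).comp z (hy j))
      have B := ((hd2 i _).comp z (hy i)).mul A
      refine B.congr_deriv ?_
      simp only [hΨ', hP2, ffun, smul_eq_mul, Function.comp_apply]
      rw [Finset.mul_sum]
      congr 1
      · ring
      · refine Finset.sum_congr rfl fun j _ => ?_
        ring
  have hint : ∀ i k, Integrable (fun x => x k * Ψ i x) (gI ι) := fun i k =>
    integrable_coord_mul k (mΨ i) _ (bΨ i)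
  have e1 : ∫ x, D θ x ∂(gI ι) = ∑ i, ∑ k, v i k * ∫ x, x k * Ψ i x ∂(gI ι) := by
    have : ∀ x, D θ x = ∑ i, ∑ k, v i k * (x k * Ψ i x) := by
      intro x
      simp only [hD, hΨ, ylin', hv]
      refine Finset.sum_congr rfl fun i _ => ?_
      rw [Finset.mul_sum, Finset.mul_sum]
      refine Finset.sum_congr rfl fun k _ => ?_
      ring
    simp_rw [this]
    rw [integral_finsetSum _ fun i _ => integrable_finsetSum _ fun k _ =>
      (hint i k).const_mul _]
    refine Finset.sum_congr rfl fun i _ => ?_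
    rw [integral_finsetSum _ fun k _ => (hint i k).const_mul _]
    simp_rw [integral_const_mul]
  rw [e1]
  have hve : ∀ i j, ∑ k, v i k * e j k = Real.sin θ * Real.cos θ *
        (∑ k, c i k * c j k - ∑ k, d i k * d j k) := by
    intro i j
    have : ∀ k, v i k * e j k = Real.sin θ * Real.cos θ * (c i k * c j k)
        - Real.sin θ * Real.cos θ * (d i k * d j k) + Real.cos θ ^ 2 * (c i k * d j k)
        - Real.sin θ ^ 2 * (c j k * d i k) := by intro k; simp only [hv, he]; ring
    simp_rw [this]
    rw [Finset.sum_sub_distrib, Finset.sum_add_distrib, Finset.sum_sub_distrib,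
      ← Finset.mul_sum, ← Finset.mul_sum, ← Finset.mul_sum, ← Finset.mul_sum, hcd, hcd]
    ring
  have hvi : ∀ i, ∑ k, v i k * e i k = 0 := by
    intro i
    rw [hve]
    have := hn i
    simp only [sq] at this
    rw [this]; ring
  refine Finset.sum_congr rfl fun i _ => ?_
  have : ∀ k, v i k * ∫ x, x k * Ψ i x ∂(gI ι) = v i k * e i k * ∫ x, P2 i x ∂(gI ι)
      + ∑ j ∈ Finset.univ.erase i, v i k * e j k * ∫ x, ffun c d h h1 θ i j x ∂(gI ι) := by
    intro k
    rw [hst, hΨ', integral_add ((integrable_bdd (mP2 i) _ (bP2 i)).const_mul _)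
      (integrable_finsetSum _ fun j _ => (integrable_bdd (mff i j) _ (bff i j)).const_mul _),
      integral_finsetSum _ fun j _ => (integrable_bdd (mff i j) _ (bff i j)).const_mul _]
    simp_rw [integral_const_mul]
    rw [mul_add, Finset.mul_sum, ← mul_assoc]
    simp_rw [mul_assoc]
  simp_rw [this]
  rw [Finset.sum_add_distrib, ← Finset.sum_mul, hvi, zero_mul, zero_add, Finset.sum_comm]
  refine Finset.sum_congr rfl fun j _ => ?_
  rw [← Finset.sum_mul, hve]

end interp

/-! ### Slepian's inequality -/

lemma bounded_of_zero_outside {f : ℝ → ℝ} (hf : Continuous f) (h0 : ∀ x < 0, f x = 0)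
    (h1 : ∀ x > 1, f x = 0) : ∃ C, ∀ x, |f x| ≤ C := by
  obtain ⟨C, hC⟩ := isCompact_Icc.exists_bound_of_continuousOn (s := Set.Icc (0:ℝ) 1) hf.continuousOn
  refine ⟨C, fun x => ?_⟩
  have hC0 : 0 ≤ C := (norm_nonneg _).trans (hC 0 (by simp))
  by_cases a : x < 0
  · rw [h0 x a]; simpa
  · by_cases b : x > 1
    · rw [h1 x b]; simpa
    · exact hC x ⟨by linarith, by linarith⟩

lemma smooth_cutoff (δ : ℝ) (hδ : 0 < δ) : ∃ (h h1 h2 : ℝ → ℝ) (C : ℝ), 1 ≤ C ∧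
    (∀ y, HasDerivAt h (h1 y) y) ∧ (∀ y, HasDerivAt h1 (h2 y) y) ∧ (∀ y, |h y| ≤ C) ∧
    (∀ y, |h1 y| ≤ C) ∧ (∀ y, |h2 y| ≤ C) ∧ Measurable h2 ∧ (∀ y, h1 y ≤ 0) ∧
    (∀ y, 0 ≤ h y) ∧ (∀ y, h y ≤ 1) ∧ (∀ y ≤ 0, h y = 1) ∧ (∀ y, δ ≤ y → h y = 0) := by
  set s := Real.smoothTransition with hs
  have cs : ContDiff ℝ (2 : ℕ) s := Real.smoothTransition.contDiff (n := 2)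
  have cs1 : ContDiff ℝ (1 : ℕ) (deriv s) := by
    have := (contDiff_succ_iff_deriv (n := 1) (f := s)).1 (by exact_mod_cast cs)
    exact this.2.2
  have cs2 : Continuous (deriv (deriv s)) := cs1.continuous_deriv (by norm_num)
  have d1 : ∀ y, HasDerivAt s (deriv s y) y := fun y =>
    (cs.differentiable (by norm_num)).differentiableAt.hasDerivAt
  have d2 : ∀ y, HasDerivAt (deriv s) (deriv (deriv s) y) y := fun y =>
    (cs1.differentiable (by norm_num)).differentiableAt.hasDerivAt
  have z0 : ∀ x < 0, deriv s x = 0 := by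
    intro x hx
    have : s =ᶠ[nhds x] fun _ => 0 := by
      filter_upwards [Iio_mem_nhds hx] with y hy
      exact Real.smoothTransition.zero_of_nonpos (le_of_lt hy)
    rw [this.deriv_eq]; simp
  have z1 : ∀ x > 1, deriv s x = 0 := by
    intro x hx
    have : s =ᶠ[nhds x] fun _ => 1 := by
      filter_upwards [Ioi_mem_nhds hx] with y hy
      exact Real.smoothTransition.one_of_one_le (le_of_lt hy)
    rw [this.deriv_eq]; simp
  have w0 : ∀ x < 0, deriv (deriv s) x = 0 := by
    intro x hx
    have : deriv s =ᶠ[nhds x] fun _ => 0 := by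
      filter_upwards [Iio_mem_nhds hx] with y hy using z0 y hy
    rw [this.deriv_eq]; simp
  have w1 : ∀ x > 1, deriv (deriv s) x = 0 := by
    intro x hx
    have : deriv s =ᶠ[nhds x] fun _ => 0 := by
      filter_upwards [Ioi_mem_nhds hx] with y hy using z1 y hy
    rw [this.deriv_eq]; simp
  obtain ⟨C1, hC1⟩ := bounded_of_zero_outside cs1.continuous z0 z1
  obtain ⟨C2, hC2⟩ := bounded_of_zero_outside cs2 w0 w1
  have lin : ∀ y, HasDerivAt (fun y : ℝ => 1 - y / δ) (-(1 / δ)) y := fun y => by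
    simpa using ((hasDerivAt_id y).div_const δ).const_sub 1
  refine ⟨fun y => s (1 - y / δ), fun y => deriv s (1 - y / δ) * (-(1 / δ)),
    fun y => deriv (deriv s) (1 - y / δ) * (-(1 / δ)) * (-(1 / δ)),
    max 1 (max (C1 * (1 / δ)) (C2 * (1 / δ) * (1 / δ))), le_max_left _ _, ?_, ?_, ?_, ?_, ?_, ?_,
    ?_, ?_, ?_, ?_, ?_⟩
  · exact fun y => (d1 _).comp y (lin y)
  · exact fun y => ((d2 _).comp y (lin y)).mul_const _
  · intro y
    rw [abs_of_nonneg (Real.smoothTransition.nonneg _)]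
    exact (Real.smoothTransition.le_one _).trans (le_max_left _ _)
  · intro y
    rw [abs_mul, abs_neg, abs_of_pos (by positivity : 0 < 1 / δ)]
    exact (mul_le_mul_of_nonneg_right (hC1 _) (by positivity)).trans
      ((le_max_left _ _).trans (le_max_right _ _))
  · intro y
    rw [abs_mul, abs_mul, abs_neg, abs_of_pos (by positivity : 0 < 1 / δ)]
    exact (mul_le_mul_of_nonneg_right (mul_le_mul_of_nonneg_right (hC2 _) (by positivity))
      (by positivity)).trans ((le_max_right _ _).trans (le_max_right _ _))
  · have := cs2.measurable
    fun_prop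
  · intro y
    have : 0 ≤ deriv s (1 - y / δ) := Real.smoothTransition.monotone.deriv_nonneg
    have : 0 < 1 / δ := by positivity
    nlinarith
  · exact fun y => Real.smoothTransition.nonneg _
  · exact fun y => Real.smoothTransition.le_one _
  · intro y hy
    apply Real.smoothTransition.one_of_one_le
    have : y / δ ≤ 0 := div_nonpos_of_nonpos_of_nonneg hy hδ.le
    linarith
  · intro y hy
    apply Real.smoothTransition.zero_of_nonpos
    have : 1 ≤ y / δ := (one_le_div hδ).2 hy
    linarith

lemma slepian {ι κ : Type} [Fintype ι] [Fintype κ] (c d : κ → ι → ℝ) (τ : κ → ℝ)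
    (hcd : ∀ i j, ∑ k, c i k * d j k = 0) (hn : ∀ i, ∑ k, c i k ^ 2 = ∑ k, d i k ^ 2)
    (hle : ∀ i j, ∑ k, d i k * d j k ≤ ∑ k, c i k * c j k) (δ : ℝ) (hδ : 0 < δ) :
    (gI ι) {x | ∃ i, τ i + δ < ∑ k, c i k * x k} ≤ (gI ι) {x | ∃ i, τ i < ∑ k, d i k * x k} := by
  classical
  obtain ⟨h, h1, h2, C, hC, hd1, hd2, b0, b1, b2, m2, neg, pos, le1, one, zero⟩ :=
    smooth_cutoff δ hδ
  set F := fun θ => ∫ x, ∏ i, h (ylin c d θ i x - τ i) ∂(gI ι) with hF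
  have hder := fun θ => interp_hasDerivAt c d (fun i y => h (y - τ i)) (fun i y => h1 (y - τ i))
    (fun i y => h2 (y - τ i)) C hC
    (fun i y => (hd1 (y - τ i)).comp_sub_const y (τ i))
    (fun i y => (hd2 (y - τ i)).comp_sub_const y (τ i))
    (fun i y => b0 _) (fun i y => b1 _) (fun i y => b2 _) (fun i => by fun_prop) hcd hn θ
  have hmono : F 0 ≤ F (π / 2) := by
    have : MonotoneOn F (Set.Icc 0 (π / 2)) := by
      apply monotoneOn_of_deriv_nonneg (convex_Icc _ _)
      · exact fun θ _ => (hder θ).continuousAt.continuousWithinAt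
      · exact fun θ _ => (hder θ).differentiableAt.differentiableWithinAt
      · intro θ hθ
        rw [interior_Icc] at hθ
        rw [(hder θ).deriv]
        refine Finset.sum_nonneg fun i _ => Finset.sum_nonneg fun j _ => ?_
        refine mul_nonneg (mul_nonneg (mul_nonneg ?_ ?_) ?_) ?_
        · exact sin_nonneg_of_nonneg_of_le_pi hθ.1.le (by linarith [hθ.2, pi_pos])
        · exact cos_nonneg_of_neg_pi_div_two_le_of_le (by linarith [hθ.1, pi_pos]) hθ.2.le
        · exact sub_nonneg.2 (hle i j)
        · apply integral_nonneg
          intro x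
          simp only [ffun, Pi.zero_apply]
          rw [← mul_assoc]
          exact mul_nonneg (mul_nonneg_of_nonpos_of_nonpos (neg _) (neg _))
            (Finset.prod_nonneg fun l _ => pos _)
    exact this ⟨le_rfl, by positivity⟩ ⟨by positivity, le_rfl⟩ (by positivity)
  have mh : Measurable h :=
    (continuous_iff_continuousAt.2 fun x => (hd1 x).continuousAt).measurable
  have mA : MeasurableSet {x : ι → ℝ | ∃ i, τ i + δ < ∑ k, c i k * x k} := by
    have : {x : ι → ℝ | ∃ i, τ i + δ < ∑ k, c i k * x k}
      = ⋃ i, {x : ι → ℝ | τ i + δ < ∑ k, c i k * x k} := by ext x; simp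
    rw [this]
    exact MeasurableSet.iUnion fun i => measurableSet_lt measurable_const (by fun_prop)
  have mB : MeasurableSet {x : ι → ℝ | ∃ i, τ i < ∑ k, d i k * x k} := by
    have : {x : ι → ℝ | ∃ i, τ i < ∑ k, d i k * x k}
      = ⋃ i, {x : ι → ℝ | τ i < ∑ k, d i k * x k} := by ext x; simp
    rw [this]
    exact MeasurableSet.iUnion fun i => measurableSet_lt measurable_const (by fun_prop)
  have int : ∀ θ, Integrable (fun x => ∏ i, h (ylin c d θ i x - τ i)) (gI ι) := fun θ => by
    refine integrable_bdd (by fun_prop) 1 fun x => ?_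
    rw [abs_of_nonneg (Finset.prod_nonneg fun i _ => pos _)]
    exact Finset.prod_le_one (fun i _ => pos _) fun i _ => le1 _
  have up : F (π / 2) ≤ (gI ι).real {x | ∃ i, τ i + δ < ∑ k, c i k * x k}ᶜ := by
    rw [← integral_indicator_one mA.compl]
    refine integral_mono (int _) ((integrable_const (1:ℝ)).indicator mA.compl) fun x => ?_
    by_cases hx : x ∈ {x | ∃ i, τ i + δ < ∑ k, c i k * x k}
    · rw [Set.indicator_of_notMem (by simpa using hx)]
      obtain ⟨i, hi⟩ := hx
      refine le_of_eq (Finset.prod_eq_zero (Finset.mem_univ i) (zero _ ?_))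
      simp only [ylin, Real.sin_pi_div_two, Real.cos_pi_div_two, one_mul, zero_mul, add_zero]
      linarith
    · rw [Set.indicator_of_mem (by simpa using hx)]
      exact Finset.prod_le_one (fun i _ => pos _) fun i _ => le1 _
  have lo : (gI ι).real {x | ∃ i, τ i < ∑ k, d i k * x k}ᶜ ≤ F 0 := by
    rw [← integral_indicator_one mB.compl]
    refine integral_mono ((integrable_const (1:ℝ)).indicator mB.compl) (int _) fun x => ?_
    by_cases hx : x ∈ {x | ∃ i, τ i < ∑ k, d i k * x k}
    · rw [Set.indicator_of_notMem (by simpa using hx)]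
      exact Finset.prod_nonneg fun i _ => pos _
    · rw [Set.indicator_of_mem (by simpa using hx)]
      simp only [Set.mem_setOf_eq, not_exists, not_lt] at hx
      refine le_of_eq (Finset.prod_eq_one fun i _ => one _ ?_).symm
      simp only [ylin, Real.sin_zero, Real.cos_zero, one_mul, zero_mul, zero_add]
      linarith [hx i]
  have := lo.trans (hmono.trans up)
  rw [probReal_compl_eq_one_sub mA, probReal_compl_eq_one_sub mB] at this
  have h3 : (gI ι).real {x | ∃ i, τ i + δ < ∑ k, c i k * x k}
    ≤ (gI ι).real {x | ∃ i, τ i < ∑ k, d i k * x k} := by linarith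
  exact (ENNReal.toReal_le_toReal (measure_ne_top _ _) (measure_ne_top _ _)).1 h3

/-! ### Slepian for the GOE quadratic form -/

lemma map_precomp_gI {ι ι' : Type} (e : ι' → ι) (he : Function.Injective e) :
    (gI ι).map (fun x j => x (e j)) = gI ι' := by
  classical
  apply Measure.eq_infinitePi
  intro s t ht
  rw [Measure.map_apply (by fun_prop) (MeasurableSet.pi s.countable_toSet (fun i _ => ht i))]
  set t' : ι → Set ℝ := Function.extend e t (fun _ => Set.univ) with ht'
  have : (fun (x : ι → ℝ) j => x (e j)) ⁻¹' ((s : Set ι').pi t)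
      = ((s.map ⟨e, he⟩ : Finset ι) : Set ι).pi t' := by
    ext x
    simp [Set.mem_pi, ht', he.extend_apply]
  rw [this, Measure.infinitePi_pi]
  · rw [Finset.prod_map]
    simp [ht', he.extend_apply]
  · intro i hi
    obtain ⟨j, _, rfl⟩ := Finset.mem_map.1 hi
    simpa [ht', he.extend_apply] using ht j

/-- GOE matrix built from iid Gaussians -/
def Xmat {N : ℕ} (Y : Fin N × Fin N → ℝ) (i j : Fin N) : ℝ := (Y (i, j) + Y (j, i)) / √2

/-- quadratic form -/
def qf {N : ℕ} (A : Fin N → Fin N → ℝ) (x : Fin N → ℝ) : ℝ := ∑ i, ∑ j, A i j * x i * x j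

lemma qf_Xmat {N : ℕ} (Y : Fin N × Fin N → ℝ) (x : Fin N → ℝ) :
    qf (Xmat Y) x = ∑ p : Fin N × Fin N, √2 * x p.1 * x p.2 * Y p := by
  have h2 : √2 * √2 = 2 := Real.mul_self_sqrt (by norm_num)
  have h0 : √2 ≠ 0 := by positivity
  rw [Fintype.sum_prod_type]
  have e : qf (Xmat Y) x = (∑ i, ∑ j, Y (i, j) * x i * x j) / √2
      + (∑ i, ∑ j, Y (j, i) * x i * x j) / √2 := by
    rw [qf, ← add_div, ← Finset.sum_add_distrib, Finset.sum_div]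
    refine Finset.sum_congr rfl fun i _ => ?_
    rw [← Finset.sum_add_distrib, Finset.sum_div]
    refine Finset.sum_congr rfl fun j _ => ?_
    simp only [Xmat]; ring
  have e2 : (∑ i, ∑ j, Y (j, i) * x i * x j) = ∑ i, ∑ j, Y (i, j) * x i * x j := by
    rw [Finset.sum_comm]
    refine Finset.sum_congr rfl fun i _ => Finset.sum_congr rfl fun j _ => ?_
    ring
  rw [e, e2, ← add_div, Finset.sum_congr rfl fun i _ => Finset.sum_congr rfl fun j _ =>
    (by ring : √2 * x i * x j * Y (i, j) = √2 * (Y (i, j) * x i * x j))]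
  simp_rw [← Finset.mul_sum]
  rw [div_eq_iff h0]
  linear_combination (-∑ i, ∑ j, Y (i, j) * x i * x j) * h2

lemma slepian_goe_fin {N : ℕ} {κ : Type} [Fintype κ] (x : κ → Fin N → ℝ)
    (hx : ∀ i, ∑ k, x i k ^ 2 ≤ 1) (τ : κ → ℝ) (r δ : ℝ) (hδ : 0 < δ) :
    (gI (Fin N × Fin N)) {Y | ∃ i, τ i + 2 * δ < r * qf (Xmat Y) (x i)}
      ≤ (gI (Fin N)) {z | ∃ i, τ i < 2 * r * √(∑ k, x i k ^ 2) * ∑ k, z k * x i k}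
        + gm {ξ | δ < √2 * |r| * |ξ|} := by
  classical
  have h2 : √2 * √2 = 2 := Real.mul_self_sqrt (by norm_num)
  set n : κ → ℝ := fun i => √(∑ k, x i k ^ 2) with hn
  have hnsq : ∀ i, n i * n i = ∑ k, x i k ^ 2 := fun i =>
    Real.mul_self_sqrt (Finset.sum_nonneg fun k _ => sq_nonneg _)
  set c : κ → ((Fin N × Fin N) ⊕ Unit ⊕ Fin N) → ℝ := fun i => Sum.elim (fun p => r * (√2 * x i p.1 * x i p.2))
    (Sum.elim (fun _ => r * √2 * (n i * n i)) (fun _ => 0)) with hc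
  set d : κ → ((Fin N × Fin N) ⊕ Unit ⊕ Fin N) → ℝ := fun i => Sum.elim (fun p => 0)
    (Sum.elim (fun _ => 0) (fun k => 2 * r * n i * x i k)) with hd
  have gc : ∀ i j, ∑ k, c i k * c j k = 2 * r ^ 2 * (∑ k, x i k * x j k) ^ 2
      + 2 * r ^ 2 * (n i * n j) ^ 2 := by
    intro i j
    simp only [hc, Fintype.sum_sum_type, Sum.elim_inl, Sum.elim_inr, Finset.univ_unique,
      Finset.sum_singleton, Fintype.sum_prod_type, mul_zero, Finset.sum_const_zero, add_zero]
    congr 1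
    · rw [sq (∑ k, x i k * x j k), Finset.sum_mul_sum, Finset.mul_sum]
      refine Finset.sum_congr rfl fun a _ => ?_
      rw [Finset.mul_sum]
      refine Finset.sum_congr rfl fun b _ => ?_
      linear_combination (r ^ 2 * x i a * x i b * x j a * x j b) * h2
    · linear_combination (r ^ 2 * n i ^ 2 * n j ^ 2) * h2
  have gd : ∀ i j, ∑ k, d i k * d j k = 4 * r ^ 2 * (n i * n j) * (∑ k, x i k * x j k) := by
    intro i j
    simp only [hd, Fintype.sum_sum_type, Sum.elim_inl, Sum.elim_inr, Finset.univ_unique,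
      Finset.sum_singleton, Finset.sum_const_zero, zero_add, mul_zero, Finset.mul_sum]
    refine Finset.sum_congr rfl fun a _ => ?_
    ring
  have xx : ∀ i, ∑ k, x i k * x i k = n i * n i := by
    intro i; rw [hnsq]; simp [sq]
  have S := slepian c d τ (by intro i j; simp [hc, hd, Fintype.sum_sum_type])
    (by
      intro i
      have a := gc i i; have b := gd i i
      simp_rw [sq] at a b ⊢
      rw [a, b, xx]; ring)
    (by
      intro i j
      rw [gc, gd]
      nlinarith [mul_nonneg (sq_nonneg r) (sq_nonneg (∑ k, x i k * x j k - n i * n j))]) δ hδ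
  have L1 : (gI (Fin N × Fin N)) {Y | ∃ i, τ i + 2 * δ < r * qf (Xmat Y) (x i)}
      = (gI ((Fin N × Fin N) ⊕ Unit ⊕ Fin N)) {w | ∃ i, τ i + 2 * δ < r * qf (Xmat (fun p => w (Sum.inl p))) (x i)} := by
    rw [← map_precomp_gI (ι := ((Fin N × Fin N) ⊕ Unit ⊕ Fin N)) (ι' := Fin N × Fin N) Sum.inl Sum.inl_injective,
      Measure.map_apply (by fun_prop)]
    · rfl
    · rw [show {Y : Fin N × Fin N → ℝ | ∃ i, τ i + 2 * δ < r * qf (Xmat Y) (x i)}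
        = ⋃ i, {Y | τ i + 2 * δ < r * qf (Xmat Y) (x i)} by ext; simp]
      refine MeasurableSet.iUnion fun i => measurableSet_lt measurable_const ?_
      simp_rw [qf_Xmat]; fun_prop
  have L2 : (gI (Fin N)) {z | ∃ i, τ i < 2 * r * √(∑ k, x i k ^ 2) * ∑ k, z k * x i k}
      = (gI ((Fin N × Fin N) ⊕ Unit ⊕ Fin N)) {w | ∃ i, τ i < ∑ k, d i k * w k} := by
    rw [← map_precomp_gI (ι := ((Fin N × Fin N) ⊕ Unit ⊕ Fin N)) (ι' := Fin N) (fun k => Sum.inr (Sum.inr k))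
      (fun a b h => Sum.inr_injective (Sum.inr_injective h)),
      Measure.map_apply (by fun_prop)]
    · congr 1
      ext w
      simp only [Set.mem_preimage, Set.mem_setOf_eq, hd, Fintype.sum_sum_type, Sum.elim_inl,
        Sum.elim_inr, zero_mul, Finset.sum_const_zero, zero_add]
      refine exists_congr fun i => ?_
      rw [Finset.mul_sum]
      have : ∀ k, 2 * r * √(∑ k, x i k ^ 2) * (w (Sum.inr (Sum.inr k)) * x i k)
        = 2 * r * n i * x i k * w (Sum.inr (Sum.inr k)) := by intro k; simp only [hn]; ring
      simp_rw [this]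
    · rw [show {z : Fin N → ℝ | ∃ i, τ i < 2 * r * √(∑ k, x i k ^ 2) * ∑ k, z k * x i k}
        = ⋃ i, {z | τ i < 2 * r * √(∑ k, x i k ^ 2) * ∑ k, z k * x i k} by ext; simp]
      exact MeasurableSet.iUnion fun i => measurableSet_lt measurable_const (by fun_prop)
  have L3 : gm {ξ | δ < √2 * |r| * |ξ|} = (gI ((Fin N × Fin N) ⊕ Unit ⊕ Fin N)) {w | δ < √2 * |r| * |w (Sum.inr (Sum.inl ()))|} := by
    have := Measure.infinitePi_map_eval (fun _ : ((Fin N × Fin N) ⊕ Unit ⊕ Fin N) => gm) (Sum.inr (Sum.inl ()))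
    conv_lhs => rw [← this]
    rw [Measure.map_apply (measurable_pi_apply _) (measurableSet_lt measurable_const (by fun_prop))]
    rfl
  rw [L1, L2, L3]
  refine (measure_mono ?_).trans ((measure_union_le _ _).trans (add_le_add_left S _))
  rintro w ⟨i, hi⟩
  by_cases hw : δ < √2 * |r| * |w (Sum.inr (Sum.inl ()))|
  · exact Or.inr hw
  · left
    refine ⟨i, ?_⟩
    simp only [hc, Fintype.sum_sum_type, Sum.elim_inl, Sum.elim_inr, Finset.univ_unique,
      Finset.sum_singleton, zero_mul, Finset.sum_const_zero, add_zero]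
    rw [qf_Xmat, Finset.mul_sum] at hi
    have e1 : ∑ p : Fin N × Fin N, r * (√2 * x i p.1 * x i p.2) * w (Sum.inl p)
      = ∑ p : Fin N × Fin N, r * (√2 * x i p.1 * x i p.2 * w (Sum.inl p)) :=
      Finset.sum_congr rfl fun p _ => by ring
    rw [e1]
    have h1 : n i * n i ≤ 1 := (hnsq i).le.trans (hx i)
    have h3 : 0 ≤ n i * n i := mul_self_nonneg _
    have h4 : |r * √2 * (n i * n i) * w (Sum.inr (Sum.inl default))| ≤ δ := by
      rw [abs_mul, abs_mul, abs_mul, abs_of_nonneg h3, abs_of_nonneg (Real.sqrt_nonneg 2)]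
      refine le_trans ?_ (not_lt.1 hw)
      have : 0 ≤ √2 * |r| * |w (Sum.inr (Sum.inl ()))| := by positivity
      calc |r| * √2 * (n i * n i) * |w (Sum.inr (Sum.inl default))|
          = (√2 * |r| * |w (Sum.inr (Sum.inl ()))|) * (n i * n i) := by
            rw [show (default : Unit) = () from rfl]; ring
        _ ≤ (√2 * |r| * |w (Sum.inr (Sum.inl ()))|) * 1 := by gcongr
        _ = _ := mul_one _
    have := (abs_le.1 h4).1
    linarith

lemma slepian_goe {N : ℕ} (x : ℕ → Fin N → ℝ) (p : ℕ → Prop)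
    (hx : ∀ i, ∑ k, x i k ^ 2 ≤ 1) (τ : ℕ → ℝ) (r δ : ℝ) (hδ : 0 < δ) :
    (gI (Fin N × Fin N)) {Y | ∃ i, p i ∧ τ i + 2 * δ < r * qf (Xmat Y) (x i)}
      ≤ (gI (Fin N)) {z | ∃ i, p i ∧ τ i < 2 * r * √(∑ k, x i k ^ 2) * ∑ k, z k * x i k}
        + gm {ξ | δ < √2 * |r| * |ξ|} := by
  classical
  have : {Y : Fin N × Fin N → ℝ | ∃ i, p i ∧ τ i + 2 * δ < r * qf (Xmat Y) (x i)}
    = ⋃ n : ℕ, {Y | ∃ i : {i : Fin n // p i}, τ i + 2 * δ < r * qf (Xmat Y) (x i)} := by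
    ext Y
    simp only [Set.mem_setOf_eq, Set.mem_iUnion]
    constructor
    · rintro ⟨i, hp, hi⟩
      exact ⟨i + 1, ⟨⟨i, Nat.lt_succ_self i⟩, hp⟩, hi⟩
    · rintro ⟨n, ⟨i, hp⟩, hi⟩
      exact ⟨i, hp, hi⟩
  rw [this, Monotone.measure_iUnion]
  · refine iSup_le fun n => ?_
    refine (slepian_goe_fin (κ := {i : Fin n // p i}) (fun i => x i) (fun i => hx i)
      (fun i => τ i) r δ hδ).trans (add_le_add_left (measure_mono ?_) _)
    rintro z ⟨⟨i, hp⟩, hi⟩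
    exact ⟨i, hp, hi⟩
  · intro n m hnm Y
    rintro ⟨⟨i, hp⟩, hi⟩
    exact ⟨⟨⟨i, lt_of_lt_of_le i.2 hnm⟩, hp⟩, hi⟩

/-! ### The function psi -/

lemma measurable_tanh_comp {α : Type*} [MeasurableSpace α] {f : α → ℝ} (hf : Measurable f) :
    Measurable (fun x => Real.tanh (f x)) := measurable_tanh.comp hf

lemma integral_law2 {ι ι' : Type} (S : Finset ι) (S' : Finset ι') (a b : ι → ℝ) (a' b' : ι' → ℝ)
    (haa : ∑ s ∈ S, a s * a s = ∑ s ∈ S', a' s * a' s)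
    (hbb : ∑ s ∈ S, b s * b s = ∑ s ∈ S', b' s * b' s)
    (hab : ∑ s ∈ S, a s * b s = ∑ s ∈ S', a' s * b' s)
    (f : ℝ → ℝ → ℝ) (hf : Measurable (fun p : ℝ × ℝ => f p.1 p.2)) :
    ∫ x, f (∑ s ∈ S, a s * x s) (∑ s ∈ S, b s * x s) ∂(gI ι)
      = ∫ x, f (∑ s ∈ S', a' s * x s) (∑ s ∈ S', b' s * x s) ∂(gI ι') := by
  have key := law_eq (κ := Fin 2) S S' ![a, b] ![a', b'] (by
    have hba : ∑ s ∈ S, b s * a s = ∑ s ∈ S', b' s * a' s := by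
      simpa only [mul_comm] using hab
    intro k l
    fin_cases k <;> fin_cases l <;> simpa)
  have hF : Measurable (fun y : Fin 2 → ℝ => f (y 0) (y 1)) :=
    hf.comp (g := fun p : ℝ × ℝ => f p.1 p.2) (f := fun y : Fin 2 → ℝ => (y 0, y 1)) (by fun_prop)
  have e := congrArg (fun μ => ∫ y, f (y 0) (y 1) ∂μ) key
  have mm : ∀ {κ : Type} (T : Finset κ) (v : Fin 2 → κ → ℝ),
      Measurable (fun (x : κ → ℝ) k => ∑ s ∈ T, v k s * x s) := by
    intro κ T v; fun_prop
  rw [integral_map (mm _ _).aemeasurable hF.aestronglyMeasurable,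
    integral_map (mm _ _).aemeasurable hF.aestronglyMeasurable] at e
  simpa using e

lemma integral_law1 {ι : Type} (S : Finset ι) (a : ι → ℝ) {q : ℝ} (hq : 0 ≤ q)
    (haa : ∑ s ∈ S, a s * a s = q) (f : ℝ → ℝ) (hf : Measurable f) :
    ∫ x, f (∑ s ∈ S, a s * x s) ∂(gI ι) = ∫ z, f (√q * z) ∂gm := by
  have := integral_law2 S (Finset.univ : Finset Unit) a a (fun _ => √q) (fun _ => √q)
    (by simp [haa, Real.mul_self_sqrt hq]) (by simp [haa, Real.mul_self_sqrt hq])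
    (by simp [haa, Real.mul_self_sqrt hq]) (fun x _ => f x) (by fun_prop)
  rw [this]
  simp only [Finset.univ_unique, Finset.sum_singleton]
  exact integral_coord (ι := Unit) default (f := fun z => f (√q * z)) (by fun_prop)

lemma integral_three (f : ℝ → ℝ → ℝ → ℝ)
    (hf : Measurable (fun p : ℝ × ℝ × ℝ => f p.1 p.2.1 p.2.2)) (C : ℝ)
    (hb : ∀ x y z, |f x y z| ≤ C) :
    ∫ x, f (x 0) (x 1) (x 2) ∂(gI (Fin 3)) = ∫ z, ∫ z', ∫ z'', f z z' z'' ∂gm ∂gm ∂gm := by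
  have bint : ∀ {g : ℝ → ℝ}, (∀ x, |g x| ≤ C) → |∫ x, g x ∂gm| ≤ C := by
    intro g hg
    have := norm_integral_le_of_norm_le_const (μ := gm) (f := g) (C := C)
      (by filter_upwards with x using hg x)
    simpa using this
  have m1 : Measurable (fun p : ℝ × ℝ => ∫ z'', f p.1 p.2 z'' ∂gm) := by
    have h1 : Measurable (fun p : (ℝ × ℝ) × ℝ => f p.1.1 p.1.2 p.2) :=
      hf.comp (g := fun p : ℝ × ℝ × ℝ => f p.1 p.2.1 p.2.2)
        (f := fun p : (ℝ × ℝ) × ℝ => (p.1.1, p.1.2, p.2)) (by fun_prop)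
    exact (h1.stronglyMeasurable.integral_prod_right (ν := gm)).measurable
  have m2 : Measurable (fun z : ℝ => ∫ z', ∫ z'', f z z' z'' ∂gm ∂gm) :=
    (m1.stronglyMeasurable.integral_prod_right (ν := gm)).measurable
  have mf : Measurable (fun x : Fin 3 → ℝ => f (x 0) (x 1) (x 2)) :=
    hf.comp (g := fun p : ℝ × ℝ × ℝ => f p.1 p.2.1 p.2.2)
      (f := fun x : Fin 3 → ℝ => (x 0, x 1, x 2)) (by fun_prop)
  rw [integral_update (2 : Fin 3) (integrable_bdd mf C fun x => hb _ _ _)]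
  simp only [Function.update_self, ne_eq, Fin.reduceEq, not_false_eq_true, Function.update_of_ne]
  rw [integral_update (1 : Fin 3) (f := fun x : Fin 3 → ℝ => ∫ z, f (x 0) (x 1) z ∂gm)
    (integrable_bdd (m1.comp (f := fun x : Fin 3 → ℝ => (x 0, x 1)) (by fun_prop)) C
      fun x => bint fun z => hb _ _ _)]
  simp only [Function.update_self, ne_eq, Fin.reduceEq, not_false_eq_true, Function.update_of_ne]
  exact integral_coord (0 : Fin 3) m2

lemma psi_eq {ι : Type} (β h q t : ℝ) (h0 : 0 ≤ t) (htq : t ≤ q) (S : Finset ι) (a b : ι → ℝ)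
    (haa : ∑ s ∈ S, a s * a s = q) (hbb : ∑ s ∈ S, b s * b s = q)
    (hab : ∑ s ∈ S, a s * b s = t) :
    ∫ x, Real.tanh (h + β * ∑ s ∈ S, a s * x s) * Real.tanh (h + β * ∑ s ∈ S, b s * x s) ∂(gI ι)
      = psiFun β h q t := by
  have s1 : √t * √t = t := Real.mul_self_sqrt h0
  have s2 : √(q - t) * √(q - t) = q - t := Real.mul_self_sqrt (by linarith)
  rw [integral_law2 S (Finset.univ : Finset (Fin 3)) a b ![√t, √(q-t), 0] ![√t, 0, √(q-t)]
    (by rw [haa]; simp [Fin.sum_univ_three, s1, s2])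
    (by rw [hbb]; simp [Fin.sum_univ_three, s1, s2])
    (by rw [hab]; simp [Fin.sum_univ_three, s1])
    (fun x y => Real.tanh (h + β * x) * Real.tanh (h + β * y))
    (by
      exact (measurable_tanh_comp (by fun_prop)).mul (measurable_tanh_comp (by fun_prop)))]
  unfold psiFun
  rw [← integral_three (fun z z' z'' =>
      Real.tanh (h + β * Real.sqrt t * z + β * Real.sqrt (q - t) * z')
        * Real.tanh (h + β * Real.sqrt t * z + β * Real.sqrt (q - t) * z''))
    ((measurable_tanh_comp (by fun_prop)).mul (measurable_tanh_comp (by fun_prop))) 1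
    (fun x y z => by
      rw [abs_mul]
      exact mul_le_one₀ (tanh_abs_le_one _) (abs_nonneg _) (tanh_abs_le_one _))]
  congr 1
  ext x
  simp only [Fin.sum_univ_three, Matrix.cons_val_zero, Matrix.cons_val_one, Matrix.cons_val]
  congr 2 <;> ring

lemma psi_nonneg (β h q t : ℝ) : 0 ≤ psiFun β h q t := by
  unfold psiFun
  refine integral_nonneg fun z => ?_
  simp_rw [integral_const_mul, integral_mul_const]
  exact mul_self_nonneg _

/-- `E sech⁴`. -/
def Bc (β h q : ℝ) : ℝ := ∫ z, (1 - Real.tanh (h + β * (√q * z)) ^ 2) ^ 2 ∂gm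

lemma AT_Bc {β h q : ℝ} (hAT : ATcond β h q) : β ^ 2 * Bc β h q < 1 := by
  unfold ATcond at hAT
  convert hAT using 4
  unfold Bc
  congr 1
  ext z
  rw [← sech_sq, ← pow_mul, mul_assoc]

lemma qfix {β h q : ℝ} (hq : isFixedq β h q) : ∫ z, Real.tanh (h + β * (√q * z)) ^ 2 ∂gm = q := by
  have := hq.2.2
  conv_rhs => rw [this]
  unfold qtanh
  congr 1
  ext z
  rw [mul_assoc]

lemma psi_le {β h q t : ℝ} (hq : isFixedq β h q) (h0 : 0 ≤ t) (htq : t ≤ q) :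
    psiFun β h q t ≤ q := by
  have s1 : √t * √t = t := Real.mul_self_sqrt h0
  have s2 : √(q - t) * √(q - t) = q - t := Real.mul_self_sqrt (by linarith)
  have haa : ∑ s ∈ (Finset.univ : Finset (Fin 3)), (![√t, √(q-t), 0] : Fin 3 → ℝ) s * (![√t, √(q-t), 0] : Fin 3 → ℝ) s = q := by
    simp [Fin.sum_univ_three, s1, s2]
  have hbb : ∑ s ∈ (Finset.univ : Finset (Fin 3)), (![√t, 0, √(q-t)] : Fin 3 → ℝ) s * (![√t, 0, √(q-t)] : Fin 3 → ℝ) s = q := by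
    simp [Fin.sum_univ_three, s1, s2]
  have hab : ∑ s ∈ (Finset.univ : Finset (Fin 3)), (![√t, √(q-t), 0] : Fin 3 → ℝ) s * (![√t, 0, √(q-t)] : Fin 3 → ℝ) s = t := by
    simp [Fin.sum_univ_three, s1]
  set a : Fin 3 → ℝ := ![√t, √(q-t), 0]
  set b : Fin 3 → ℝ := ![√t, 0, √(q-t)]
  rw [← psi_eq β h q t h0 htq Finset.univ a b haa hbb hab]
  have q1 := integral_law1 Finset.univ a hq.1.le haa (fun y => Real.tanh (h + β * y) ^ 2)
    ((measurable_tanh_comp (by fun_prop)).pow_const 2)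
  have q2 := integral_law1 Finset.univ b hq.1.le hbb (fun y => Real.tanh (h + β * y) ^ 2)
    ((measurable_tanh_comp (by fun_prop)).pow_const 2)
  rw [qfix hq] at q1 q2
  have mm : ∀ c : Fin 3 → ℝ, Measurable (fun x : Fin 3 → ℝ => Real.tanh (h + β * ∑ s, c s * x s)) :=
    fun c => measurable_tanh_comp (by fun_prop)
  have ii : ∀ c : Fin 3 → ℝ, Integrable (fun x : Fin 3 → ℝ => Real.tanh (h + β * ∑ s, c s * x s) ^ 2)
      (gI (Fin 3)) :=
    fun c => integrable_bdd ((mm c).pow_const 2) 1 fun x => by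
      rw [abs_of_nonneg (sq_nonneg _)]; exact tanh_sq_le_one _
  calc _ ≤ ∫ x, (1/2) * (Real.tanh (h + β * ∑ s, a s * x s) ^ 2
        + Real.tanh (h + β * ∑ s, b s * x s) ^ 2) ∂(gI (Fin 3)) := by
        refine integral_mono (integrable_bdd ((mm a).mul (mm b)) 1 fun x => ?_)
          (((ii a).add (ii b)).const_mul _) fun x => ?_
        · rw [abs_mul]
          exact mul_le_one₀ (tanh_abs_le_one _) (abs_nonneg _) (tanh_abs_le_one _)
        · simp only
          nlinarith [sq_nonneg (Real.tanh (h + β * ∑ s, a s * x s)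
            - Real.tanh (h + β * ∑ s, b s * x s))]
    _ = q := by
        rw [integral_const_mul, integral_add (ii a) (ii b), q1, q2]; ring

lemma psi_contract {β h q t : ℝ} (hβ : 0 < β) (hq : isFixedq β h q) (h0 : 0 ≤ t) (htq : t ≤ q) :
    q - β ^ 2 * Bc β h q * (q - t) ≤ psiFun β h q t := by
  have q0 := hq.1
  have sq : √q * √q = q := Real.mul_self_sqrt q0.le
  set d : Fin 2 → Fin 2 → ℝ := fun _ => ![√q, 0] with hd
  set c : Fin 2 → Fin 2 → ℝ := ![![0, √q], ![0, -√q]] with hc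
  set f : Fin 2 → ℝ → ℝ := fun _ y => Real.tanh (h + β * y) with hf
  set f1 : Fin 2 → ℝ → ℝ := fun _ y => β * (1 - Real.tanh (h + β * y) ^ 2) with hf1
  set f2 : Fin 2 → ℝ → ℝ := fun _ y => β * (-2 * Real.tanh (h + β * y) *
    (β * (1 - Real.tanh (h + β * y) ^ 2))) with hf2
  have hd1 : ∀ i y, HasDerivAt (f i) (f1 i y) y := by
    intro i y
    have := (hasDerivAt_tanh (h + β * y)).comp y (((hasDerivAt_id y).const_mul β).const_add h)
    refine this.congr_deriv ?_
    simp only [hf1]; ring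
  have hd2 : ∀ i y, HasDerivAt (f1 i) (f2 i y) y := by
    intro i y
    have := (((hd1 i y).pow 2).const_sub 1).const_mul β
    refine this.congr_deriv ?_
    simp only [hf1, hf2, hf]; ring
  set Cc := 1 + β + 2 * β ^ 2 with hCc
  have t2 : ∀ y, |1 - Real.tanh y ^ 2| ≤ 1 := by
    intro y
    rw [abs_le]; constructor <;> nlinarith [tanh_sq_le_one y, sq_nonneg (Real.tanh y)]
  have b0 : ∀ i y, |f i y| ≤ Cc := fun i y =>
    (tanh_abs_le_one _).trans (by rw [hCc]; nlinarith [sq_nonneg β])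
  have b1 : ∀ i y, |f1 i y| ≤ Cc := fun i y => by
    simp only [hf1]
    rw [abs_mul, abs_of_pos hβ]
    have := mul_le_mul_of_nonneg_left (t2 (h + β * y)) hβ.le
    nlinarith [sq_nonneg β]
  have b2 : ∀ i y, |f2 i y| ≤ Cc := fun i y => by
    simp only [hf2]
    rw [abs_mul, abs_mul, abs_mul, abs_mul, abs_of_pos hβ, abs_neg, abs_two]
    have h1 := mul_le_one₀ (tanh_abs_le_one (h + β * y)) (abs_nonneg _) (t2 (h + β * y))
    have : β * (2 * |Real.tanh (h + β * y)| * (β * |1 - Real.tanh (h + β * y) ^ 2|))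
      = 2 * β ^ 2 * (|Real.tanh (h + β * y)| * |1 - Real.tanh (h + β * y) ^ 2|) := by ring
    rw [this]
    nlinarith [mul_le_mul_of_nonneg_left h1 (by positivity : 0 ≤ 2 * β ^ 2)]
  have mt : Measurable (fun y => Real.tanh (h + β * y)) := measurable_tanh_comp (by fun_prop)
  have m1 : Measurable (f1 0) := (measurable_const.sub (mt.pow_const 2)).const_mul β
  have hder := interp_hasDerivAt (ι := Fin 2) (κ := Fin 2) c d f f1 f2 Cc
    (by rw [hCc]; nlinarith [sq_nonneg β]) hd1 hd2 b0 b1 b2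
    (fun i => ((mt.const_mul (-2)).mul m1).const_mul β)
    (by intro i j; fin_cases i <;> simp [hc, hd]) (by intro i; fin_cases i <;> simp [hc, hd])
  set F : ℝ → ℝ := fun θ => ∫ x, ∏ i, f i (ylin c d θ i x) ∂(gI (Fin 2)) with hF
  -- marginal norms
  have nrm : ∀ θ i, ∑ k, (Real.sin θ * c i k + Real.cos θ * d i k)
      * (Real.sin θ * c i k + Real.cos θ * d i k) = q := by
    intro θ i
    have := Real.sin_sq_add_cos_sq θ
    fin_cases i <;> simp [hc, hd, Fin.sum_univ_two] <;>
    linear_combination (Real.sin θ ^ 2 + Real.cos θ ^ 2) * sq + q * this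
  have cov : ∀ θ, ∑ k, (Real.sin θ * c 0 k + Real.cos θ * d 0 k)
      * (Real.sin θ * c 1 k + Real.cos θ * d 1 k) = q * Real.cos (2 * θ) := by
    intro θ
    have := Real.sin_sq_add_cos_sq θ
    rw [Real.cos_two_mul]
    simp [hc, hd, Fin.sum_univ_two]
    linear_combination (-Real.sin θ ^ 2 + Real.cos θ ^ 2) * sq - q * this
  have mart : ∀ θ i, ∫ x, (f1 i (ylin c d θ i x)) ^ 2 ∂(gI (Fin 2)) = β ^ 2 * Bc β h q := by
    intro θ i
    have := integral_law1 Finset.univ (fun k => Real.sin θ * c i k + Real.cos θ * d i k) q0.le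
      (nrm θ i) (fun y => (f1 i y) ^ 2) (m1.pow_const 2)
    unfold ylin
    rw [this, Bc, ← integral_const_mul]
    congr 1
    ext z
    simp only [hf1]; ring
  have my : ∀ θ i, Measurable (fun x : Fin 2 → ℝ => f1 i (ylin c d θ i x)) := fun θ i =>
    m1.comp (measurable_ylin c d θ i)
  have i2 : ∀ θ i, Integrable (fun x : Fin 2 → ℝ => f1 i (ylin c d θ i x) ^ 2) (gI (Fin 2)) :=
    fun θ i => integrable_bdd ((my θ i).pow_const 2) (Cc ^ 2) fun x => by
      rw [abs_pow]
      exact pow_le_pow_left₀ (abs_nonneg _) (b1 i (ylin c d θ i x)) 2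
  have i11 : ∀ θ, Integrable (fun x : Fin 2 → ℝ => f1 0 (ylin c d θ 0 x) * f1 1 (ylin c d θ 1 x))
      (gI (Fin 2)) := fun θ => integrable_bdd ((my θ 0).mul (my θ 1)) (Cc * Cc) fun x => by
        rw [abs_mul]
        exact mul_le_mul (b1 0 (ylin c d θ 0 x)) (b1 1 (ylin c d θ 1 x)) (abs_nonneg _) ((abs_nonneg _).trans (b1 0 0))
  set I : ℝ → ℝ := fun θ => ∫ x, f1 0 (ylin c d θ 0 x) * f1 1 (ylin c d θ 1 x) ∂(gI (Fin 2)) with hI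
  have Ile : ∀ θ, I θ ≤ β ^ 2 * Bc β h q := by
    intro θ
    calc I θ ≤ ∫ x, (1/2) * (f1 0 (ylin c d θ 0 x) ^ 2 + f1 1 (ylin c d θ 1 x) ^ 2) ∂(gI (Fin 2)) := by
          refine integral_mono (i11 θ) (((i2 θ 0).add (i2 θ 1)).const_mul _) fun x => ?_
          simp only
          nlinarith [sq_nonneg (f1 0 (ylin c d θ 0 x) - f1 1 (ylin c d θ 1 x))]
      _ = _ := by
        rw [integral_const_mul, integral_add (i2 θ 0) (i2 θ 1), mart, mart]; ring
  have hder2 : ∀ θ, HasDerivAt F (-(4 * q) * (Real.sin θ * Real.cos θ) * I θ) θ := by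
    intro θ
    refine (hder θ).congr_deriv ?_
    symm
    have e0 : (Finset.univ.erase (0 : Fin 2)) = {1} := by decide
    have e1 : (Finset.univ.erase (1 : Fin 2)) = {0} := by decide
    have I10 : ∫ x, f1 1 (ylin c d θ 1 x) * f1 0 (ylin c d θ 0 x) ∂(gI (Fin 2)) = I θ := by
      rw [hI]; congr 1; ext x; ring
    rw [Fin.sum_univ_two, e0, e1, Finset.sum_singleton, Finset.sum_singleton]
    unfold ffun
    rw [e0, e1]
    simp only [Finset.erase_singleton, Finset.prod_empty, mul_one]
    rw [I10]
    change _ = _ * I θ + _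
    simp [hc, hd, Fin.sum_univ_two]
    linear_combination (4 * Real.sin θ * Real.cos θ * I θ) * sq
  have Fpsi : ∀ θ, F θ = ∫ x, Real.tanh (h + β * ∑ s, (Real.sin θ * c 0 s + Real.cos θ * d 0 s) * x s)
      * Real.tanh (h + β * ∑ s, (Real.sin θ * c 1 s + Real.cos θ * d 1 s) * x s) ∂(gI (Fin 2)) := by
    intro θ
    simp only [hF, Fin.prod_univ_two]
    rfl
  have F0 : F 0 = q := by
    rw [Fpsi]
    have := integral_law1 Finset.univ (fun k => Real.sin 0 * c 0 k + Real.cos 0 * d 0 k) q0.le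
      (nrm 0 0) (fun y => Real.tanh (h + β * y) ^ 2) (mt.pow_const 2)
    rw [qfix hq] at this
    rw [← this]
    congr 1
    ext x
    simp [hd, sq]
    ring
  set θ0 := Real.arccos (t / q) / 2 with hθ0
  have htq1 : t / q ≤ 1 := (div_le_one q0).2 htq
  have htq0 : 0 ≤ t / q := by positivity
  have ct : q * Real.cos (2 * θ0) = t := by
    rw [hθ0, mul_div_cancel₀ _ two_ne_zero, Real.cos_arccos (by linarith) htq1]
    field_simp
  have Ft : F θ0 = psiFun β h q t := by
    rw [Fpsi]
    exact psi_eq β h q t h0 htq _ _ _ (nrm θ0 0) (nrm θ0 1) ((cov θ0).trans ct)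
  have th0 : 0 ≤ θ0 := by have := Real.arccos_nonneg (t / q); positivity
  have th1 : θ0 ≤ π / 2 := by
    have := Real.arccos_le_pi (t / q); rw [hθ0]; linarith
  have mono : MonotoneOn (fun θ => F θ - β ^ 2 * Bc β h q * (q * Real.cos (2 * θ)))
      (Set.Icc 0 (π / 2)) := by
    have dd : ∀ θ, HasDerivAt (fun θ => F θ - β ^ 2 * Bc β h q * (q * Real.cos (2 * θ)))
        (4 * q * (Real.sin θ * Real.cos θ) * (β ^ 2 * Bc β h q - I θ)) θ := by
      intro θ
      have h1 : HasDerivAt (fun θ : ℝ => Real.cos (2 * θ)) (-Real.sin (2 * θ) * (2 * 1)) θ :=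
        ((hasDerivAt_id θ).const_mul 2).cos
      refine ((hder2 θ).sub ((h1.const_mul q).const_mul (β ^ 2 * Bc β h q))).congr_deriv ?_
      rw [Real.sin_two_mul]; ring
    refine monotoneOn_of_deriv_nonneg (convex_Icc _ _)
      (fun θ _ => (dd θ).continuousAt.continuousWithinAt)
      (fun θ _ => (dd θ).differentiableAt.differentiableWithinAt) fun θ hθ => ?_
    rw [interior_Icc] at hθ
    rw [(dd θ).deriv]
    have s0 := Real.sin_nonneg_of_nonneg_of_le_pi hθ.1.le (by linarith [hθ.2, Real.pi_pos])
    have c0 := Real.cos_nonneg_of_neg_pi_div_two_le_of_le (by linarith [hθ.1, Real.pi_pos]) hθ.2.le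
    have := Ile θ
    have : 0 ≤ β ^ 2 * Bc β h q - I θ := by linarith
    positivity
  have := mono ⟨le_refl _, by positivity⟩ ⟨th0, th1⟩ th0
  simp only [F0, Ft, ct, mul_zero, Real.cos_zero, mul_one] at this
  linarith

/-! ### Row functions -/

lemma tanh_mono : Monotone Real.tanh := by
  refine monotone_of_deriv_nonneg (fun x => (hasDerivAt_tanh x).differentiableAt) fun x => ?_
  rw [(hasDerivAt_tanh x).deriv]
  linarith [tanh_sq_le_one x]

lemma tanh_lip (a b : ℝ) : |Real.tanh a - Real.tanh b| ≤ |a - b| := by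
  have := Convex.norm_image_sub_le_of_norm_deriv_le (f := Real.tanh) (C := 1) (s := Set.univ)
    (x := b) (y := a) (fun x _ => (hasDerivAt_tanh x).differentiableAt) (fun x _ => by
      rw [(hasDerivAt_tanh x).deriv, Real.norm_eq_abs, abs_le]
      constructor <;> nlinarith [tanh_sq_le_one x, sq_nonneg (Real.tanh x)])
    convex_univ (Set.mem_univ _) (Set.mem_univ _)
  simpa using this

/-- parameters -/
structure Par where
  β : ℝ
  h : ℝ
  q : ℝ
  hβ : 0 < β
  hh : 0 < h
  hq : isFixedq β h q
  hAT : ATcond β h q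

namespace Par
variable (p : Par)

def gam (j : ℕ) : ℝ := (boltSeq p.β p.h p.q j).2.1
def alp (j : ℕ) : ℝ := (boltSeq p.β p.h p.q j).1
def Sg : ℕ → ℝ
  | 0 => 0
  | j + 1 => (boltSeq p.β p.h p.q j).2.2
def eta (j : ℕ) : ℝ := √(p.q - p.Sg j)
def cf (j t : ℕ) : ℝ := if t < j then p.gam t else if t = j then p.eta j else 0
def arg (j : ℕ) (x : ℕ → ℝ) : ℝ := ∑ t ∈ Finset.range (j + 1), p.cf j t * x t
def M : ℕ → (ℕ → ℝ) → ℝ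
  | 0, _ => √p.q
  | j + 1, x => Real.tanh (p.h + p.β * p.arg j x)
def F (j : ℕ) (x : ℕ → ℝ) : ℝ :=
  (p.M j x - ∑ t : Fin j, p.gam t * F t x) / p.eta j
  termination_by j
  decreasing_by exact t.2

lemma F_eq (j : ℕ) (x : ℕ → ℝ) :
    p.F j x = (p.M j x - ∑ t ∈ Finset.range j, p.gam t * p.F t x) / p.eta j := by
  rw [F, Finset.sum_range]

lemma q0 : 0 < p.q := p.hq.1

lemma Sg_succ (j : ℕ) : p.Sg (j + 1) = p.Sg j + p.gam j ^ 2 := by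
  cases j with
  | zero => simp [Sg, gam, boltSeq]
  | succ j => simp [Sg, gam, boltSeq]

lemma Sg_eq (j : ℕ) : p.Sg j = ∑ t ∈ Finset.range j, p.gam t ^ 2 := by
  induction j with
  | zero => simp [Sg]
  | succ j ih => rw [Sg_succ, ih, Finset.sum_range_succ]

lemma Sg_nonneg (j : ℕ) : 0 ≤ p.Sg j := by
  rw [Sg_eq]; exact Finset.sum_nonneg fun _ _ => sq_nonneg _

lemma gam_eq (j : ℕ) : p.gam j = (p.alp j - p.Sg j) / p.eta j := by
  cases j with
  | zero =>
    have : √p.q ≠ 0 := (Real.sqrt_pos.2 p.q0).ne'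
    simp [Sg, gam, boltSeq, alp, eta]
    field_simp
  | succ j => simp [Sg, gam, boltSeq, alp, eta]

lemma alp_succ (j : ℕ) : p.alp (j + 1) = psiFun p.β p.h p.q (p.alp j) := by
  simp [alp, boltSeq]

lemma gamma1_bd : |gamma1 p.β p.h p.q| ≤ √p.q := by
  have m : Measurable (fun z => Real.tanh (p.h + p.β * (√p.q * z))) :=
    measurable_tanh_comp (by fun_prop)
  have i1 : Integrable (fun z => Real.tanh (p.h + p.β * (√p.q * z))) gm :=
    integrable_bdd m 1 fun x => tanh_abs_le_one _
  have i2 : Integrable (fun z => Real.tanh (p.h + p.β * (√p.q * z)) ^ 2) gm :=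
    integrable_bdd (m.pow_const 2) 1 fun x => by
      rw [abs_of_nonneg (sq_nonneg _)]; exact tanh_sq_le_one _
  have g : gamma1 p.β p.h p.q = ∫ z, Real.tanh (p.h + p.β * (√p.q * z)) ∂gm := by
    unfold gamma1; simp only [mul_assoc]
  apply Real.abs_le_sqrt
  set c := gamma1 p.β p.h p.q
  have h0 : 0 ≤ ∫ z, (Real.tanh (p.h + p.β * (√p.q * z)) - c) ^ 2 ∂gm :=
    integral_nonneg fun _ => sq_nonneg _
  have e : ∫ z, (Real.tanh (p.h + p.β * (√p.q * z)) - c) ^ 2 ∂gm = p.q - c ^ 2 := by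
    have : ∀ z, (Real.tanh (p.h + p.β * (√p.q * z)) - c) ^ 2
      = Real.tanh (p.h + p.β * (√p.q * z)) ^ 2 - 2 * c * Real.tanh (p.h + p.β * (√p.q * z)) + c ^ 2 := by
      intro z; ring
    simp_rw [this]
    have i3 : Integrable (fun z => Real.tanh (p.h + p.β * (√p.q * z)) ^ 2
        - 2 * c * Real.tanh (p.h + p.β * (√p.q * z))) gm := i2.sub (i1.const_mul _)
    rw [integral_add i3 (integrable_const _),
      integral_sub i2 (i1.const_mul _), integral_const_mul, ← g, qfix p.hq]
    simp; ring
  linarith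

lemma gamma1_nonneg : 0 ≤ gamma1 p.β p.h p.q := by
  -- pair z with -z
  have m : Measurable (fun z => Real.tanh (p.h + p.β * √p.q * z)) :=
    measurable_tanh_comp (by fun_prop)
  have m' : Measurable (fun z => Real.tanh (p.h + p.β * √p.q * (-z))) :=
    measurable_tanh_comp (by fun_prop)
  have i1 : Integrable (fun z => Real.tanh (p.h + p.β * √p.q * z)) gm :=
    integrable_bdd m 1 fun x => tanh_abs_le_one _
  have i2 : Integrable (fun z => Real.tanh (p.h + p.β * √p.q * (-z))) gm :=
    integrable_bdd m' 1 fun x => tanh_abs_le_one _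
  have e : ∫ z, Real.tanh (p.h + p.β * √p.q * (-z)) ∂gm = gamma1 p.β p.h p.q := by
    have : gm.map (fun z => -z) = gm := by
      rw [gm, gaussianReal_map_neg]; simp
    unfold gamma1
    change _ = ∫ z, Real.tanh (p.h + p.β * √p.q * z) ∂gm
    conv_rhs => rw [← this]
    rw [integral_map (by fun_prop) m.aestronglyMeasurable]
  have : 0 ≤ gamma1 p.β p.h p.q + ∫ z, Real.tanh (p.h + p.β * √p.q * (-z)) ∂gm := by
    unfold gamma1
    rw [← integral_add i1 i2]
    refine integral_nonneg fun z => ?_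
    simp only [Pi.zero_apply]
    have hm : Real.tanh (-(p.h + p.β * √p.q * z)) ≤ Real.tanh (p.h + p.β * √p.q * (-z)) :=
      tanh_mono (by linarith [p.hh])
    rw [Real.tanh_neg] at hm
    linarith
  rw [e] at this
  linarith

lemma alp_mem (j : ℕ) : 0 ≤ p.alp j ∧ p.alp j ≤ p.q := by
  induction j with
  | zero =>
    have h1 := p.gamma1_nonneg
    have h2 := (abs_le.1 p.gamma1_bd).2
    have h3 := Real.sqrt_nonneg p.q
    have h4 := Real.mul_self_sqrt p.q0.le
    simp only [alp, boltSeq]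
    exact ⟨by positivity, by nlinarith⟩
  | succ j ih =>
    rw [alp_succ]
    exact ⟨psi_nonneg _ _ _ _, psi_le p.hq ih.1 ih.2⟩

lemma alp_tendsto : Tendsto p.alp atTop (nhds p.q) := by
  set κ := p.β ^ 2 * Bc p.β p.h p.q with hκ
  have hB : 0 ≤ Bc p.β p.h p.q := integral_nonneg fun z => sq_nonneg _
  have k0 : 0 ≤ κ := by positivity
  have k1 : κ < 1 := AT_Bc p.hAT
  have key : ∀ j, p.q - p.alp j ≤ κ ^ j * p.q := by
    intro j
    induction j with
    | zero => simp; exact (p.alp_mem 0).1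
    | succ j ih =>
      rw [alp_succ]
      have := psi_contract p.hβ p.hq (p.alp_mem j).1 (p.alp_mem j).2
      have h2 := mul_le_mul_of_nonneg_left ih k0
      rw [pow_succ]
      rw [← hκ] at this
      linarith
  have h1 : Tendsto (fun j => p.q - κ ^ j * p.q) atTop (nhds (p.q - 0 * p.q)) :=
    ((tendsto_pow_atTop_nhds_zero_of_lt_one k0 k1).mul_const _).const_sub _
  rw [zero_mul, sub_zero] at h1
  exact tendsto_of_tendsto_of_tendsto_of_le_of_le h1 tendsto_const_nhds
    (fun j => by have := key j; simp only; linarith) (fun j => (p.alp_mem j).2)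

lemma measurable_M (j : ℕ) : Measurable (p.M j) := by
  cases j with
  | zero => exact measurable_const
  | succ j =>
    show Measurable (fun x => Real.tanh (p.h + p.β * p.arg j x))
    unfold arg
    exact measurable_tanh_comp (by fun_prop)

lemma measurable_F (j : ℕ) : Measurable (p.F j) := by
  induction j using Nat.strong_induction_on with
  | _ j ih =>
    have : p.F j = fun x => (p.M j x - ∑ t ∈ Finset.range j, p.gam t * p.F t x) / p.eta j := by
      ext x; exact p.F_eq j x
    rw [this]
    refine ((p.measurable_M j).sub (Finset.measurable_fun_sum _ fun t ht => ?_)).div_const _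
    exact (ih t (Finset.mem_range.1 ht)).const_mul _

lemma M_abs_le (j : ℕ) (x : ℕ → ℝ) : |p.M j x| ≤ 1 := by
  cases j with
  | zero =>
    simp only [M]
    rw [abs_of_nonneg (Real.sqrt_nonneg _)]
    exact Real.sqrt_le_one.2 p.hq.2.1.le
  | succ j => exact tanh_abs_le_one _

lemma M_abs_lt (j : ℕ) (x : ℕ → ℝ) : |p.M j x| < 1 := by
  cases j with
  | zero =>
    simp only [M]
    rw [abs_of_nonneg (Real.sqrt_nonneg _)]
    calc √p.q < √1 := Real.sqrt_lt_sqrt p.q0.le p.hq.2.1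
      _ = 1 := Real.sqrt_one
  | succ j => exact Real.abs_tanh_lt_one _

lemma F_bdd (j : ℕ) : ∃ C, ∀ x, |p.F j x| ≤ C := by
  induction j using Nat.strong_induction_on with
  | _ j ih =>
    choose C hC using ih
    refine ⟨(1 + ∑ t : Fin j, |p.gam t| * C t t.2) / |p.eta j|, fun x => ?_⟩
    rw [F, abs_div]
    gcongr
    refine (abs_sub _ _).trans (add_le_add (p.M_abs_le j x) ?_)
    refine (Finset.abs_sum_le_sum_abs _ _).trans (Finset.sum_le_sum fun t _ => ?_)
    rw [abs_mul]
    gcongr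
    exact hC t t.2 x

lemma arg_congr (j : ℕ) {x y : ℕ → ℝ} (h : ∀ t ≤ j, x t = y t) : p.arg j x = p.arg j y := by
  unfold arg
  refine Finset.sum_congr rfl fun t ht => ?_
  rw [h t (Nat.lt_succ_iff.1 (Finset.mem_range.1 ht))]

lemma M_congr (j : ℕ) {x y : ℕ → ℝ} (h : ∀ t < j, x t = y t) : p.M j x = p.M j y := by
  cases j with
  | zero => rfl
  | succ j =>
    simp only [M]
    rw [p.arg_congr j fun t ht => h t (Nat.lt_succ_of_le ht)]

lemma F_congr (j : ℕ) {x y : ℕ → ℝ} (h : ∀ t < j, x t = y t) : p.F j x = p.F j y := by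
  induction j using Nat.strong_induction_on with
  | _ j ih =>
    rw [F_eq, F_eq, p.M_congr j h]
    congr 2
    refine Finset.sum_congr rfl fun t ht => ?_
    have := Finset.mem_range.1 ht
    rw [ih t this fun s hs => h s (hs.trans this)]

lemma int_MM (a b : ℕ) : Integrable (fun x => p.M a x * p.M b x) (gI ℕ) :=
  integrable_bdd ((p.measurable_M a).mul (p.measurable_M b)) 1 fun x => by
    rw [abs_mul]; exact mul_le_one₀ (p.M_abs_le _ _) (abs_nonneg _) (p.M_abs_le _ _)

lemma int_MF (a b : ℕ) : Integrable (fun x => p.M a x * p.F b x) (gI ℕ) := by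
  obtain ⟨C, hC⟩ := p.F_bdd b
  exact integrable_bdd ((p.measurable_M a).mul (p.measurable_F b)) (1 * C) fun x => by
    rw [abs_mul]
    exact mul_le_mul (p.M_abs_le _ _) (hC _) (abs_nonneg _) zero_le_one

lemma int_FF (a b : ℕ) : Integrable (fun x => p.F a x * p.F b x) (gI ℕ) := by
  obtain ⟨C, hC⟩ := p.F_bdd b
  obtain ⟨D, hD⟩ := p.F_bdd a
  exact integrable_bdd ((p.measurable_F a).mul (p.measurable_F b)) (D * C) fun x => by
    rw [abs_mul]
    exact mul_le_mul (hD _) (hC _) (abs_nonneg _) ((abs_nonneg _).trans (hD x))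

lemma eta_pos {j : ℕ} (h : p.Sg j < p.q) : 0 < p.eta j := Real.sqrt_pos.2 (by linarith)
lemma eta_sq {j : ℕ} (h : p.Sg j < p.q) : p.eta j * p.eta j = p.q - p.Sg j :=
  Real.mul_self_sqrt (by linarith)

lemma cf_sq {j : ℕ} (h : p.Sg j < p.q) (n : ℕ) (hn : j < n) :
    ∑ t ∈ Finset.range n, p.cf j t * p.cf j t = p.q := by
  have e : ∑ t ∈ Finset.range n, p.cf j t * p.cf j t
      = ∑ t ∈ Finset.range (j + 1), p.cf j t * p.cf j t := by
    symm
    refine Finset.sum_subset (Finset.range_subset_range.2 hn) fun t _ ht => ?_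
    simp only [Finset.mem_range, not_lt] at ht
    rw [cf, if_neg (by omega), if_neg (by omega), mul_zero]
  rw [e, Finset.sum_range_succ]
  have : ∑ t ∈ Finset.range j, p.cf j t * p.cf j t = p.Sg j := by
    rw [Sg_eq]
    refine Finset.sum_congr rfl fun t ht => ?_
    rw [cf, if_pos (Finset.mem_range.1 ht), sq]
  rw [this]
  simp only [cf, lt_irrefl, if_false, if_true]
  rw [p.eta_sq h]; ring

lemma cf_cross {a b : ℕ} (hab : a < b) (h : p.Sg a < p.q) (n : ℕ) (hn : b < n) :
    ∑ t ∈ Finset.range n, p.cf a t * p.cf b t = p.alp a := by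
  have e : ∑ t ∈ Finset.range n, p.cf a t * p.cf b t
      = ∑ t ∈ Finset.range (a + 1), p.cf a t * p.cf b t := by
    symm
    refine Finset.sum_subset (Finset.range_subset_range.2 (by omega)) fun t _ ht => ?_
    simp only [Finset.mem_range, not_lt] at ht
    rw [cf, if_neg (by omega), if_neg (by omega), zero_mul]
  rw [e, Finset.sum_range_succ]
  have : ∑ t ∈ Finset.range a, p.cf a t * p.cf b t = p.Sg a := by
    rw [Sg_eq]
    refine Finset.sum_congr rfl fun t ht => ?_
    have := Finset.mem_range.1 ht
    rw [cf, if_pos this, cf, if_pos (this.trans hab), sq]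
  rw [this]
  simp only [cf, lt_irrefl, if_false, if_true, hab]
  have := (p.eta_pos h).ne'
  rw [gam_eq]
  field_simp
  ring

lemma arg_eq {j n : ℕ} (hn : j < n) (x : ℕ → ℝ) :
    p.arg j x = ∑ t ∈ Finset.range n, p.cf j t * x t := by
  unfold arg
  refine Finset.sum_subset (Finset.range_subset_range.2 hn) fun t _ ht => ?_
  simp only [Finset.mem_range, not_lt] at ht
  rw [cf, if_neg (by omega), if_neg (by omega), zero_mul]

lemma law_M {j : ℕ} (h : p.Sg j < p.q) (f : ℝ → ℝ) (hf : Measurable f) :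
    ∫ x, f (p.arg j x) ∂(gI ℕ) = ∫ z, f (√p.q * z) ∂gm :=
  integral_law1 (Finset.range (j+1)) (p.cf j) p.q0.le (p.cf_sq h _ (by omega)) f hf

lemma E_M_sq (j : ℕ) (h : ∀ t < j, p.Sg t < p.q) : ∫ x, p.M j x * p.M j x ∂(gI ℕ) = p.q := by
  cases j with
  | zero => simp [M, Real.mul_self_sqrt p.q0.le]
  | succ j =>
    have := p.law_M (h j (by omega)) (fun y => Real.tanh (p.h + p.β * y) ^ 2)
      ((measurable_tanh_comp (by fun_prop)).pow_const 2)
    rw [qfix p.hq] at this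
    rw [← this]
    simp [M, sq]

lemma E_MM {a b : ℕ} (hab : a < b) (h : ∀ t < b, p.Sg t < p.q) :
    ∫ x, p.M a x * p.M b x ∂(gI ℕ) = p.alp a := by
  cases b with
  | zero => omega
  | succ b =>
    cases a with
    | zero =>
      have := p.law_M (h b (by omega)) (fun y => Real.tanh (p.h + p.β * y))
        (measurable_tanh_comp (by fun_prop))
      simp only [M]
      rw [integral_const_mul, this]
      simp [alp, boltSeq, gamma1, mul_assoc]
    | succ a =>
      rw [alp_succ]
      simp only [M]
      have ha : a < b := by omega
      have := psi_eq p.β p.h p.q (p.alp a) (p.alp_mem a).1 (p.alp_mem a).2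
        (Finset.range (b + 1)) (p.cf a) (p.cf b) (p.cf_sq (h a (by omega)) _ (by omega))
        (p.cf_sq (h b (by omega)) _ (by omega)) (p.cf_cross ha (h a (by omega)) _ (by omega))
      rw [← this]
      congr 1
      ext x
      rw [p.arg_eq (show a < b + 1 by omega), p.arg_eq (show b < b + 1 by omega)]

lemma E_MF {s b : ℕ} (hsb : s < b) (h : ∀ t < b, p.Sg t < p.q) :
    ∫ x, p.M b x * p.F s x ∂(gI ℕ) = p.gam s := by
  induction s using Nat.strong_induction_on with
  | _ s ih =>
    have e : ∀ x, p.M b x * p.F s x = (p.M s x * p.M b x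
        - ∑ t ∈ Finset.range s, p.gam t * (p.M b x * p.F t x)) / p.eta s := by
      intro x
      rw [F_eq, ← mul_div_assoc, mul_sub, Finset.mul_sum]
      congr 2
      · ring
      · exact Finset.sum_congr rfl fun t _ => by ring
    simp_rw [e]
    rw [integral_div, integral_sub (p.int_MM s b)
      (integrable_finsetSum _ fun t _ => (p.int_MF b t).const_mul _),
      integral_finsetSum _ fun t _ => (p.int_MF b t).const_mul _, p.E_MM hsb h, gam_eq, Sg_eq]
    congr 2
    refine Finset.sum_congr rfl fun t ht => ?_
    have := Finset.mem_range.1 ht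
    rw [integral_const_mul, ih t this (this.trans hsb), sq]

lemma E_FF_aux (n : ℕ) : ∀ s j, s < j → j ≤ n → (∀ t < j, p.Sg t < p.q) →
      (∫ x, p.F s x * p.F j x ∂(gI ℕ) = 0 ∧ ∫ x, p.F s x * p.F s x ∂(gI ℕ) = 1) := by
  induction n with
  | zero => intro s j hs hj; omega
  | succ n ih =>
    intro s j hs hj h
    have sumF : ∀ (r j' : ℕ), (∫ x, ∑ t ∈ Finset.range j', p.gam t * (p.F r x * p.F t x) ∂(gI ℕ))
        = ∑ t ∈ Finset.range j', p.gam t * ∫ x, p.F r x * p.F t x ∂(gI ℕ) := by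
      intro r j'
      rw [integral_finsetSum _ fun t _ => (p.int_FF r t).const_mul _]
      exact Finset.sum_congr rfl fun t _ => integral_const_mul _ _
    have isum : ∀ (r j' : ℕ), Integrable (fun x => ∑ t ∈ Finset.range j',
        p.gam t * (p.F r x * p.F t x)) (gI ℕ) := fun r j' =>
      integrable_finsetSum _ fun t _ => (p.int_FF r t).const_mul _
    have ex : ∀ r j' x, p.F r x * p.F j' x = (p.M j' x * p.F r x
        - ∑ t ∈ Finset.range j', p.gam t * (p.F r x * p.F t x)) / p.eta j' := by
      intro r j' x
      conv_lhs => rw [p.F_eq j']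
      rw [← mul_div_assoc, mul_sub, Finset.mul_sum]
      congr 2
      · ring
      · exact Finset.sum_congr rfl fun t _ => by ring
    -- lower orthogonality
    have low : ∀ s' t', s' < t' → t' < j → ∫ x, p.F s' x * p.F t' x ∂(gI ℕ) = 0 :=
      fun s' t' h1 h2 => (ih s' t' h1 (by omega) fun t ht => h t (by omega)).1
    -- norm of F s
    have nrm : ∀ r < j, ∫ x, p.F r x * p.F r x ∂(gI ℕ) = 1 := by
      intro r hr
      have hη := (p.eta_pos (h r hr)).ne'
      have hMr : ∫ x, p.M r x * p.F r x ∂(gI ℕ) = p.eta r := by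
        have e : ∀ x, p.M r x * p.F r x = (p.M r x * p.M r x
            - ∑ t ∈ Finset.range r, p.gam t * (p.M r x * p.F t x)) / p.eta r := by
          intro x
          rw [p.F_eq r, ← mul_div_assoc, mul_sub, Finset.mul_sum]
          congr 2
          exact Finset.sum_congr rfl fun t _ => by ring
        simp_rw [e]
        rw [integral_div, integral_sub (p.int_MM r r)
          (integrable_finsetSum _ fun t _ => (p.int_MF r t).const_mul _),
          integral_finsetSum _ fun t _ => (p.int_MF r t).const_mul _,
          p.E_M_sq r fun t ht => h t (by omega)]
        rw [div_eq_iff hη, p.eta_sq (h r hr), Sg_eq]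
        congr 1
        refine Finset.sum_congr rfl fun t ht => ?_
        have := Finset.mem_range.1 ht
        rw [integral_const_mul, p.E_MF this fun t ht => h t (by omega), sq]
      simp_rw [fun x => ex r r x]
      rw [integral_div, integral_sub (p.int_MF r r) (isum r r), sumF, hMr]
      rw [Finset.sum_eq_zero, sub_zero, div_self hη]
      intro t ht
      have := Finset.mem_range.1 ht
      rw [show (∫ x, p.F r x * p.F t x ∂(gI ℕ)) = 0 by
        rw [← low t r this hr]; congr 1; ext x; ring, mul_zero]
    refine ⟨?_, nrm s hs⟩
    simp_rw [fun x => ex s j x]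
    rw [integral_div, integral_sub (p.int_MF j s) (isum s j), sumF, p.E_MF hs h]
    rw [Finset.sum_eq_single_of_mem s (Finset.mem_range.2 hs), nrm s hs, mul_one, sub_self, zero_div]
    intro t ht hts
    have ht' := Finset.mem_range.1 ht
    rcases lt_or_gt_of_ne hts with h1 | h1
    · rw [show (∫ x, p.F s x * p.F t x ∂(gI ℕ)) = 0 by
        rw [← low t s h1 hs]; congr 1; ext x; ring, mul_zero]
    · rw [low s t h1 ht', mul_zero]

lemma sum_sq_eq (j : ℕ) (h : ∀ t < j, p.Sg t < p.q) :
    ∫ x, (p.M j x - ∑ t ∈ Finset.range j, p.gam t * p.F t x) ^ 2 ∂(gI ℕ) = p.q - p.Sg j := by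
  have e : ∀ x, (p.M j x - ∑ t ∈ Finset.range j, p.gam t * p.F t x) ^ 2
      = p.M j x * p.M j x - 2 * (∑ t ∈ Finset.range j, p.gam t * (p.M j x * p.F t x))
        + ∑ t ∈ Finset.range j, ∑ s ∈ Finset.range j, p.gam t * p.gam s * (p.F t x * p.F s x) := by
    intro x
    rw [sub_sq, sq (∑ t ∈ Finset.range j, p.gam t * p.F t x), Finset.sum_mul_sum, Finset.mul_sum,
      Finset.mul_sum]
    congr 1
    · congr 1
      · ring
      · exact Finset.sum_congr rfl fun t _ => by ring
    · exact Finset.sum_congr rfl fun t _ => Finset.sum_congr rfl fun s _ => by ring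
  have i1 : Integrable (fun x => 2 * (∑ t ∈ Finset.range j, p.gam t * (p.M j x * p.F t x))) (gI ℕ) :=
    (integrable_finsetSum _ fun t _ => (p.int_MF j t).const_mul _).const_mul _
  have i2 : Integrable (fun x => ∑ t ∈ Finset.range j, ∑ s ∈ Finset.range j,
      p.gam t * p.gam s * (p.F t x * p.F s x)) (gI ℕ) :=
    integrable_finsetSum _ fun t _ => integrable_finsetSum _ fun s _ => (p.int_FF t s).const_mul _
  have i3 : Integrable (fun x => p.M j x * p.M j x
      - 2 * (∑ t ∈ Finset.range j, p.gam t * (p.M j x * p.F t x))) (gI ℕ) := (p.int_MM j j).sub i1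
  simp_rw [e]
  rw [integral_add i3 i2, integral_sub (p.int_MM j j) i1, p.E_M_sq j h, integral_const_mul,
    integral_finsetSum _ fun t _ => (p.int_MF j t).const_mul _,
    integral_finsetSum _ fun t _ => integrable_finsetSum _ fun s _ => (p.int_FF t s).const_mul _]
  have e1 : ∑ t ∈ Finset.range j, ∫ x, p.gam t * (p.M j x * p.F t x) ∂(gI ℕ) = p.Sg j := by
    rw [Sg_eq]
    refine Finset.sum_congr rfl fun t ht => ?_
    rw [integral_const_mul, p.E_MF (Finset.mem_range.1 ht) h, sq]
  have e2 : ∑ t ∈ Finset.range j, ∫ x, ∑ s ∈ Finset.range j,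
      p.gam t * p.gam s * (p.F t x * p.F s x) ∂(gI ℕ) = p.Sg j := by
    rw [Sg_eq]
    refine Finset.sum_congr rfl fun t ht => ?_
    have ht' := Finset.mem_range.1 ht
    rw [integral_finsetSum _ fun s _ => (p.int_FF t s).const_mul _,
      Finset.sum_eq_single_of_mem t ht, integral_const_mul,
      (p.E_FF_aux j t j ht' le_rfl h).2, mul_one, sq]
    intro s hs hst
    have hs' := Finset.mem_range.1 hs
    rw [integral_const_mul]
    rcases lt_or_gt_of_ne hst with h1 | h1
    · rw [show (∫ x, p.F t x * p.F s x ∂(gI ℕ)) = 0 by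
        rw [← (p.E_FF_aux j s t h1 ht'.le fun r hr => h r (by omega)).1]; congr 1; ext x; ring,
        mul_zero]
    · rw [(p.E_FF_aux j t s h1 hs'.le fun r hr => h r (by omega)).1, mul_zero]
  rw [e1, e2]
  ring

lemma Sg_lt (j : ℕ) : p.Sg j < p.q := by
  induction j using Nat.strong_induction_on with
  | _ j ih =>
  cases j with
  | zero => exact p.q0
  | succ j =>
    by_contra hcon
    have key := p.sum_sq_eq (j + 1) ih
    set R : (ℕ → ℝ) → ℝ := fun x => ∑ t ∈ Finset.range (j + 1), p.gam t * p.F t x with hR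
    have mR : Measurable R := Finset.measurable_fun_sum _ fun t _ => (p.measurable_F t).const_mul _
    have z : ∫ x, (p.M (j+1) x - R x) ^ 2 ∂(gI ℕ) = 0 :=
      le_antisymm (by rw [key]; linarith) (integral_nonneg fun _ => sq_nonneg _)
    obtain ⟨C, hC⟩ : ∃ C, ∀ x, |R x| ≤ C := by
      choose C hC using fun t => p.F_bdd t
      refine ⟨∑ t ∈ Finset.range (j + 1), |p.gam t| * C t, fun x => ?_⟩
      refine (Finset.abs_sum_le_sum_abs _ _).trans (Finset.sum_le_sum fun t _ => ?_)
      rw [abs_mul]; gcongr; exact hC t x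
    have iz : Integrable (fun x => (p.M (j+1) x - R x) ^ 2) (gI ℕ) := integrable_bdd
      (((p.measurable_M _).sub mR).pow_const 2) ((1 + C) ^ 2) fun x => by
        rw [abs_pow]
        exact pow_le_pow_left₀ (abs_nonneg _)
          ((abs_sub _ _).trans (add_le_add (p.M_abs_le _ _) (hC x))) 2
    rw [integral_eq_zero_iff_of_nonneg (fun _ => sq_nonneg _) iz] at z
    have z2 : ∀ᵐ x ∂(gI ℕ), p.M (j+1) x = R x := by
      filter_upwards [z] with x hx
      have : p.M (j+1) x - R x = 0 := by simpa using hx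
      linarith
    rw [← map_update_gI j, ae_map_iff (measurable_update_pair j).aemeasurable
      (measurableSet_eq_fun (p.measurable_M _) mR)] at z2
    have z3 := Measure.ae_ae_of_ae_prod z2
    obtain ⟨x, hx⟩ := z3.exists
    have Rc : ∀ z, R (Function.update x j z) = R x := by
      intro z
      refine Finset.sum_congr rfl fun t ht => ?_
      rw [p.F_congr t]
      intro s hs
      have := Finset.mem_range.1 ht
      exact Function.update_of_ne (by omega) _ _
    have sub : {z | p.M (j+1) (Function.update x j z) = R (Function.update x j z)}.Subsingleton := by
      intro z1 h1 z2 h2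
      simp only [Set.mem_setOf_eq, Rc] at h1 h2
      have h3 := h1.trans h2.symm
      simp only [M] at h3
      have h4 := Real.tanh_injective h3
      have h5 : p.arg j (Function.update x j z1) = p.arg j (Function.update x j z2) := by
        have := p.hβ.ne'
        have h6 : p.β * p.arg j (Function.update x j z1) = p.β * p.arg j (Function.update x j z2) := by
          linarith
        exact mul_left_cancel₀ this h6
      unfold arg at h5
      rw [Finset.sum_range_succ, Finset.sum_range_succ] at h5
      have h7 : ∀ z, ∑ t ∈ Finset.range j, p.cf j t * Function.update x j z t
        = ∑ t ∈ Finset.range j, p.cf j t * x t := by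
        intro z
        refine Finset.sum_congr rfl fun t ht => ?_
        have := Finset.mem_range.1 ht
        rw [Function.update_of_ne (by omega)]
      rw [h7, h7, Function.update_self, Function.update_self] at h5
      have h8 : p.cf j j ≠ 0 := by
        simp only [cf, lt_irrefl, if_false, if_true]
        exact (p.eta_pos (ih j (by omega))).ne'
      exact mul_left_cancel₀ h8 (by linarith)
    haveI : NullSingletonClass gm := nullSingletonClass_gaussianReal one_ne_zero
    have m0 : gm {z | p.M (j+1) (Function.update x j z) = R (Function.update x j z)} = 0 :=
      sub.measure_zero gm
    have m1 : gm {z | p.M (j+1) (Function.update x j z) = R (Function.update x j z)}ᶜ = 0 := hx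
    have := measure_union_le (μ := gm)
      {z | p.M (j+1) (Function.update x j z) = R (Function.update x j z)}
      {z | p.M (j+1) (Function.update x j z) = R (Function.update x j z)}ᶜ
    rw [m0, m1, Set.union_compl_self] at this
    simp at this

lemma etapos (j : ℕ) : 0 < p.eta j := p.eta_pos (p.Sg_lt j)

lemma etasq (j : ℕ) : p.eta j ^ 2 = p.q - p.Sg j := by rw [sq]; exact p.eta_sq (p.Sg_lt j)

lemma E_FF (s t : ℕ) : ∫ x, p.F s x * p.F t x ∂(gI ℕ) = if s = t then 1 else 0 := by
  rcases lt_trichotomy s t with h | h | h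
  · rw [if_neg h.ne, (p.E_FF_aux t s t h le_rfl fun r _ => p.Sg_lt r).1]
  · rw [if_pos h, ← h, (p.E_FF_aux (s+1) s (s+1) (by omega) le_rfl fun r _ => p.Sg_lt r).2]
  · rw [if_neg h.ne', ← (p.E_FF_aux s t s h le_rfl fun r _ => p.Sg_lt r).1]
    congr 1; ext x; ring

lemma alp_sq_le (k : ℕ) : p.alp k ^ 2 ≤ p.q * p.Sg (k + 1) := by
  have e : p.alp k = p.Sg k + p.gam k * p.eta k := by
    have := (p.etapos k).ne'
    rw [gam_eq]; field_simp; ring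
  have h1 := p.etasq k
  rw [Sg_succ, e]
  nlinarith [sq_nonneg (p.eta k - p.gam k), p.Sg_nonneg k, sq_nonneg (p.gam k)]

lemma eta_tendsto : Tendsto p.eta atTop (nhds 0) := by
  have h1 : Tendsto (fun k => p.alp k ^ 2 / p.q) atTop (nhds p.q) := by
    have := (p.alp_tendsto.pow 2).div_const p.q
    rwa [sq, mul_div_assoc, div_self p.q0.ne', mul_one] at this
  have h2 : Tendsto (fun k => p.Sg (k + 1)) atTop (nhds p.q) :=
    tendsto_of_tendsto_of_tendsto_of_le_of_le h1 tendsto_const_nhds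
      (fun k => by simp only; rw [div_le_iff₀ p.q0, mul_comm]; exact p.alp_sq_le k)
      (fun k => (p.Sg_lt _).le)
  have h3 := (tendsto_add_atTop_iff_nat 1).1 h2
  have := (h3.const_sub p.q).sqrt
  rw [sub_self, Real.sqrt_zero] at this
  exact this

end Par

/-! ### The with-high-probability filter -/

/-- sets of asymptotically full probability -/
def whp {X : ℕ → Type} [∀ n, MeasurableSpace (X n)] (μ : ∀ n, Measure (X n)) :
    Filter (Σ n, X n) where
  sets := {S | Tendsto (fun n => μ n {x | (⟨n, x⟩ : Σ n, X n) ∉ S}) atTop (nhds 0)}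
  univ_sets := by simp
  sets_of_superset := by
    intro S T hS hST
    refine tendsto_of_tendsto_of_tendsto_of_le_of_le tendsto_const_nhds hS (fun _ => zero_le) ?_
    intro n
    exact measure_mono fun x hx hx' => hx (hST hx')
  inter_sets := by
    intro S T hS hT
    have := hS.add hT
    rw [add_zero] at this
    refine tendsto_of_tendsto_of_tendsto_of_le_of_le tendsto_const_nhds this (fun _ => zero_le) ?_
    intro n
    refine le_trans (measure_mono ?_) (measure_union_le _ _)
    intro x hx
    by_cases h : (⟨n, x⟩ : Σ n, X n) ∈ S
    · right
      intro h'
      exact hx ⟨h, h'⟩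
    · left; exact h

lemma eventually_whp {X : ℕ → Type} [∀ n, MeasurableSpace (X n)] {μ : ∀ n, Measure (X n)}
    {P : (Σ n, X n) → Prop} :
    (∀ᶠ e in whp μ, P e) ↔ Tendsto (fun n => μ n {x | ¬ P ⟨n, x⟩}) atTop (nhds 0) := Iff.rfl

lemma whp_fst {X : ℕ → Type} [∀ n, MeasurableSpace (X n)] {μ : ∀ n, Measure (X n)} :
    Tendsto (fun e : Σ n, X n => e.1) (whp μ) atTop := by
  rw [tendsto_atTop]
  intro b
  rw [eventually_whp]
  refine tendsto_const_nhds.congr' ?_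
  filter_upwards [eventually_ge_atTop b] with n hn
  simp [hn]

/-- i.i.d. rows -/
abbrev rowM (N : ℕ) : Measure (Fin N → ℕ → ℝ) := Measure.pi fun _ => gI ℕ

abbrev rowF : Filter (Σ N : ℕ, (Fin N → ℕ → ℝ)) := whp rowM

abbrev fullM (N : ℕ) : Measure ((Fin N → ℕ → ℝ) × (Fin N × Fin N → ℝ)) :=
  (rowM N).prod (gI (Fin N × Fin N))

abbrev fullF : Filter (Σ N : ℕ, ((Fin N → ℕ → ℝ) × (Fin N × Fin N → ℝ))) := whp fullM

/-- projection -/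
def toRow (e : Σ N : ℕ, ((Fin N → ℕ → ℝ) × (Fin N × Fin N → ℝ))) :
    Σ N : ℕ, (Fin N → ℕ → ℝ) := ⟨e.1, e.2.1⟩

lemma toRow_tendsto : Tendsto toRow fullF rowF := by
  intro S hS
  have hS' : Tendsto (fun n => rowM n {x | (⟨n, x⟩ : Σ n, (Fin n → ℕ → ℝ)) ∉ S}) atTop (nhds 0) := hS
  change Tendsto (fun n => fullM n {x | toRow ⟨n, x⟩ ∉ S}) atTop (nhds 0)
  refine hS'.congr fun n => ?_
  have : {x : (Fin n → ℕ → ℝ) × (Fin n × Fin n → ℝ) | toRow ⟨n, x⟩ ∉ S}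
    = {x | (⟨n, x⟩ : Σ n, (Fin n → ℕ → ℝ)) ∉ S} ×ˢ Set.univ := by
    ext x; simp [toRow]
  rw [this, Measure.prod_prod]; simp

/-! ### Tame functions -/

def Tame (f : (ℕ → ℝ) → ℝ) : Prop :=
  Measurable f ∧ ∃ (C : ℝ) (n : ℕ), 0 ≤ C ∧ ∀ x, |f x| ≤ C * exp (C * ∑ s ∈ Finset.range n, |x s|)

lemma Tame.of_bdd {f : (ℕ → ℝ) → ℝ} (hf : Measurable f) (C : ℝ) (h : ∀ x, |f x| ≤ C) : Tame f := by
  refine ⟨hf, |C|, 0, abs_nonneg _, fun x => ?_⟩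
  simp; exact (h x).trans (le_abs_self C)

lemma Tame.coord (k : ℕ) : Tame (fun x => x k) := by
  refine ⟨by fun_prop, 1, k + 1, zero_le_one, fun x => ?_⟩
  have h1 : |x k| ≤ ∑ s ∈ Finset.range (k + 1), |x s| :=
    Finset.single_le_sum (f := fun s => |x s|) (fun _ _ => abs_nonneg _) (by simp)
  have h2 := Real.add_one_le_exp (∑ s ∈ Finset.range (k + 1), |x s|)
  simp only [one_mul]
  linarith

lemma Tame.mul {f g : (ℕ → ℝ) → ℝ} (hf : Tame f) (hg : Tame g) : Tame (fun x => f x * g x) := by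
  obtain ⟨mf, C, m, hC, bf⟩ := hf
  obtain ⟨mg, D, n, hD, bg⟩ := hg
  refine ⟨mf.mul mg, max (C * D) (C + D), max m n, le_max_of_le_right (by positivity), fun x => ?_⟩
  have h1 : ∑ s ∈ Finset.range m, |x s| ≤ ∑ s ∈ Finset.range (max m n), |x s| :=
    Finset.sum_le_sum_of_subset_of_nonneg (by simp) fun _ _ _ => abs_nonneg _
  have h2 : ∑ s ∈ Finset.range n, |x s| ≤ ∑ s ∈ Finset.range (max m n), |x s| :=
    Finset.sum_le_sum_of_subset_of_nonneg (by simp) fun _ _ _ => abs_nonneg _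
  have h0 : 0 ≤ ∑ s ∈ Finset.range (max m n), |x s| := Finset.sum_nonneg fun _ _ => abs_nonneg _
  set T := ∑ s ∈ Finset.range (max m n), |x s|
  have k1 : |f x| ≤ C * exp (C * T) := (bf x).trans (by gcongr)
  have k2 : |g x| ≤ D * exp (D * T) := (bg x).trans (by gcongr)
  calc |f x * g x| = |f x| * |g x| := abs_mul _ _
    _ ≤ (C * exp (C * T)) * (D * exp (D * T)) := by gcongr
    _ = (C * D) * exp ((C + D) * T) := by rw [add_mul, Real.exp_add]; ring
    _ ≤ _ := by gcongr <;> simp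

lemma Tame.add {f g : (ℕ → ℝ) → ℝ} (hf : Tame f) (hg : Tame g) : Tame (fun x => f x + g x) := by
  obtain ⟨mf, C, m, hC, bf⟩ := hf
  obtain ⟨mg, D, n, hD, bg⟩ := hg
  refine ⟨mf.add mg, C + D, max m n, by positivity, fun x => ?_⟩
  have h1 : ∑ s ∈ Finset.range m, |x s| ≤ ∑ s ∈ Finset.range (max m n), |x s| :=
    Finset.sum_le_sum_of_subset_of_nonneg (by simp) fun _ _ _ => abs_nonneg _
  have h2 : ∑ s ∈ Finset.range n, |x s| ≤ ∑ s ∈ Finset.range (max m n), |x s| :=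
    Finset.sum_le_sum_of_subset_of_nonneg (by simp) fun _ _ _ => abs_nonneg _
  have h0 : 0 ≤ ∑ s ∈ Finset.range (max m n), |x s| := Finset.sum_nonneg fun _ _ => abs_nonneg _
  set T := ∑ s ∈ Finset.range (max m n), |x s|
  have k1 : |f x| ≤ C * exp ((C + D) * T) := (bf x).trans (by gcongr; linarith)
  have k2 : |g x| ≤ D * exp ((C + D) * T) := (bg x).trans (by gcongr; linarith)
  calc |f x + g x| ≤ |f x| + |g x| := abs_add_le _ _
    _ ≤ _ := by linarith

lemma Tame.const (c : ℝ) : Tame (fun _ => c) := Tame.of_bdd measurable_const |c| fun _ => le_rfl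

lemma Tame.sum {κ : Type*} (S : Finset κ) (f : κ → (ℕ → ℝ) → ℝ) (h : ∀ s ∈ S, Tame (f s)) :
    Tame (fun x => ∑ s ∈ S, f s x) := by
  classical
  induction S using Finset.induction_on with
  | empty => simpa using Tame.const 0
  | insert a S ha ih =>
    simp only [Finset.sum_insert ha]
    exact (h a (by simp)).add (ih fun s hs => h s (by simp [hs]))

lemma Tame.prod {κ : Type*} (S : Finset κ) (f : κ → (ℕ → ℝ) → ℝ) (h : ∀ s ∈ S, Tame (f s)) :
    Tame (fun x => ∏ s ∈ S, f s x) := by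
  classical
  induction S using Finset.induction_on with
  | empty => simpa using Tame.const 1
  | insert a S ha ih =>
    simp only [Finset.prod_insert ha]
    exact (h a (by simp)).mul (ih fun s hs => h s (by simp [hs]))

lemma Tame.pow {f : (ℕ → ℝ) → ℝ} (hf : Tame f) (n : ℕ) : Tame (fun x => f x ^ n) := by
  simpa using Tame.prod (Finset.range n) (fun _ => f) fun _ _ => hf

lemma Tame.integrable {f : (ℕ → ℝ) → ℝ} (hf : Tame f) : Integrable f (gI ℕ) := by
  obtain ⟨mf, C, n, hC, bf⟩ := hf
  have hi : Integrable (fun x : ℕ → ℝ => C * (1 + ∑ s ∈ Finset.range n, exp ((C * n) * |x s|))) (gI ℕ) := by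
    refine Integrable.const_mul ?_ _
    refine (integrable_const _).add (integrable_finsetSum _ fun s _ => ?_)
    exact integrable_exp_coord s _
  refine hi.mono' mf.aestronglyMeasurable (Filter.Eventually.of_forall fun x => ?_)
  rw [Real.norm_eq_abs]
  refine (bf x).trans ?_
  refine mul_le_mul_of_nonneg_left ?_ hC
  rcases Nat.eq_zero_or_pos n with rfl | hn
  · simp
  obtain ⟨s0, hs0, hmax⟩ := Finset.exists_max_image (Finset.range n) (fun s => |x s|) ⟨0, by simpa using hn⟩
  have h1 : ∑ s ∈ Finset.range n, |x s| ≤ n * |x s0| := by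
    have := Finset.sum_le_card_nsmul (Finset.range n) (fun s => |x s|) _ hmax
    simpa using this
  have h2 : exp (C * ∑ s ∈ Finset.range n, |x s|) ≤ exp ((C * n) * |x s0|) := by
    rw [mul_assoc]; gcongr
  have h3 : exp ((C * n) * |x s0|) ≤ ∑ s ∈ Finset.range n, exp ((C * n) * |x s|) :=
    Finset.single_le_sum (f := fun s => exp ((C * n) * |x s|)) (fun _ _ => (exp_pos _).le) hs0
  linarith

lemma Tame.memLp {f : (ℕ → ℝ) → ℝ} (hf : Tame f) : MemLp f 2 (gI ℕ) := by
  rw [memLp_two_iff_integrable_sq hf.1.aestronglyMeasurable]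
  exact (hf.pow 2).integrable

/-- empirical average -/
def av (f : (ℕ → ℝ) → ℝ) (e : Σ N : ℕ, (Fin N → ℕ → ℝ)) : ℝ := (∑ i, f (e.2 i)) / e.1

lemma lln {f : (ℕ → ℝ) → ℝ} (hf : Tame f) :
    Tendsto (av f) rowF (nhds (∫ x, f x ∂(gI ℕ))) := by
  rw [Metric.tendsto_nhds]
  intro ε hε
  rw [eventually_whp]
  set m := ∫ x, f x ∂(gI ℕ)
  set v := Var[f; gI ℕ]
  have hb : ∀ n : ℕ, 0 < n → rowM n {x | ¬ dist (av f ⟨n, x⟩) m < ε} ≤ ENNReal.ofReal (v / (n * ε ^ 2)) := by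
    intro n hn
    have hn' : (0:ℝ) < n := by exact_mod_cast hn
    have mp : ∀ i, MeasurePreserving (fun x : Fin n → ℕ → ℝ => x i) (rowM n) (gI ℕ) :=
      fun i => measurePreserving_eval (fun _ => gI ℕ) i
    have ml : ∀ i, MemLp (fun x : Fin n → ℕ → ℝ => f (x i)) 2 (rowM n) := fun i =>
      hf.memLp.comp_measurePreserving (mp i)
    have ml' : MemLp (fun x : Fin n → ℕ → ℝ => ∑ i, f (x i)) 2 (rowM n) :=
      memLp_finsetSum _ fun i _ => ml i
    have e1 : (rowM n)[fun x : Fin n → ℕ → ℝ => ∑ i, f (x i)] = n * m := by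
      rw [integral_finsetSum _ fun i _ => (ml i).integrable (by norm_num)]
      have : ∀ i, ∫ x : Fin n → ℕ → ℝ, f (x i) ∂(rowM n) = m := by
        intro i
        rw [← integral_map (φ := fun x : Fin n → ℕ → ℝ => x i) (f := f) (mp i).measurable.aemeasurable
          hf.1.aestronglyMeasurable, (mp i).map_eq]
      simp [this]
    have hind : iIndepFun (fun i (x : Fin n → ℕ → ℝ) => f (x i)) (rowM n) :=
      iIndepFun_pi (X := fun _ => f) fun i => hf.1.aemeasurable
    have e2 : Var[fun x : Fin n → ℕ → ℝ => ∑ i, f (x i); rowM n] = n * v := by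
      have := IndepFun.variance_sum (s := Finset.univ) (X := fun i (x : Fin n → ℕ → ℝ) => f (x i))
        (μ := rowM n) (fun i _ => ml i) (fun i _ j _ hij => hind.indepFun hij)
      have h3 : (∑ i, fun x : Fin n → ℕ → ℝ => f (x i)) = fun x : Fin n → ℕ → ℝ => ∑ i, f (x i) := by
        ext x; simp
      rw [h3] at this
      rw [this]
      have : ∀ i, Var[fun x : Fin n → ℕ → ℝ => f (x i); rowM n] = v := by
        intro i
        exact (mp i).variance_fun_comp hf.1.aemeasurable
      simp [this]
    have ch := meas_ge_le_variance_div_sq ml' (c := n * ε) (by positivity)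
    rw [e1, e2] at ch
    refine le_trans (measure_mono ?_) (ch.trans (ENNReal.ofReal_le_ofReal ?_))
    · intro x hx
      simp only [Set.mem_setOf_eq, not_lt, Real.dist_eq, av] at hx ⊢
      have : (∑ i, f (x i)) / n - m = ((∑ i, f (x i)) - n * m) / n := by field_simp
      rw [this, abs_div, abs_of_pos hn', le_div_iff₀ hn'] at hx
      linarith
    · apply le_of_eq; field_simp
  have hl : Tendsto (fun n : ℕ => ENNReal.ofReal (v / (n * ε ^ 2))) atTop (nhds 0) := by
    rw [← ENNReal.ofReal_zero]
    apply ENNReal.tendsto_ofReal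
    apply Tendsto.const_div_atTop
    exact (tendsto_natCast_atTop_atTop).atTop_mul_const (by positivity)
  refine tendsto_of_tendsto_of_tendsto_of_le_of_le' tendsto_const_nhds hl
    (Filter.Eventually.of_forall fun _ => zero_le) ?_
  filter_upwards [eventually_gt_atTop 0] with n hn using hb n hn

/-- uniform LLN for powers of linear combinations -/
lemma ulln {κ : Type} [Fintype κ] (n : ℕ) (ω : (ℕ → ℝ) → ℝ) (hω : Tame ω)
    (f : κ → (ℕ → ℝ) → ℝ) (hf : ∀ s, Tame (f s)) (R ε : ℝ) (hε : 0 < ε) :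
    ∀ᶠ e in rowF, ∀ a : κ → ℝ, (∀ s, |a s| ≤ R) →
      |av (fun x => ω x * (∑ s, a s * f s x) ^ n) e
        - ∫ x, ω x * (∑ s, a s * f s x) ^ n ∂(gI ℕ)| ≤ ε := by
  classical
  set g : (Fin n → κ) → (ℕ → ℝ) → ℝ := fun p x => ω x * ∏ i, f (p i) x
  have hg : ∀ p, Tame (g p) := fun p => hω.mul (Tame.prod _ _ fun i _ => hf _)
  have hexp : ∀ (a : κ → ℝ) x, ω x * (∑ s, a s * f s x) ^ n = ∑ p : Fin n → κ, (∏ i, a (p i)) * g p x := by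
    intro a x
    have h1 : (∑ s, a s * f s x) ^ n = ∑ p : Fin n → κ, ∏ i, (a (p i) * f (p i) x) := by
      have := Fintype.sum_pow (fun s => a s * f s x) n
      rw [this]
    rw [h1, Finset.mul_sum]
    refine Finset.sum_congr rfl fun p _ => ?_
    rw [Finset.prod_mul_distrib]; simp only [g]; ring
  have hlim : Tendsto (fun e => ∑ p : Fin n → κ, |R| ^ n * |av (g p) e - ∫ x, g p x ∂(gI ℕ)|) rowF (nhds 0) := by
    have : (0:ℝ) = ∑ p : Fin n → κ, |R| ^ n * |(∫ x, g p x ∂(gI ℕ)) - ∫ x, g p x ∂(gI ℕ)| := by simp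
    rw [this]
    exact tendsto_finsetSum _ fun p _ => (((lln (hg p)).sub_const _).abs).const_mul _
  filter_upwards [hlim.eventually (gt_mem_nhds hε)] with e he a ha
  have e1 : av (fun x => ω x * (∑ s, a s * f s x) ^ n) e = ∑ p : Fin n → κ, (∏ i, a (p i)) * av (g p) e := by
    unfold av
    simp_rw [hexp a]
    rw [Finset.sum_comm, Finset.sum_div]
    refine Finset.sum_congr rfl fun p _ => ?_
    rw [← Finset.mul_sum]; ring
  have e2 : ∫ x, ω x * (∑ s, a s * f s x) ^ n ∂(gI ℕ) = ∑ p : Fin n → κ, (∏ i, a (p i)) * ∫ x, g p x ∂(gI ℕ) := by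
    simp_rw [hexp a]
    rw [integral_finsetSum _ fun p _ => (hg p).integrable.const_mul _]
    simp_rw [integral_const_mul]
  rw [e1, e2, ← Finset.sum_sub_distrib]
  refine (Finset.abs_sum_le_sum_abs _ _).trans (le_trans (Finset.sum_le_sum fun p _ => ?_) he.le)
  rw [← mul_sub, abs_mul]
  refine mul_le_mul_of_nonneg_right ?_ (abs_nonneg _)
  rw [Finset.abs_prod]
  calc ∏ i, |a (p i)| ≤ ∏ _i : Fin n, |R| := Finset.prod_le_prod (fun _ _ => abs_nonneg _)
        fun i _ => (ha _).trans (le_abs_self R)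
    _ = |R| ^ n := by simp

lemma Par.tame_M (p : Par) (j : ℕ) : Tame (p.M j) := by
  exact Tame.of_bdd (p.measurable_M j) 1 fun x => p.M_abs_le j x

lemma Par.tame_F (p : Par) (j : ℕ) : Tame (p.F j) := by
  obtain ⟨C, hC⟩ := p.F_bdd j
  exact Tame.of_bdd (p.measurable_F j) C hC

/-! ### Gram–Schmidt with normalization -/

section GS
variable {V : Type*} [NormedAddCommGroup V] [InnerProductSpace ℝ V]

def gs (m : ℕ → V) (k : ℕ) : V :=
  ‖m k - ∑ t : Fin k, inner ℝ (m k) (gs m t) • gs m t‖⁻¹ •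
    (m k - ∑ t : Fin k, inner ℝ (m k) (gs m t) • gs m t)
  termination_by k
  decreasing_by all_goals exact t.2

/-- unnormalized remainder -/
def gsv (m : ℕ → V) (k : ℕ) : V :=
  m k - ∑ t ∈ Finset.range k, inner ℝ (m k) (gs m t) • gs m t

lemma gs_eq (m : ℕ → V) (k : ℕ) : gs m k = ‖gsv m k‖⁻¹ • gsv m k := by
  rw [gs, gsv, Finset.sum_range fun t => inner ℝ (m k) (gs m t) • gs m t]

lemma gs_zero_or (m : ℕ → V) (k : ℕ) : gs m k = 0 ∨ ‖gs m k‖ = 1 := by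
  rw [gs_eq]
  by_cases h : gsv m k = 0
  · left; simp [h]
  · right
    rw [norm_smul, norm_inv, norm_norm]
    exact inv_mul_cancel₀ (norm_ne_zero_iff.2 h)

lemma gs_norm_le (m : ℕ → V) (k : ℕ) : ‖gs m k‖ ≤ 1 := by
  rcases gs_zero_or m k with h | h <;> simp [h]

lemma gs_orth_lt (m : ℕ → V) (k : ℕ) : ∀ s < k, inner ℝ (gs m s) (gs m k) = 0 := by
  induction k using Nat.strong_induction_on with
  | _ k ih =>
    intro s hs
    rw [gs_eq m k, inner_smul_right]
    have : inner ℝ (gs m s) (gsv m k) = 0 := by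
      rw [gsv, inner_sub_right, inner_sum, Finset.sum_eq_single s]
      · rw [inner_smul_right, real_inner_self_eq_norm_sq]
        rcases gs_zero_or m s with h | h
        · simp [h]
        · rw [h, real_inner_comm]; ring
      · intro t ht hts
        rw [inner_smul_right]
        have ht' : t < k := Finset.mem_range.1 ht
        rcases lt_or_gt_of_ne hts with h | h
        · rw [real_inner_comm (gs m t) (gs m s), ih s hs t h]; simp
        · rw [ih t ht' s h]; simp
      · intro h; exact absurd (Finset.mem_range.2 hs) h
    rw [this, mul_zero]

lemma gs_orth (m : ℕ → V) {s t : ℕ} (h : s ≠ t) : inner ℝ (gs m s) (gs m t) = 0 := by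
  rcases lt_or_gt_of_ne h with h | h
  · exact gs_orth_lt m t s h
  · rw [real_inner_comm]; exact gs_orth_lt m s t h

lemma gs_congr (m m' : ℕ → V) (k : ℕ) (h : ∀ t ≤ k, m t = m' t) : gs m k = gs m' k := by
  induction k using Nat.strong_induction_on with
  | _ k ih =>
    have : gsv m k = gsv m' k := by
      unfold gsv
      rw [h k le_rfl]
      congr 1
      refine Finset.sum_congr rfl fun t ht => ?_
      have ht' := Finset.mem_range.1 ht
      rw [ih t ht' fun s hs => h s (hs.trans ht'.le)]
    rw [gs_eq, gs_eq, this]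

lemma gs_smul (m : ℕ → V) (c : ℝ) (hc : 0 < c) (k : ℕ) : gs (fun j => c • m j) k = gs m k := by
  induction k using Nat.strong_induction_on with
  | _ k ih =>
    have : gsv (fun j => c • m j) k = c • gsv m k := by
      unfold gsv
      rw [smul_sub, Finset.smul_sum]
      congr 1
      refine Finset.sum_congr rfl fun t ht => ?_
      rw [ih t (Finset.mem_range.1 ht), inner_smul_left, smul_smul]; simp
    rw [gs_eq, gs_eq, this, norm_smul, smul_smul, Real.norm_of_nonneg hc.le]
    congr 1
    field_simp

lemma measurable_gs {X : Type*} [MeasurableSpace X] [MeasurableSpace V] [BorelSpace V]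
    [SecondCountableTopology V] (m : X → ℕ → V) (hm : ∀ j, Measurable fun x => m x j) (k : ℕ) :
    Measurable fun x => gs (m x) k := by
  induction k using Nat.strong_induction_on with
  | _ k ih =>
    have : Measurable fun x => gsv (m x) k := by
      unfold gsv
      refine (hm k).sub (Finset.measurable_fun_sum _ fun t ht => ?_)
      have h1 := ih t (Finset.mem_range.1 ht)
      exact ((hm k).inner h1).smul h1
    simp_rw [gs_eq]
    exact this.norm.inv.smul this

end GS

/-! ### Approximation calculus -/

section App
variable {Ξ : Type*} {l : Filter Ξ} {V : Ξ → Type*} [∀ e, NormedAddCommGroup (V e)]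
  [∀ e, InnerProductSpace ℝ (V e)]

def App (l : Filter Ξ) (a b : ∀ e, V e) : Prop := Tendsto (fun e => ‖a e - b e‖) l (nhds 0)
def Bd (l : Filter Ξ) (a : ∀ e, V e) : Prop := ∃ C, 0 ≤ C ∧ ∀ᶠ e in l, ‖a e‖ ≤ C

lemma App.refl (a : ∀ e, V e) : App l a a := by
  unfold App; simpa using tendsto_const_nhds

lemma App.symm {a b : ∀ e, V e} (h : App l a b) : App l b a := by
  unfold App at *; simpa only [norm_sub_rev] using h

lemma app_of_le {a b : ∀ e, V e} (u : Ξ → ℝ) (hu : Tendsto u l (nhds 0))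
    (h : ∀ᶠ e in l, ‖a e - b e‖ ≤ u e) : App l a b :=
  squeeze_zero' (Eventually.of_forall fun _ => norm_nonneg _) h hu

lemma App.add {a b a' b' : ∀ e, V e} (h : App l a b) (h' : App l a' b') :
    App l (fun e => a e + a' e) (fun e => b e + b' e) := by
  refine app_of_le (fun e => ‖a e - b e‖ + ‖a' e - b' e‖) (by simpa using Tendsto.add h h')
    (Eventually.of_forall fun e => ?_)
  rw [add_sub_add_comm]; exact norm_add_le _ _

lemma App.sub {a b a' b' : ∀ e, V e} (h : App l a b) (h' : App l a' b') :
    App l (fun e => a e - a' e) (fun e => b e - b' e) := by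
  refine app_of_le (fun e => ‖a e - b e‖ + ‖a' e - b' e‖) (by simpa using Tendsto.add h h')
    (Eventually.of_forall fun e => ?_)
  rw [sub_sub_sub_comm]; exact norm_sub_le _ _

lemma App.trans {a b c : ∀ e, V e} (h : App l a b) (h' : App l b c) : App l a c := by
  refine app_of_le (fun e => ‖a e - b e‖ + ‖b e - c e‖) (by simpa using Tendsto.add h h')
    (Eventually.of_forall fun e => norm_sub_le_norm_sub_add_norm_sub _ _ _)

lemma App.sum {κ : Type*} (S : Finset κ) {a b : κ → ∀ e, V e} (h : ∀ s ∈ S, App l (a s) (b s)) :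
    App l (fun e => ∑ s ∈ S, a s e) (fun e => ∑ s ∈ S, b s e) := by
  classical
  induction S using Finset.induction_on with
  | empty => simpa using App.refl _
  | insert s S hs ih =>
    simp only [Finset.sum_insert hs]
    exact (h s (by simp)).add (ih fun t ht => h t (by simp [ht]))

lemma Bd.of_app {a b : ∀ e, V e} (h : App l a b) (hb : Bd l b) : Bd l a := by
  obtain ⟨C, hC, h1⟩ := hb
  refine ⟨C + 1, by positivity, ?_⟩
  filter_upwards [h1, h.eventually (gt_mem_nhds zero_lt_one)] with e h1 h2
  have := norm_add_le (a e - b e) (b e)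
  rw [sub_add_cancel] at this
  linarith

lemma App.smul {a b : ∀ e, V e} {c : Ξ → ℝ} {c0 : ℝ} (hc : Tendsto c l (nhds c0)) (h : App l a b)
    (hb : Bd l b) : App l (fun e => c e • a e) (fun e => c0 • b e) := by
  obtain ⟨C, hC, h1⟩ := hb
  refine app_of_le (fun e => |c e| * ‖a e - b e‖ + |c e - c0| * C) ?_ ?_
  · have := ((hc.abs).mul h).add (((hc.sub_const c0).abs).mul_const C)
    simpa using this
  · filter_upwards [h1] with e he
    have : c e • a e - c0 • b e = c e • (a e - b e) + (c e - c0) • b e := by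
      rw [smul_sub, sub_smul]; abel
    rw [this]
    refine (norm_add_le _ _).trans ?_
    rw [norm_smul, norm_smul, Real.norm_eq_abs, Real.norm_eq_abs]
    gcongr

lemma App.smul_zero {b : ∀ e, V e} {c : Ξ → ℝ} (hc : Tendsto c l (nhds 0))
    (hb : Bd l b) : App l (fun e => c e • b e) (fun _ => 0) := by
  simpa using App.smul hc (App.refl b) hb

lemma App.inn {a b a' b' : ∀ e, V e} (h : App l a a') (h' : App l b b') (ha : Bd l a') (hb : Bd l b') :
    Tendsto (fun e => inner ℝ (a e) (b e) - inner ℝ (a' e) (b' e)) l (nhds 0) := by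
  have hb2 := Bd.of_app h' hb
  obtain ⟨C, hC, h1⟩ := ha
  obtain ⟨D, hD, h2⟩ := hb2
  refine squeeze_zero_norm' (a := fun e => ‖a e - a' e‖ * D + C * ‖b e - b' e‖) ?_ ?_
  · filter_upwards [h1, h2] with e h1 h2
    have : inner ℝ (a e) (b e) - inner ℝ (a' e) (b' e)
      = inner ℝ (a e - a' e) (b e) + inner ℝ (a' e) (b e - b' e) := by
      rw [inner_sub_left, inner_sub_right]; ring
    rw [this]
    refine (norm_add_le _ _).trans ?_
    have k1 := norm_inner_le_norm (𝕜 := ℝ) (a e - a' e) (b e)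
    have k2 := norm_inner_le_norm (𝕜 := ℝ) (a' e) (b e - b' e)
    refine add_le_add (k1.trans ?_) (k2.trans ?_) <;> gcongr
  · have := (Tendsto.mul_const D h).add (Tendsto.const_mul C h')
    simpa using this

lemma App.inner_tendsto {a b a' b' : ∀ e, V e} {c : ℝ} (h : App l a a') (h' : App l b b')
    (ha : Bd l a') (hb : Bd l b')
    (hc : Tendsto (fun e => Inner.inner ℝ (a' e) (b' e)) l (nhds c)) :
    Tendsto (fun e => Inner.inner ℝ (a e) (b e)) l (nhds c) := by
  have := (App.inn h h' ha hb).add hc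
  simpa using this

lemma Bd.of_tendsto {a : ∀ e, V e} {c : ℝ} (h : Tendsto (fun e => Inner.inner ℝ (a e) (a e)) l (nhds c)) :
    Bd l a := by
  refine ⟨√(|c| + 1), by positivity, ?_⟩
  filter_upwards [h.eventually (gt_mem_nhds (show c < |c| + 1 by linarith [le_abs_self c]))] with e he
  rw [real_inner_self_eq_norm_sq] at he
  exact Real.le_sqrt_of_sq_le he.le

lemma Bd.add {a b : ∀ e, V e} (ha : Bd l a) (hb : Bd l b) : Bd l (fun e => a e + b e) := by
  obtain ⟨C, hC, h1⟩ := ha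
  obtain ⟨D, hD, h2⟩ := hb
  refine ⟨C + D, by positivity, ?_⟩
  filter_upwards [h1, h2] with e h1 h2 using (norm_add_le _ _).trans (add_le_add h1 h2)

lemma Bd.smul {a : ∀ e, V e} (c : ℝ) (ha : Bd l a) : Bd l (fun e => c • a e) := by
  obtain ⟨C, hC, h1⟩ := ha
  refine ⟨|c| * C, by positivity, ?_⟩
  filter_upwards [h1] with e h1
  rw [norm_smul, Real.norm_eq_abs]; gcongr

lemma Bd.zero : Bd l (fun e => (0 : V e)) := ⟨0, le_rfl, by simp⟩

lemma Bd.sum {κ : Type*} (S : Finset κ) {a : κ → ∀ e, V e} (h : ∀ s ∈ S, Bd l (a s)) :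
    Bd l (fun e => ∑ s ∈ S, a s e) := by
  classical
  induction S using Finset.induction_on with
  | empty => simpa using Bd.zero
  | insert s S hs ih =>
    simp only [Finset.sum_insert hs]
    exact (h s (by simp)).add (ih fun t ht => h t (by simp [ht]))

/-- stability of Gram–Schmidt -/
lemma gs_stable (J : ℕ) (m f : ℕ → ∀ e, V e) (γ η : ℕ → ℝ) (hη : ∀ j, 0 < η j)
    (hm : ∀ j ≤ J, App l (m j) (fun e => (∑ t ∈ Finset.range j, γ t • f t e) + η j • f j e))
    (hf : ∀ s t, Tendsto (fun e => Inner.inner ℝ (f s e) (f t e)) l (nhds (if s = t then 1 else 0))) :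
    ∀ j ≤ J, App l (fun e => gs (fun i => m i e) j) (f j) := by
  intro j
  have bf : ∀ s, Bd l (f s) := fun s => Bd.of_tendsto (hf s s)
  induction j using Nat.strong_induction_on with
  | _ j ih =>
    intro hj
    have bm : Bd l (fun e => (∑ t ∈ Finset.range j, γ t • f t e) + η j • f j e) :=
      (Bd.sum _ fun t _ => (bf t).smul _).add ((bf j).smul _)
    have h1 : ∀ t < j, Tendsto (fun e => Inner.inner ℝ (m j e) (gs (fun i => m i e) t)) l (nhds (γ t)) := by
      intro t ht
      refine App.inner_tendsto (hm j hj) (ih t ht (ht.le.trans hj)) bm (bf t) ?_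
      have hh : ∀ e, Inner.inner ℝ ((∑ s ∈ Finset.range j, γ s • f s e) + η j • f j e) (f t e)
        = (∑ s ∈ Finset.range j, γ s * Inner.inner ℝ (f s e) (f t e)) + η j * Inner.inner ℝ (f j e) (f t e) := by
        intro e
        rw [inner_add_left, sum_inner]
        simp [inner_smul_left]
      simp_rw [hh]
      have : γ t = (∑ s ∈ Finset.range j, γ s * (if s = t then 1 else 0)) + η j * (if j = t then 1 else 0) := by
        simp [ht, ht.ne']
      rw [this]
      exact (tendsto_finsetSum _ fun s _ => (hf s t).const_mul _).add ((hf j t).const_mul _)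
    have h2 : App l (fun e => gsv (fun i => m i e) j) (fun e => η j • f j e) := by
      have k1 : App l (fun e => ∑ t ∈ Finset.range j,
          (Inner.inner ℝ (m j e) (gs (fun i => m i e) t)) • gs (fun i => m i e) t)
          (fun e => ∑ t ∈ Finset.range j, γ t • f t e) := by
        refine App.sum _ fun t ht => ?_
        have ht' := Finset.mem_range.1 ht
        exact App.smul (h1 t ht') (ih t ht' (ht'.le.trans hj)) (bf t)
      have := (hm j hj).sub k1
      simp only [add_sub_cancel_left] at this
      exact this
    have h3 : Tendsto (fun e => ‖gsv (fun i => m i e) j‖) l (nhds (η j)) := by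
      have k : Tendsto (fun e => Inner.inner ℝ (gsv (fun i => m i e) j) (gsv (fun i => m i e) j)) l
          (nhds (η j ^ 2)) := by
        refine App.inner_tendsto h2 h2 ((bf j).smul _) ((bf j).smul _) ?_
        simp_rw [inner_smul_left, inner_smul_right]
        have := ((hf j j).const_mul (η j)).const_mul (η j)
        simp at this ⊢
        rw [pow_two]; exact this
      have := k.sqrt
      rw [Real.sqrt_sq (hη j).le] at this
      refine this.congr fun e => ?_
      rw [real_inner_self_eq_norm_sq, Real.sqrt_sq (norm_nonneg _)]
    have h4 := App.smul (h3.inv₀ (hη j).ne') h2 ((bf j).smul (η j))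
    simp only [smul_smul, inv_mul_cancel₀ (hη j).ne', one_smul] at h4
    simp_rw [gs_eq]
    exact h4

end App

/-! ### Conditioning map for GOE matrices -/

abbrev EE (N : ℕ) := EuclideanSpace ℝ (Fin N)

def mv {N : ℕ} (A : Fin N → Fin N → ℝ) (u : EE N) : EE N := WithLp.toLp 2 fun i => ∑ j, A i j * u j

lemma inner_EE {N : ℕ} (u v : EE N) : inner ℝ u v = ∑ i, u i * v i := by
  rw [PiLp.inner_apply]
  refine Finset.sum_congr rfl fun i _ => ?_
  simp [mul_comm]

lemma norm_sq_EE {N : ℕ} (u : EE N) : ‖u‖ ^ 2 = ∑ i, u i ^ 2 := by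
  rw [← real_inner_self_eq_norm_sq, inner_EE]
  simp [pow_two]

def Qm {N : ℕ} (φ : EE N) (i j : Fin N) : ℝ := (if i = j then 1 else 0) - φ i * φ j

def Th {N : ℕ} (φ g : EE N) (X : Fin N → Fin N → ℝ) (i j : Fin N) : ℝ :=
  (∑ a, ∑ b, Qm φ i a * Qm φ j b * X a b) + g i * φ j + φ i * g j
    + (√2 - 2) * inner ℝ φ g * (φ i * φ j)

lemma Th_symm {N : ℕ} (φ g : EE N) (X : Fin N → Fin N → ℝ) (hX : ∀ i j, X i j = X j i) (i j : Fin N) :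
    Th φ g X i j = Th φ g X j i := by
  unfold Th
  have : ∑ a, ∑ b, Qm φ i a * Qm φ j b * X a b = ∑ a, ∑ b, Qm φ j a * Qm φ i b * X a b := by
    rw [Finset.sum_comm]
    refine Finset.sum_congr rfl fun a _ => Finset.sum_congr rfl fun b _ => ?_
    rw [hX b a]; ring
  rw [this]; ring

lemma sum_Qm {N : ℕ} (φ u : EE N) (i : Fin N) : ∑ j, Qm φ i j * u j = u i - inner ℝ φ u * φ i := by
  unfold Qm
  simp only [sub_mul, Finset.sum_sub_distrib, ite_mul, one_mul, zero_mul, Finset.sum_ite_eq,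
    Finset.mem_univ, if_true]
  rw [inner_EE, Finset.sum_mul]
  congr 1
  exact Finset.sum_congr rfl fun j _ => by ring

lemma Qm_symm {N : ℕ} (φ : EE N) (i j : Fin N) : Qm φ i j = Qm φ j i := by
  unfold Qm; simp only [eq_comm, mul_comm]

def prQ {N : ℕ} (φ u : EE N) : EE N := u - inner ℝ φ u • φ

lemma prQ_apply {N : ℕ} (φ u : EE N) (i : Fin N) : prQ φ u i = u i - inner ℝ φ u * φ i := by
  simp [prQ]

lemma mv_Th {N : ℕ} (φ g : EE N) (X : Fin N → Fin N → ℝ) (u : EE N) :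
    mv (Th φ g X) u = prQ φ (mv X (prQ φ u)) + (inner ℝ φ u • g + inner ℝ g u • φ
      + ((√2 - 2) * inner ℝ φ g * inner ℝ φ u) • φ) := by
  ext i
  have e1 : ∑ j, (∑ a, ∑ b, Qm φ i a * Qm φ j b * X a b) * u j
      = ∑ a, Qm φ i a * mv X (prQ φ u) a := by
    calc ∑ j, (∑ a, ∑ b, Qm φ i a * Qm φ j b * X a b) * u j
        = ∑ j, ∑ a, ∑ b, Qm φ i a * Qm φ j b * X a b * u j := by
          refine Finset.sum_congr rfl fun j _ => ?_
          rw [Finset.sum_mul]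
          refine Finset.sum_congr rfl fun a _ => ?_
          rw [Finset.sum_mul]
      _ = ∑ a, ∑ b, ∑ j, Qm φ i a * Qm φ j b * X a b * u j := by
          rw [Finset.sum_comm]
          refine Finset.sum_congr rfl fun a _ => ?_
          rw [Finset.sum_comm]
      _ = _ := by
          refine Finset.sum_congr rfl fun a _ => ?_
          simp only [mv]
          rw [Finset.mul_sum]
          refine Finset.sum_congr rfl fun b _ => ?_
          rw [prQ_apply, ← sum_Qm, Finset.mul_sum, Finset.mul_sum]
          refine Finset.sum_congr rfl fun j _ => ?_
          rw [Qm_symm φ j b]; ring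
  rw [sum_Qm] at e1
  have e2 : mv (Th φ g X) u i = ∑ j, ((∑ a, ∑ b, Qm φ i a * Qm φ j b * X a b) * u j
      + (φ j * u j) * g i + (g j * u j) * φ i + (φ j * u j) * ((√2 - 2) * inner ℝ φ g * φ i)) := by
    simp only [mv, Th]
    refine Finset.sum_congr rfl fun j _ => by ring
  rw [e2]
  simp only [Finset.sum_add_distrib, ← Finset.sum_mul]
  rw [e1, ← inner_EE, ← inner_EE]
  simp [prQ]
  ring

lemma qf_eq_inner {N : ℕ} (A : Fin N → Fin N → ℝ) (u : EE N) : qf A u = inner ℝ u (mv A u) := by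
  rw [inner_EE, qf]
  refine Finset.sum_congr rfl fun i _ => ?_
  simp only [mv]
  rw [Finset.mul_sum]
  exact Finset.sum_congr rfl fun j _ => by ring

lemma mv_symm {N : ℕ} (A : Fin N → Fin N → ℝ) (hA : ∀ i j, A i j = A j i) (u v : EE N) :
    inner ℝ u (mv A v) = inner ℝ (mv A u) v := by
  rw [inner_EE, inner_EE]
  simp only [mv, Finset.mul_sum, Finset.sum_mul]
  rw [Finset.sum_comm]
  refine Finset.sum_congr rfl fun i _ => Finset.sum_congr rfl fun j _ => ?_
  rw [hA i j]; ring

lemma gram_sym {N : ℕ} (R : Fin N → Fin N → ℝ) (i j k l : Fin N) :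
    ∑ p : Fin N × Fin N, ((R i p.1 * R j p.2 + R i p.2 * R j p.1) / √2)
        * ((R k p.1 * R l p.2 + R k p.2 * R l p.1) / √2)
      = (∑ c, R i c * R k c) * (∑ c, R j c * R l c) + (∑ c, R i c * R l c) * (∑ c, R j c * R k c) := by
  rw [Fintype.sum_prod_type]
  have h2 : √2 * √2 = 2 := Real.mul_self_sqrt (by norm_num)
  have e : ∀ c d, ((R i c * R j d + R i d * R j c) / √2) * ((R k c * R l d + R k d * R l c) / √2)
      = (1/2) * ((R i c * R k c) * (R j d * R l d)) + (1/2) * ((R i c * R l c) * (R j d * R k d))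
        + (1/2) * ((R j c * R k c) * (R i d * R l d)) + (1/2) * ((R j c * R l c) * (R i d * R k d)) := by
    intro c d
    rw [div_mul_div_comm, h2]; ring
  simp only [e, Finset.sum_add_distrib, ← Finset.mul_sum, ← Finset.sum_mul]
  ring

lemma Qm_sq {N : ℕ} (φ : EE N) (hφ : φ = 0 ∨ ‖φ‖ = 1) (i k : Fin N) :
    ∑ c, Qm φ i c * Qm φ k c = Qm φ i k := by
  have h := sum_Qm φ (WithLp.toLp 2 fun c => Qm φ k c) i
  simp only at h
  have h3 : inner ℝ φ (WithLp.toLp 2 fun c => Qm φ k c : EE N) = φ k - inner ℝ φ φ * φ k := by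
    rw [inner_EE, ← sum_Qm]
    refine Finset.sum_congr rfl fun c _ => ?_
    ring
  rw [h, h3, Qm_symm φ k i]
  rcases hφ with rfl | h1
  · simp
  · rw [real_inner_self_eq_norm_sq, h1]; ring

lemma gI_fin_eq (ι : Type) [Fintype ι] : gI ι = Measure.pi fun _ => gm := Measure.infinitePi_eq_pi _

lemma gI_sum (ι ι' : Type) [Fintype ι] [Fintype ι'] :
    (gI ι).prod (gI ι') = (gI (ι ⊕ ι')).map (fun x => (fun i => x (Sum.inl i), fun i => x (Sum.inr i))) := by
  have := (measurePreserving_sumPiEquivProdPi (X := fun _ : ι ⊕ ι' => ℝ) (fun _ => gm)).map_eq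
  rw [gI_fin_eq, gI_fin_eq, gI_fin_eq, ← this]
  rfl

lemma law_Th {N : ℕ} (φ : EE N) (hφ : φ = 0 ∨ ‖φ‖ = 1) :
    ((gI (Fin N)).prod (gI (Fin N × Fin N))).map
        (fun p => Th φ (WithLp.toLp 2 p.1) (Xmat p.2)) = (gI (Fin N × Fin N)).map Xmat := by
  classical
  have h2 : √2 * √2 = 2 := Real.mul_self_sqrt (by norm_num)
  have h20 : √2 ≠ 0 := by positivity
  set a : Fin N × Fin N → (Fin N ⊕ (Fin N × Fin N)) → ℝ := fun k s =>
    Sum.elim (fun c => (if k.1 = c then 1 else 0) * φ k.2 + (if k.2 = c then 1 else 0) * φ k.1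
        + (√2 - 2) * φ c * (φ k.1 * φ k.2))
      (fun c => (Qm φ k.1 c.1 * Qm φ k.2 c.2 + Qm φ k.1 c.2 * Qm φ k.2 c.1) / √2) s with ha
  set δ : Fin N → Fin N → ℝ := fun i j => if i = j then 1 else 0 with hδ
  set b : Fin N × Fin N → Fin N × Fin N → ℝ := fun k c =>
    (δ k.1 c.1 * δ k.2 c.2 + δ k.1 c.2 * δ k.2 c.1) / √2 with hb
  have hgram : ∀ k l, ∑ s, a k s * a l s = ∑ s, b k s * b l s := by
    rintro ⟨i, j⟩ ⟨k, l⟩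
    rw [Fintype.sum_sum_type]
    simp only [ha, hb, Sum.elim_inl, Sum.elim_inr]
    rw [gram_sym (Qm φ), gram_sym δ, Qm_sq φ hφ, Qm_sq φ hφ, Qm_sq φ hφ, Qm_sq φ hφ]
    have hdd : ∀ i k, ∑ c, δ i c * δ k c = δ i k := by
      intro i k; simp [hδ]
    rw [hdd, hdd, hdd, hdd]
    set n : ℝ := ∑ c, φ c * φ c with hn
    have hs : ∑ c, ((if i = c then 1 else 0) * φ j + (if j = c then 1 else 0) * φ i
        + (√2 - 2) * φ c * (φ i * φ j)) * ((if k = c then 1 else 0) * φ l + (if l = c then 1 else 0) * φ k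
        + (√2 - 2) * φ c * (φ k * φ l)) =
        δ i k * (φ j * φ l) + δ i l * (φ j * φ k) + δ j k * (φ i * φ l) + δ j l * (φ i * φ k)
        + 4 * (√2 - 2) * (φ i * φ j * φ k * φ l) + (√2 - 2) ^ 2 * n * (φ i * φ j * φ k * φ l) := by
      have e : ∀ c, ((if i = c then 1 else 0) * φ j + (if j = c then 1 else 0) * φ i
        + (√2 - 2) * φ c * (φ i * φ j)) * ((if k = c then 1 else 0) * φ l + (if l = c then 1 else 0) * φ k
        + (√2 - 2) * φ c * (φ k * φ l))
        = (φ j * φ l) * (δ i c * δ k c) + (φ j * φ k) * (δ i c * δ l c) + (φ i * φ l) * (δ j c * δ k c)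
          + (φ i * φ k) * (δ j c * δ l c) + ((√2 - 2) * (φ k * φ l) * φ j) * (δ i c * φ c)
          + ((√2 - 2) * (φ k * φ l) * φ i) * (δ j c * φ c)
          + ((√2 - 2) * (φ i * φ j) * φ l) * (δ k c * φ c)
          + ((√2 - 2) * (φ i * φ j) * φ k) * (δ l c * φ c)
          + ((√2 - 2) ^ 2 * (φ i * φ j * φ k * φ l)) * (φ c * φ c) := by
        intro c; simp only [hδ]; ring
      have hdf : ∀ i, ∑ c, δ i c * φ c = φ i := by intro i; simp [hδ]
      simp only [e, Finset.sum_add_distrib, ← Finset.mul_sum, hdd, hdf]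
      ring
    rw [hs]
    have hQ : ∀ i j, Qm φ i j = δ i j - φ i * φ j := fun i j => rfl
    rw [hQ, hQ, hQ, hQ]
    rcases hφ with h0 | h1
    · simp [h0]
    · have : n = 1 := by
        rw [hn, ← inner_EE, real_inner_self_eq_norm_sq, h1]; ring
      rw [this]
      have h22 : (√2 - 2) ^ 2 = 6 - 4 * √2 := by nlinarith
      rw [h22]; ring
  have hl := law_eq Finset.univ Finset.univ a b hgram
  -- currying
  have mcur : Measurable (fun (x : Fin N × Fin N → ℝ) (i j : Fin N) => x (i, j)) := by fun_prop
  have hl' := congrArg (fun μ => μ.map (fun (x : Fin N × Fin N → ℝ) (i j : Fin N) => x (i, j))) hl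
  beta_reduce at hl'
  rw [Measure.map_map mcur (by fun_prop), Measure.map_map mcur (by fun_prop)] at hl'
  have mTh : Measurable (fun p : (Fin N → ℝ) × (Fin N × Fin N → ℝ) => Th φ (WithLp.toLp 2 p.1) (Xmat p.2)) := by
    refine measurable_pi_lambda _ fun i => measurable_pi_lambda _ fun j => ?_
    simp only [Th, Xmat, inner_EE]
    fun_prop
  rw [gI_sum, Measure.map_map mTh (by fun_prop)]
  convert hl' using 2
  · ext x i j
    simp only [Function.comp, Th, Fintype.sum_sum_type, ha, Sum.elim_inl, Sum.elim_inr]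
    rw [Fintype.sum_prod_type]
    simp only [add_mul, Finset.sum_add_distrib]
    have t1 : ∑ c, (if i = c then (1:ℝ) else 0) * φ j * x (Sum.inl c) = x (Sum.inl i) * φ j := by
      simp [mul_comm]
    have t2 : ∑ c, (if j = c then (1:ℝ) else 0) * φ i * x (Sum.inl c) = φ i * x (Sum.inl j) := by
      simp
    have t3 : ∑ c, (√2 - 2) * φ c * (φ i * φ j) * x (Sum.inl c)
        = (√2 - 2) * inner ℝ φ (WithLp.toLp 2 fun c => x (Sum.inl c)) * (φ i * φ j) := by
      rw [inner_EE, Finset.mul_sum, Finset.sum_mul]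
      exact Finset.sum_congr rfl fun c _ => by ring
    rw [t1, t2, t3]
    have t4 : ∑ c, ∑ d, Qm φ i c * Qm φ j d * Xmat (fun i => x (Sum.inr i)) c d
        = ∑ c, ∑ d, (Qm φ i c * Qm φ j d + Qm φ i d * Qm φ j c) / √2 * x (Sum.inr (c, d)) := by
      have u1 : ∑ c, ∑ d, Qm φ i c * Qm φ j d * Xmat (fun i => x (Sum.inr i)) c d
        = (∑ c, ∑ d, Qm φ i c * Qm φ j d / √2 * x (Sum.inr (c, d)))
          + ∑ c, ∑ d, Qm φ i c * Qm φ j d / √2 * x (Sum.inr (d, c)) := by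
        rw [← Finset.sum_add_distrib]
        refine Finset.sum_congr rfl fun c _ => ?_
        rw [← Finset.sum_add_distrib]
        refine Finset.sum_congr rfl fun d _ => ?_
        simp only [Xmat]; ring
      rw [u1]
      rw [Finset.sum_comm (f := fun c d => Qm φ i c * Qm φ j d / √2 * x (Sum.inr (d, c)))]
      rw [← Finset.sum_add_distrib]
      refine Finset.sum_congr rfl fun c _ => ?_
      rw [← Finset.sum_add_distrib]
      refine Finset.sum_congr rfl fun d _ => ?_
      ring
    rw [t4]; ring
  · ext x i j
    simp only [Function.comp, Xmat, hb, hδ]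
    rw [Fintype.sum_prod_type]
    have u1 : ∀ c d, ((if i = c then (1:ℝ) else 0) * (if j = d then 1 else 0)
        + (if i = d then 1 else 0) * (if j = c then 1 else 0)) / √2 * x (c, d)
        = (if i = c then (if j = d then x (c, d) / √2 else 0) else 0)
          + (if i = d then (if j = c then x (c, d) / √2 else 0) else 0) := by
      intro c d
      split_ifs <;> ring
    simp only [u1, Finset.sum_add_distrib]
    simp [add_div]

/-! ### Iterated conditioning -/

def Xh {N : ℕ} (φ c : ℕ → EE N) : ℕ → (Fin N → Fin N → ℝ) → (Fin N → Fin N → ℝ)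
  | 0, X => X
  | K + 1, X => Xh φ c K (Th (φ K) (c K) X)

lemma Xh_symm {N : ℕ} (φ c : ℕ → EE N) (K : ℕ) (X : Fin N → Fin N → ℝ) (hX : ∀ i j, X i j = X j i) :
    ∀ i j, Xh φ c K X i j = Xh φ c K X j i := by
  induction K generalizing X with
  | zero => exact hX
  | succ K ih => exact ih _ (Th_symm _ _ _ hX)

lemma Xmat_symm {N : ℕ} (Y : Fin N × Fin N → ℝ) (i j : Fin N) : Xmat Y i j = Xmat Y j i := by
  simp [Xmat, add_comm]

lemma Xh_congr {N : ℕ} (φ c φ' c' : ℕ → EE N) (K : ℕ) (h : ∀ s < K, φ s = φ' s) (h' : ∀ s < K, c s = c' s)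
    (X : Fin N → Fin N → ℝ) : Xh φ c K X = Xh φ' c' K X := by
  induction K generalizing X with
  | zero => rfl
  | succ K ih =>
    simp only [Xh]
    rw [h K (by omega), h' K (by omega)]
    exact ih (fun s hs => h s (by omega)) (fun s hs => h' s (by omega)) _

/-- projection off the first K vectors -/
def PK {N : ℕ} (φ : ℕ → EE N) (K : ℕ) (u : EE N) : EE N := u - ∑ s ∈ Finset.range K, inner ℝ (φ s) u • φ s

structure ON {N : ℕ} (φ : ℕ → EE N) : Prop where
  orth : ∀ s t, s ≠ t → inner ℝ (φ s) (φ t) = 0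
  z1 : ∀ s, φ s = 0 ∨ ‖φ s‖ = 1

section
variable {N : ℕ} {φ : ℕ → EE N}

lemma PK_succ (K : ℕ) (u : EE N) : PK φ (K + 1) u = PK φ K u - inner ℝ (φ K) u • φ K := by
  unfold PK; rw [Finset.sum_range_succ]; abel

lemma PK_add (K : ℕ) (u v : EE N) : PK φ K (u + v) = PK φ K u + PK φ K v := by
  unfold PK
  simp only [inner_add_right, add_smul, Finset.sum_add_distrib]; abel

lemma PK_smul (K : ℕ) (a : ℝ) (v : EE N) : PK φ K (a • v) = a • PK φ K v := by
  unfold PK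
  simp only [inner_smul_right, smul_sub, Finset.smul_sum, smul_smul]

lemma PK_sub (K : ℕ) (u v : EE N) : PK φ K (u - v) = PK φ K u - PK φ K v := by
  have := PK_add (φ := φ) K (u - v) v
  rw [sub_add_cancel] at this
  rw [this]; abel

lemma PK_inner (K : ℕ) (u v : EE N) : inner ℝ u (PK φ K v) = inner ℝ (PK φ K u) v := by
  unfold PK
  rw [inner_sub_right, inner_sub_left, inner_sum, sum_inner]
  congr 1
  refine Finset.sum_congr rfl fun s _ => ?_
  rw [inner_smul_right, inner_smul_left, real_inner_comm u (φ s)]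
  simp; ring


lemma PK_phi_ge (hφ : ON φ) (K r : ℕ) (h : K ≤ r) : PK φ K (φ r) = φ r := by
  unfold PK
  rw [Finset.sum_eq_zero, sub_zero]
  intro s hs
  rw [hφ.orth s r (by have := Finset.mem_range.1 hs; omega), zero_smul]


lemma PK_phi_lt (hφ : ON φ) (K r : ℕ) (h : r < K) : PK φ K (φ r) = 0 := by
  unfold PK
  rw [Finset.sum_eq_single r]
  · rw [real_inner_self_eq_norm_sq]
    rcases hφ.z1 r with h | h
    · simp [h]
    · simp [h]
  · intro s _ hs
    rw [hφ.orth s r hs, zero_smul]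
  · intro h'; exact absurd (Finset.mem_range.2 h) h'


lemma PK_inner_phi (hφ : ON φ) (K : ℕ) (u : EE N) : inner ℝ (φ K) (PK φ K u) = inner ℝ (φ K) u := by
  rw [PK_inner, PK_phi_ge hφ K K le_rfl]


lemma prQ_PK (hφ : ON φ) (K : ℕ) (u : EE N) : prQ (φ K) (PK φ K u) = PK φ (K + 1) u := by
  rw [prQ, PK_inner_phi hφ, PK_succ]


lemma PK_prQ (hφ : ON φ) (K : ℕ) (u : EE N) : PK φ K (prQ (φ K) u) = PK φ (K + 1) u := by
  rw [prQ, PK_sub, PK_smul, PK_phi_ge hφ K K le_rfl, PK_succ]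


lemma mv_Xh (hφ : ON φ) (c : ℕ → EE N) (K : ℕ) (X : Fin N → Fin N → ℝ) (u : EE N) :
    mv (Xh φ c K X) u = PK φ K (mv X (PK φ K u)) + ∑ s ∈ Finset.range K,
      (inner ℝ (φ s) u • PK φ s (c s) + inner ℝ (c s) (PK φ s u) • φ s
        + ((√2 - 2) * inner ℝ (φ s) (c s) * inner ℝ (φ s) u) • φ s) := by
  induction K generalizing X with
  | zero => simp [Xh, PK]
  | succ K ih =>
    simp only [Xh]
    rw [ih, mv_Th, PK_add, prQ_PK hφ, PK_prQ hφ, Finset.sum_range_succ, PK_add, PK_add, PK_smul,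
      PK_smul, PK_smul, PK_phi_ge hφ K K le_rfl, PK_inner_phi hφ]
    abel


lemma qf_Xh (hφ : ON φ) (c : ℕ → EE N) (K : ℕ) (X : Fin N → Fin N → ℝ) (u : EE N) :
    qf (Xh φ c K X) u = qf X (PK φ K u) + ∑ s ∈ Finset.range K,
      (2 * inner ℝ (φ s) u * inner ℝ (c s) (PK φ s u)
        + (√2 - 2) * inner ℝ (φ s) (c s) * inner ℝ (φ s) u ^ 2) := by
  rw [qf_eq_inner, qf_eq_inner, mv_Xh hφ, inner_add_right, PK_inner, inner_sum]
  congr 1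
  refine Finset.sum_congr rfl fun s _ => ?_
  rw [inner_add_right, inner_add_right, inner_smul_right, inner_smul_right, inner_smul_right, PK_inner,
    real_inner_comm (φ s) u, real_inner_comm (PK φ s u) (c s)]
  ring


lemma mv_Xh_phi (hφ : ON φ) (c : ℕ → EE N) (K r : ℕ) (hr : r < K) (X : Fin N → Fin N → ℝ) (h1 : ‖φ r‖ = 1) :
    mv (Xh φ c K X) (φ r) = PK φ r (c r) + ((√2 - 1) * inner ℝ (φ r) (c r)) • φ r
      + ∑ s ∈ Finset.range r, inner ℝ (c s) (φ r) • φ s := by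
  rw [mv_Xh hφ, PK_phi_lt hφ K r hr]
  have z : mv X (0 : EE N) = 0 := by ext i; simp [mv]
  have z' : PK φ K (0 : EE N) = 0 := by simp [PK]
  rw [z, z', zero_add]
  have hrr : inner ℝ (φ r) (φ r) = (1:ℝ) := by rw [real_inner_self_eq_norm_sq, h1]; norm_num
  have hsplit : Finset.range K = Finset.range r ∪ ({r} ∪ Finset.Ico (r+1) K) := by
    ext x; simp; omega
  rw [hsplit, Finset.sum_union, Finset.sum_union]
  · have e1 : ∑ s ∈ Finset.range r, (inner ℝ (φ s) (φ r) • PK φ s (c s) + inner ℝ (c s) (PK φ s (φ r)) • φ s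
        + ((√2 - 2) * inner ℝ (φ s) (c s) * inner ℝ (φ s) (φ r)) • φ s)
        = ∑ s ∈ Finset.range r, inner ℝ (c s) (φ r) • φ s := by
      refine Finset.sum_congr rfl fun s hs => ?_
      have hs' := Finset.mem_range.1 hs
      rw [hφ.orth s r hs'.ne, PK_phi_ge hφ s r hs'.le]
      simp
    have e2 : ∑ s ∈ Finset.Ico (r+1) K, (inner ℝ (φ s) (φ r) • PK φ s (c s) + inner ℝ (c s) (PK φ s (φ r)) • φ s
        + ((√2 - 2) * inner ℝ (φ s) (c s) * inner ℝ (φ s) (φ r)) • φ s) = 0 := by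
      refine Finset.sum_eq_zero fun s hs => ?_
      have hs' : r < s := by have := Finset.mem_Ico.1 hs; omega
      rw [hφ.orth s r hs'.ne', PK_phi_lt hφ s r hs']
      simp
    rw [e1, e2, Finset.sum_singleton, hrr, PK_phi_ge hφ r r le_rfl, real_inner_comm (φ r) (c r)]
    have : ((√2 - 1) * inner ℝ (φ r) (c r)) • φ r = inner ℝ (φ r) (c r) • φ r
        + ((√2 - 2) * inner ℝ (φ r) (c r) * 1) • φ r := by
      rw [← add_smul]; congr 1; ring
    rw [this, one_smul]; abel
  · rw [Finset.disjoint_left]; intro x hx hx'; simp at hx hx'; omega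
  · rw [Finset.disjoint_left]; intro x hx hx'; simp at hx hx'; omega


/-- Bessel with remainder -/
lemma PK_norm_sq (hφ : ON φ) (K : ℕ) (u : EE N) :
    ‖PK φ K u‖ ^ 2 + ∑ s ∈ Finset.range K, inner ℝ (φ s) u ^ 2 = ‖u‖ ^ 2 := by
  induction K with
  | zero => simp [PK]
  | succ K ih =>
    rw [PK_succ, Finset.sum_range_succ, ← ih, norm_sub_sq_real, inner_smul_right, real_inner_comm (φ K) (PK φ K u),
      PK_inner_phi hφ, norm_smul, mul_pow, Real.norm_eq_abs, sq_abs]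
    rcases hφ.z1 K with h | h
    · simp [h]
    · rw [h]; ring

end

/-! ### Law of the iterated conditioning -/

def updc {N : ℕ} (K : ℕ) (g : Fin N → ℕ → ℝ) (z : Fin N → ℝ) : Fin N → ℕ → ℝ :=
  fun i => Function.update (g i) K (z i)

lemma measurable_updc {N : ℕ} (K : ℕ) :
    Measurable (fun p : (Fin N → ℕ → ℝ) × (Fin N → ℝ) => updc K p.1 p.2) := by
  refine measurable_pi_lambda _ fun i => ?_
  exact (measurable_update_pair K).comp (f := fun p : (Fin N → ℕ → ℝ) × (Fin N → ℝ) => (p.1 i, p.2 i))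
    (by fun_prop)

lemma col_update {N : ℕ} (K : ℕ) :
    ((rowM N).prod (gI (Fin N))).map (fun p => updc K p.1 p.2) = rowM N := by
  have h1 := (measurePreserving_arrowProdEquivProdArrow (ℕ → ℝ) ℝ (Fin N) (fun _ => gI ℕ) (fun _ => gm)).map_eq
  have hh : rowM N = Measure.pi (fun _ : Fin N => gI ℕ) := rfl
  rw [gI_fin_eq (Fin N), hh, ← h1, Measure.map_map (measurable_updc K) (by measurability)]
  have h2 : Measure.map (fun (x : Fin N → (ℕ → ℝ) × ℝ) i => Function.update (x i).1 K (x i).2)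
      (Measure.pi fun _ => (gI ℕ).prod gm)
      = Measure.pi fun i => Measure.map (fun x : (ℕ → ℝ) × ℝ => Function.update x.1 K x.2) ((gI ℕ).prod gm) := by
    have := map_update_gI (ι := ℕ) K
    have : ∀ i : Fin N, SigmaFinite (Measure.map (fun x : (ℕ → ℝ) × ℝ => Function.update x.1 K x.2)
        ((gI ℕ).prod gm)) := by
      intro i; rw [this]; infer_instance
    exact Measure.pi_map_pi (f := fun _ (x : (ℕ → ℝ) × ℝ) => Function.update x.1 K x.2)
      fun i => (measurable_update_pair K).aemeasurable
  rw [map_update_gI] at h2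
  rw [← h2]
  rfl

def col {N : ℕ} (g : Fin N → ℕ → ℝ) (s : ℕ) : EE N := WithLp.toLp 2 fun i => g i s

lemma col_updc_self {N : ℕ} (K : ℕ) (g : Fin N → ℕ → ℝ) (z : Fin N → ℝ) :
    col (updc K g z) K = WithLp.toLp 2 z := by
  ext i; simp [col, updc]

lemma col_updc_ne {N : ℕ} (K : ℕ) (g : Fin N → ℕ → ℝ) (z : Fin N → ℝ) (s : ℕ) (h : s ≠ K) :
    col (updc K g z) s = col g s := by
  ext i; simp [col, updc, h]

lemma measurable_toLp_comp {X : Type*} [MeasurableSpace X] {N : ℕ} {f : X → Fin N → ℝ} (hf : Measurable f) :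
    Measurable (fun x => (WithLp.toLp 2 (f x) : EE N)) := (WithLp.measurable_toLp 2 (Fin N → ℝ)).comp hf

lemma measurable_col {N : ℕ} (s : ℕ) : Measurable (fun g : Fin N → ℕ → ℝ => col g s) :=
  measurable_toLp_comp (by fun_prop)

lemma measurable_EE_apply {X : Type*} [MeasurableSpace X] {N : ℕ} {f : X → EE N} (hf : Measurable f)
    (i : Fin N) : Measurable (fun x => f x i) := by
  have : Measurable (fun v : EE N => v i) := by
    have := WithLp.measurable_ofLp 2 (Fin N → ℝ)
    exact (measurable_pi_apply i).comp this
  exact this.comp hf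

lemma measurable_Th {X : Type*} [MeasurableSpace X] {N : ℕ} {φ g : X → EE N}
    {A : X → Fin N → Fin N → ℝ} (hφ : Measurable φ) (hg : Measurable g) (hA : Measurable A) :
    Measurable (fun x => Th (φ x) (g x) (A x)) := by
  refine measurable_pi_lambda _ fun i => measurable_pi_lambda _ fun j => ?_
  have hφi := fun i => measurable_EE_apply hφ i
  have hgi := fun i => measurable_EE_apply hg i
  have hAij : ∀ i j, Measurable fun x => A x i j := fun i j => by fun_prop
  simp only [Th, inner_EE, Qm]
  fun_prop

lemma measurable_Xh {X : Type*} [MeasurableSpace X] {N : ℕ} {φ c : ℕ → X → EE N}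
    (hφ : ∀ s, Measurable (φ s)) (hc : ∀ s, Measurable (c s)) (K : ℕ)
    {A : X → Fin N → Fin N → ℝ} (hA : Measurable A) :
    Measurable (fun x => Xh (fun s => φ s x) (fun s => c s x) K (A x)) := by
  induction K generalizing A with
  | zero => exact hA
  | succ K ih => exact ih (measurable_Th (hφ K) (hc K) hA)

lemma measurable_Xmat {N : ℕ} : Measurable (Xmat (N := N)) := by
  refine measurable_pi_lambda _ fun i => measurable_pi_lambda _ fun j => ?_
  simp only [Xmat]; fun_prop

lemma law_Xh {N : ℕ} (Φ : ℕ → (Fin N → ℕ → ℝ) → EE N) (hm : ∀ s, Measurable (Φ s))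
    (hdep : ∀ s g g', (∀ i, ∀ t < s, g i t = g' i t) → Φ s g = Φ s g')
    (h01 : ∀ s g, Φ s g = 0 ∨ ‖Φ s g‖ = 1) (K : ℕ) :
    (fullM N).map (fun e => Xh (fun s => Φ s e.1) (col e.1) K (Xmat e.2)) = (gI (Fin N × Fin N)).map Xmat := by
  have mX : ∀ K, Measurable (fun p : (Fin N → ℕ → ℝ) × (Fin N → Fin N → ℝ) =>
      Xh (fun s => Φ s p.1) (col p.1) K p.2) := fun K =>
    measurable_Xh (φ := fun s (p : (Fin N → ℕ → ℝ) × (Fin N → Fin N → ℝ)) => Φ s p.1)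
      (c := fun s (p : (Fin N → ℕ → ℝ) × (Fin N → Fin N → ℝ)) => col p.1 s)
      (fun s => (hm s).comp measurable_fst) (fun s => (measurable_col s).comp measurable_fst) K measurable_snd
  have mX' : ∀ K, Measurable (fun e : (Fin N → ℕ → ℝ) × (Fin N × Fin N → ℝ) =>
      Xh (fun s => Φ s e.1) (col e.1) K (Xmat e.2)) := fun K =>
    (mX K).comp (f := fun e : (Fin N → ℕ → ℝ) × (Fin N × Fin N → ℝ) => (e.1, Xmat e.2))
      (measurable_fst.prodMk (measurable_Xmat.comp measurable_snd))
  induction K with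
  | zero =>
    simp only [Xh]
    have : (fullM N).map (Xmat ∘ Prod.snd) = (gI (Fin N × Fin N)).map Xmat := by
      rw [← Measure.map_map (g := Xmat) (f := Prod.snd) measurable_Xmat measurable_snd]
      simp
    exact this
  | succ K ih =>
    rw [← ih]
    ext A hA
    rw [Measure.map_apply (mX' _) hA, Measure.map_apply (mX' _) hA]
    rw [Measure.prod_apply ((mX' _) hA), Measure.prod_apply ((mX' _) hA)]
    have mint : Measurable fun g : Fin N → ℕ → ℝ => gI (Fin N × Fin N)
        (Prod.mk g ⁻¹' ((fun e : (Fin N → ℕ → ℝ) × (Fin N × Fin N → ℝ) =>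
          Xh (fun s => Φ s e.1) (col e.1) (K+1) (Xmat e.2)) ⁻¹' A)) :=
      measurable_measure_prodMk_left ((mX' _) hA)
    conv_lhs => rw [← col_update K]
    rw [lintegral_map mint (measurable_updc K)]
    have mint2 := mint.comp (measurable_updc (N := N) K)
    simp only [Function.comp_def] at mint2
    rw [lintegral_prod _ mint2.aemeasurable]
    refine lintegral_congr fun g => ?_
    -- inner
    have hΦ : ∀ z, ∀ s ≤ K, Φ s (updc K g z) = Φ s g := by
      intro z s hs
      refine hdep s _ _ fun i t ht => ?_
      simp [updc, Function.update_of_ne (show t ≠ K by omega)]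
    have hin : ∀ (z : Fin N → ℝ) Y, Xh (fun s => Φ s (updc K g z)) (col (updc K g z)) (K + 1) (Xmat Y)
        = Xh (fun s => Φ s g) (col g) K (Th (Φ K g) (WithLp.toLp 2 z) (Xmat Y)) := by
      intro z Y
      simp only [Xh]
      rw [hΦ z K le_rfl, col_updc_self]
      exact Xh_congr _ _ _ _ K (fun s hs => hΦ z s hs.le) (fun s hs => col_updc_ne K g z s hs.ne) _
    have mXg : Measurable (fun X => Xh (fun s => Φ s g) (col g) K X) := (mX K).comp measurable_prodMk_left
    have mTh : Measurable (fun p : (Fin N → ℝ) × (Fin N × Fin N → ℝ) =>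
        Th (Φ K g) (WithLp.toLp 2 p.1) (Xmat p.2)) :=
      measurable_Th measurable_const (measurable_toLp_comp measurable_fst) (measurable_Xmat.comp measurable_snd)
    have hl := congrArg (fun μ => μ ((fun X => Xh (fun s => Φ s g) (col g) K X) ⁻¹' A)) (law_Th (Φ K g) (h01 K g))
    beta_reduce at hl
    rw [Measure.map_apply mTh (mXg hA), Measure.map_apply measurable_Xmat (mXg hA),
      Measure.prod_apply (mTh (mXg hA))] at hl
    refine Eq.trans (lintegral_congr fun z => ?_) hl
    congr 1
    ext Y
    simp only [Set.mem_preimage, hin]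

/-! ### High probability bounds for GOE matrices -/

def C4 : ℝ := ∫ ξ, ξ ^ 4 ∂gm

lemma gm_tail4 (t : ℝ) (ht : 0 < t) : gm {ξ | t < |ξ|} ≤ ENNReal.ofReal (C4 / t ^ 4) := by
  have hi : Integrable (fun ξ : ℝ => ξ ^ 4) gm :=
    integrable_of_pow_bound (by fun_prop) 1 4 fun x => by rw [abs_pow]; simp
  have h := mul_meas_ge_le_integral_of_nonneg (μ := gm) (f := fun ξ : ℝ => ξ ^ 4)
    (Eventually.of_forall fun ξ => by positivity) hi (t ^ 4)
  have h2 : gm {ξ | t < |ξ|} ≤ gm {ξ : ℝ | t ^ 4 ≤ ξ ^ 4} := by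
    refine measure_mono fun ξ hξ => ?_
    simp only [Set.mem_setOf_eq] at hξ ⊢
    calc t ^ 4 ≤ |ξ| ^ 4 := by gcongr
      _ = ξ ^ 4 := by
        rw [show (4:ℕ) = 2 * 2 by norm_num, pow_mul, sq_abs, ← pow_mul]
  refine h2.trans ?_
  rw [← ofReal_measureReal]
  apply ENNReal.ofReal_le_ofReal
  rw [le_div_iff₀ (by positivity), mul_comm]; exact h

lemma C4_nonneg : 0 ≤ C4 := integral_nonneg fun ξ => by positivity

lemma gm_small (r δ : ℝ) (hδ : 0 < δ) :
    Tendsto (fun N : ℕ => gm {ξ | δ < √2 * |r / √N| * |ξ|}) atTop (nhds 0) := by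
  set c := √2 * (|r| + 1) with hc
  have hc0 : 0 < c := by positivity
  have hb : ∀ N : ℕ, 0 < N → gm {ξ | δ < √2 * |r / √N| * |ξ|} ≤ ENNReal.ofReal (C4 * c ^ 4 / δ ^ 4 / N) := by
    intro N hN
    have hN' : (0:ℝ) < N := by exact_mod_cast hN
    have hs : 0 < √(N:ℝ) := Real.sqrt_pos.2 hN'
    have h1 := gm_tail4 (δ * √N / c) (by positivity)
    refine (measure_mono ?_).trans (h1.trans (ENNReal.ofReal_le_ofReal ?_))
    · intro ξ hξ
      simp only [Set.mem_setOf_eq] at hξ ⊢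
      rw [div_lt_iff₀ hc0]
      rw [abs_div, abs_of_pos hs] at hξ
      have h2 : √2 * (|r| / √N) * |ξ| ≤ c * |ξ| / √N := by
        rw [hc]
        have : √2 * (|r| / √N) * |ξ| = √2 * |r| * |ξ| / √N := by ring
        rw [this]
        gcongr
        linarith
      have h3 := hξ.trans_le h2
      rw [lt_div_iff₀ hs] at h3
      linarith
    · have : (δ * √N / c) ^ 4 = δ ^ 4 * (N:ℝ) ^ 2 / c ^ 4 := by
        rw [div_pow, mul_pow, show √(N:ℝ) ^ 4 = (√(N:ℝ) ^ 2) ^ 2 by ring, Real.sq_sqrt hN'.le]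
      rw [this]
      have h1N : (1:ℝ) ≤ N := by exact_mod_cast hN
      have hC := C4_nonneg
      calc C4 / (δ ^ 4 * (N:ℝ) ^ 2 / c ^ 4) = C4 * c ^ 4 / δ ^ 4 / N ^ 2 := by field_simp
        _ ≤ C4 * c ^ 4 / δ ^ 4 / N := by
          apply div_le_div_of_nonneg_left (by positivity) hN'
          nlinarith
  have hl : Tendsto (fun N : ℕ => ENNReal.ofReal (C4 * c ^ 4 / δ ^ 4 / N)) atTop (nhds 0) := by
    rw [← ENNReal.ofReal_zero]
    exact ENNReal.tendsto_ofReal (tendsto_const_nhds.div_atTop tendsto_natCast_atTop_atTop)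
  refine tendsto_of_tendsto_of_tendsto_of_le_of_le' tendsto_const_nhds hl
    (Filter.Eventually.of_forall fun _ => zero_le) ?_
  filter_upwards [eventually_gt_atTop 0] with n hn using hb n hn

lemma rowM_col {N : ℕ} (K : ℕ) : (rowM N).map (fun g i => g i K) = gI (Fin N) := by
  have e := Measure.infinitePi_map_eval (fun _ : ℕ => gm) K
  have : ∀ i : Fin N, SigmaFinite (Measure.map (fun x : ℕ → ℝ => x K) (gI ℕ)) := by
    intro i; rw [e]; infer_instance
  have h := Measure.pi_map_pi (ι := Fin N) (μ := fun _ => gI ℕ) (f := fun _ (x : ℕ → ℝ) => x K)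
    fun i => (measurable_pi_apply K).aemeasurable
  rw [e] at h
  rw [gI_fin_eq]; exact h

lemma int_coord_sq (k : ℕ) : ∫ x : ℕ → ℝ, x k * x k ∂(gI ℕ) = 1 := by
  have := integral_coord (ι := ℕ) k (f := fun z => z * z) (by fun_prop)
  rw [this]
  have h := integral_sq_gm
  simp only [pow_two] at h
  exact h

lemma z_norm : Tendsto (fun N : ℕ => gI (Fin N) {z | (N:ℝ) * (3/2) ^ 2 < ∑ k, z k ^ 2}) atTop (nhds 0) := by
  have h := (lln ((Tame.coord 0).mul (Tame.coord 0))).eventually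
    (gt_mem_nhds (show ∫ x : ℕ → ℝ, x 0 * x 0 ∂(gI ℕ) < (3/2) ^ 2 by rw [int_coord_sq]; norm_num))
  rw [eventually_whp] at h
  refine tendsto_of_tendsto_of_tendsto_of_le_of_le' tendsto_const_nhds h
    (Filter.Eventually.of_forall fun _ => zero_le) ?_
  filter_upwards [eventually_gt_atTop 0] with N hN
  have hN' : (0:ℝ) < N := by exact_mod_cast hN
  have hm : MeasurableSet {z : Fin N → ℝ | (N:ℝ) * (3/2) ^ 2 < ∑ k, z k ^ 2} :=
    measurableSet_lt measurable_const (by fun_prop)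
  rw [← rowM_col 0, Measure.map_apply (by fun_prop) hm]
  refine measure_mono fun g hg => ?_
  simp only [Set.mem_preimage, Set.mem_setOf_eq, av, not_lt] at hg ⊢
  rw [le_div_iff₀ hN']
  simp only [← pow_two]
  linarith

lemma qf_smul {N : ℕ} (A : Fin N → Fin N → ℝ) (c : ℝ) (u : EE N) : qf A (WithLp.ofLp (c • u)) = c ^ 2 * qf A (WithLp.ofLp u) := by
  simp only [qf, Finset.mul_sum]
  refine Finset.sum_congr rfl fun i _ => Finset.sum_congr rfl fun j _ => ?_
  simp; ring

/-- normalized dense sequence -/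
def dsq (N : ℕ) (n : ℕ) : EE N :=
  ‖TopologicalSpace.denseSeq (EE N) n‖⁻¹ • TopologicalSpace.denseSeq (EE N) n

lemma dsq_norm (N n : ℕ) : ∑ k, dsq N n k ^ 2 ≤ 1 := by
  rw [← norm_sq_EE, dsq, norm_smul, norm_inv, norm_norm]
  by_cases h : ‖TopologicalSpace.denseSeq (EE N) n‖ = 0
  · simp [h]
  · rw [inv_mul_cancel₀ h]; norm_num

lemma qf_bd_of_dense {N : ℕ} (A : Fin N → Fin N → ℝ) (C : ℝ) (h : ∀ n, qf A (dsq N n) ≤ C) (u : EE N) :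
    qf A u ≤ C * ‖u‖ ^ 2 := by
  refine DenseRange.induction_on (TopologicalSpace.denseRange_denseSeq (EE N))
    (p := fun u : EE N => qf A u ≤ C * ‖u‖ ^ 2) u ?_ fun n => ?_
  · refine isClosed_le ?_ (by fun_prop)
    simp only [qf]; fun_prop
  · set d := TopologicalSpace.denseSeq (EE N) n with hd
    have h1 := h n
    rw [dsq, ← hd, qf_smul] at h1
    by_cases h0 : d = 0
    · rw [h0]; simp [qf]
    · have hp : 0 < ‖d‖ ^ 2 := by have := norm_pos_iff.2 h0; positivity
      rw [inv_pow, inv_mul_le_iff₀ hp] at h1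
      linarith

lemma goe_qf (sg : ℝ) (hsg : |sg| = 1) : Tendsto (fun N : ℕ => gI (Fin N × Fin N)
    {Y | ¬ ∀ n, sg / √N * qf (Xmat Y) (dsq N n) ≤ 5}) atTop (nhds 0) := by
  have h := z_norm.add (gm_small sg 1 one_pos)
  rw [add_zero] at h
  refine tendsto_of_tendsto_of_tendsto_of_le_of_le' tendsto_const_nhds h
    (Filter.Eventually.of_forall fun _ => zero_le) ?_
  filter_upwards [eventually_gt_atTop 0] with N hN
  have hN' : (0:ℝ) < N := by exact_mod_cast hN
  have hs : 0 < √(N:ℝ) := Real.sqrt_pos.2 hN'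
  have hsl := slepian_goe (fun n => (dsq N n : Fin N → ℝ)) (fun _ => True) (dsq_norm N) (fun _ => 3) (sg / √N) 1 one_pos
  refine (measure_mono ?_).trans (hsl.trans (add_le_add_left (measure_mono ?_) _))
  · intro Y hY
    simp only [Set.mem_setOf_eq, not_forall, not_le] at hY ⊢
    obtain ⟨n, hn⟩ := hY
    exact ⟨n, trivial, by linarith⟩
  · intro z hz
    simp only [Set.mem_setOf_eq, true_and] at hz ⊢
    obtain ⟨n, hn⟩ := hz
    set x := dsq N n
    have hx := dsq_norm N n
    have cs : ∑ k, z k * x k ≤ √(∑ k, z k ^ 2) * √(∑ k, x k ^ 2) := Real.sum_mul_le_sqrt_mul_sqrt _ _ _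
    have cs' : -∑ k, z k * x k ≤ √(∑ k, z k ^ 2) * √(∑ k, x k ^ 2) := by
      have := Real.sum_mul_le_sqrt_mul_sqrt Finset.univ (fun k => - z k) x
      simpa using this
    have hx1 : √(∑ k, x k ^ 2) ≤ 1 := (Real.sqrt_le_sqrt hx).trans (by simp)
    have hx0 : 0 ≤ √(∑ k, x k ^ 2) := Real.sqrt_nonneg _
    have hz0 : 0 ≤ √(∑ k, z k ^ 2) := Real.sqrt_nonneg _
    have habs : |∑ k, z k * x k| ≤ √(∑ k, z k ^ 2) := by
      rw [abs_le]
      constructor <;> nlinarith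
    have h3 : 2 * (sg / √N) * √(∑ k, x k ^ 2) * ∑ k, z k * x k ≤ 2 / √N * √(∑ k, z k ^ 2) := by
      refine (le_abs_self _).trans ?_
      rw [abs_mul, abs_mul, abs_mul, abs_div, hsg, abs_of_pos hs, abs_of_nonneg hx0]
      have : |(2:ℝ)| * (1 / √N) * √(∑ k, x k ^ 2) ≤ 2 / √N := by
        rw [abs_two]
        calc 2 * (1 / √N) * √(∑ k, x k ^ 2) ≤ 2 * (1 / √N) * 1 := by gcongr
          _ = _ := by ring
      gcongr
    have h4 := hn.trans_le h3
    have h5 : 3/2 * √N < √(∑ k, z k ^ 2) := by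
      rw [div_mul_eq_mul_div, lt_div_iff₀ hs] at h4
      linarith
    have h6 := mul_self_lt_mul_self (by positivity) h5
    rw [Real.mul_self_sqrt (Finset.sum_nonneg fun _ _ => sq_nonneg _)] at h6
    have h7 := Real.mul_self_sqrt hN'.le
    nlinarith

lemma goe_diag (δ : ℝ) (hδ : 0 < δ) : Tendsto (fun N : ℕ => gI (Fin N × Fin N)
    {Y | ¬ ∀ i, |Xmat Y i i| ≤ δ * √N}) atTop (nhds 0) := by
  have hb : ∀ N : ℕ, 0 < N → gI (Fin N × Fin N) {Y | ¬ ∀ i, |Xmat Y i i| ≤ δ * √N}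
      ≤ ENNReal.ofReal (4 * C4 / δ ^ 4 / N) := by
    intro N hN
    have hN' : (0:ℝ) < N := by exact_mod_cast hN
    have hs : 0 < √(N:ℝ) := Real.sqrt_pos.2 hN'
    have h2 : √2 * √2 = 2 := Real.mul_self_sqrt (by norm_num)
    have hsub : {Y : Fin N × Fin N → ℝ | ¬ ∀ i, |Xmat Y i i| ≤ δ * √N}
        ⊆ ⋃ i : Fin N, (fun Y => Y (i, i)) ⁻¹' {ξ : ℝ | δ * √N / √2 < |ξ|} := by
      intro Y hY
      simp only [Set.mem_setOf_eq, not_forall, not_le] at hY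
      obtain ⟨i, hi⟩ := hY
      simp only [Set.mem_iUnion, Set.mem_preimage, Set.mem_setOf_eq]
      refine ⟨i, ?_⟩
      have : Xmat Y i i = √2 * Y (i, i) := by
        simp only [Xmat]
        rw [div_eq_iff (by positivity)]
        linear_combination (-Y (i, i)) * h2
      rw [this, abs_mul, abs_of_pos (by positivity)] at hi
      rw [div_lt_iff₀ (by positivity)]; linarith
    refine (measure_mono hsub).trans ((measure_iUnion_le _).trans ?_)
    have h1 : ∀ i : Fin N, gI (Fin N × Fin N) ((fun Y => Y (i, i)) ⁻¹' {ξ : ℝ | δ * √N / √2 < |ξ|})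
        ≤ ENNReal.ofReal (C4 / (δ * √N / √2) ^ 4) := by
      intro i
      have hm : MeasurableSet {ξ : ℝ | δ * √N / √2 < |ξ|} := measurableSet_lt measurable_const (by fun_prop)
      have hma := Measure.map_apply (μ := gI (Fin N × Fin N)) (f := fun Y : Fin N × Fin N → ℝ => Y (i, i))
        (measurable_pi_apply (i, i)) hm
      rw [← hma, gI, Measure.infinitePi_map_eval]
      exact gm_tail4 _ (by positivity)
    rw [tsum_fintype]
    refine (Finset.sum_le_sum fun i _ => h1 i).trans ?_
    rw [Finset.sum_const, Finset.card_univ, Fintype.card_fin, nsmul_eq_mul, ← ENNReal.ofReal_natCast,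
      ← ENNReal.ofReal_mul hN'.le]
    apply ENNReal.ofReal_le_ofReal
    have e4 : (δ * √N / √2) ^ 4 = δ ^ 4 * (N:ℝ) ^ 2 / 4 := by
      rw [div_pow, mul_pow, show √(N:ℝ) ^ 4 = (√(N:ℝ) ^ 2) ^ 2 by ring, Real.sq_sqrt hN'.le,
        show √2 ^ 4 = (√2 ^ 2) ^ 2 by ring, Real.sq_sqrt (by norm_num)]; norm_num
    rw [e4]
    apply le_of_eq
    field_simp
  have hl : Tendsto (fun N : ℕ => ENNReal.ofReal (4 * C4 / δ ^ 4 / N)) atTop (nhds 0) := by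
    rw [← ENNReal.ofReal_zero]
    exact ENNReal.tendsto_ofReal (tendsto_const_nhds.div_atTop tendsto_natCast_atTop_atTop)
  refine tendsto_of_tendsto_of_tendsto_of_le_of_le' tendsto_const_nhds hl
    (Filter.Eventually.of_forall fun _ => zero_le) ?_
  filter_upwards [eventually_gt_atTop 0] with n hn using hb n hn

/-! ### The concrete conditioned matrix -/

abbrev FS := Σ N : ℕ, ((Fin N → ℕ → ℝ) × (Fin N × Fin N → ℝ))

namespace Par
variable (p : Par)

/-- row function as a vector -/
def vec {N : ℕ} (f : (ℕ → ℝ) → ℝ) (g : Fin N → ℕ → ℝ) : EE N := WithLp.toLp 2 fun i => f (g i)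

def Ph (s : ℕ) {N : ℕ} (g : Fin N → ℕ → ℝ) : EE N := gs (fun j => vec (p.M j) g) s

def XX (K : ℕ) (e : FS) : Fin e.1 → Fin e.1 → ℝ :=
  Xh (fun s => p.Ph s e.2.1) (col e.2.1) K (Xmat e.2.2)

lemma measurable_vec {N : ℕ} {f : (ℕ → ℝ) → ℝ} (hf : Measurable f) :
    Measurable (fun g : Fin N → ℕ → ℝ => vec f g) :=
  measurable_toLp_comp (by fun_prop)

lemma measurable_Ph (s : ℕ) {N : ℕ} : Measurable (fun g : Fin N → ℕ → ℝ => p.Ph s g) :=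
  measurable_gs (fun g : Fin N → ℕ → ℝ => fun j => vec (p.M j) g)
    (fun j => measurable_vec (p.measurable_M j)) s

lemma Ph_congr (s : ℕ) {N : ℕ} (g g' : Fin N → ℕ → ℝ) (h : ∀ i, ∀ t < s, g i t = g' i t) :
    p.Ph s g = p.Ph s g' := by
  refine gs_congr _ _ _ fun j hj => ?_
  ext i
  exact p.M_congr j fun t ht => h i t (by omega)

lemma Ph_ON {N : ℕ} (g : Fin N → ℕ → ℝ) : ON (fun s => p.Ph s g) where
  orth := fun _ _ h => gs_orth _ h
  z1 := fun _ => gs_zero_or _ _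

lemma XX_transfer (K : ℕ) (Q : ∀ N, Set (Fin N → Fin N → ℝ)) (hQ : ∀ N, MeasurableSet (Q N))
    (h : Tendsto (fun N => gI (Fin N × Fin N) {Y | ¬ Xmat Y ∈ Q N}) atTop (nhds 0)) :
    ∀ᶠ e in fullF, p.XX K e ∈ Q e.1 := by
  rw [eventually_whp]
  refine h.congr fun N => ?_
  have hl := law_Xh (N := N) (fun s g => p.Ph s g) (fun s => p.measurable_Ph s)
    (fun s g g' => p.Ph_congr s g g') (fun s g => (p.Ph_ON g).z1 s) K
  have mX : Measurable (fun e : (Fin N → ℕ → ℝ) × (Fin N × Fin N → ℝ) =>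
      Xh (fun s => p.Ph s e.1) (col e.1) K (Xmat e.2)) :=
    measurable_Xh (φ := fun s (e : (Fin N → ℕ → ℝ) × (Fin N × Fin N → ℝ)) => p.Ph s e.1)
      (c := fun s (e : (Fin N → ℕ → ℝ) × (Fin N × Fin N → ℝ)) => col e.1 s)
      (fun s => (p.measurable_Ph s).comp measurable_fst) (fun s => (measurable_col s).comp measurable_fst)
      K (measurable_Xmat.comp measurable_snd)
  have := congrArg (fun μ => μ (Q N)ᶜ) hl
  beta_reduce at this
  rw [Measure.map_apply mX (hQ N).compl, Measure.map_apply measurable_Xmat (hQ N).compl] at this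
  exact this.symm

lemma XX_symm (K : ℕ) (e : FS) : ∀ i j, p.XX K e i j = p.XX K e j i :=
  Xh_symm _ _ _ _ (Xmat_symm _)

lemma measurable_qf {N : ℕ} (u : Fin N → ℝ) : Measurable (fun A : Fin N → Fin N → ℝ => qf A u) := by
  simp only [qf]; fun_prop

lemma XX_qf (K : ℕ) : ∀ᶠ e in fullF, ∀ u : EE e.1, |qf (p.XX K e) u| ≤ 5 * √e.1 * ‖u‖ ^ 2 := by
  have h : ∀ sg : ℝ, |sg| = 1 → ∀ᶠ e in fullF, ∀ n, sg / √e.1 * qf (p.XX K e) (dsq e.1 n) ≤ 5 := by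
    intro sg hsg
    refine p.XX_transfer K (fun N => {A | ∀ n, sg / √N * qf A (dsq N n) ≤ 5}) (fun N => ?_) (goe_qf sg hsg)
    have : {A : Fin N → Fin N → ℝ | ∀ n, sg / √N * qf A (dsq N n) ≤ 5}
      = ⋂ n, {A | sg / √N * qf A (dsq N n) ≤ 5} := by ext; simp
    rw [this]
    exact MeasurableSet.iInter fun n => measurableSet_le ((measurable_qf _).const_mul _) measurable_const
  filter_upwards [h 1 (by simp), h (-1) (by simp), whp_fst.eventually (eventually_gt_atTop 0)] with e h1 h2 hN u
  have hN' : (0:ℝ) < e.1 := by exact_mod_cast hN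
  have hs : 0 < √(e.1:ℝ) := Real.sqrt_pos.2 hN'
  have k1 := qf_bd_of_dense (p.XX K e) (5 * √e.1) (fun n => by
    have := h1 n
    rw [one_div, inv_mul_le_iff₀ hs] at this; linarith) u
  have k2 := qf_bd_of_dense (fun i j => - p.XX K e i j) (5 * √e.1) (fun n => by
    have := h2 n
    rw [neg_div, one_div, neg_mul, ← mul_neg, inv_mul_le_iff₀ hs] at this
    simp only [qf, neg_mul, Finset.sum_neg_distrib] at this ⊢
    linarith) u
  rw [abs_le]
  refine ⟨?_, k1⟩
  simp only [qf, neg_mul, Finset.sum_neg_distrib] at k2 ⊢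
  linarith

lemma XX_diag (K : ℕ) (δ : ℝ) (hδ : 0 < δ) : ∀ᶠ e in fullF, ∀ i, |p.XX K e i i| ≤ δ * √e.1 := by
  refine p.XX_transfer K (fun N => {A | ∀ i, |A i i| ≤ δ * √N}) (fun N => ?_) (goe_diag δ hδ)
  have : {A : Fin N → Fin N → ℝ | ∀ i, |A i i| ≤ δ * √N} = ⋂ i, {A | |A i i| ≤ δ * √N} := by ext; simp
  rw [this]
  exact MeasurableSet.iInter fun n => measurableSet_le (by fun_prop) measurable_const

end Par

lemma mv_add {N : ℕ} (A : Fin N → Fin N → ℝ) (u v : EE N) : mv A (u + v) = mv A u + mv A v := by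
  ext i; simp [mv, mul_add, Finset.sum_add_distrib]

lemma mv_smul {N : ℕ} (A : Fin N → Fin N → ℝ) (c : ℝ) (v : EE N) : mv A (c • v) = c • mv A v := by
  ext i; simp [mv, Finset.mul_sum]
  exact Finset.sum_congr rfl fun j _ => by ring

lemma mv_sub {N : ℕ} (A : Fin N → Fin N → ℝ) (u v : EE N) : mv A (u - v) = mv A u - mv A v := by
  ext i; simp [mv, mul_sub, Finset.sum_sub_distrib]

lemma op_of_qf {N : ℕ} (A : Fin N → Fin N → ℝ) (hA : ∀ i j, A i j = A j i) (C : ℝ)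
    (h : ∀ u : EE N, |qf A u| ≤ C * ‖u‖ ^ 2) (u : EE N) : ‖mv A u‖ ≤ C * ‖u‖ := by
  by_cases hu : u = 0
  · subst hu
    have : mv A (0 : EE N) = 0 := by ext i; simp [mv]
    simp [this]
  have hu' := norm_pos_iff.2 hu
  by_cases hw : mv A u = 0
  · rw [hw, norm_zero]
    have := (abs_nonneg _).trans (h u)
    have : 0 ≤ C := by
      by_contra hC
      have : C * ‖u‖ ^ 2 < 0 := mul_neg_of_neg_of_pos (by linarith) (by positivity)
      linarith
    positivity
  have hw' := norm_pos_iff.2 hw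
  set v := (‖u‖ / ‖mv A u‖) • mv A u with hv
  have nv : ‖v‖ = ‖u‖ := by
    rw [hv, norm_smul, Real.norm_of_nonneg (by positivity)]; field_simp
  have iv : inner ℝ v (mv A u) = ‖u‖ * ‖mv A u‖ := by
    rw [hv, inner_smul_left, real_inner_self_eq_norm_sq]; simp; field_simp
  have h1 := h (u + v)
  have h2 := h (u - v)
  rw [qf_eq_inner, mv_add, inner_add_left, inner_add_right, inner_add_right] at h1
  rw [qf_eq_inner, mv_sub, inner_sub_left, inner_sub_right, inner_sub_right] at h2
  have sy : inner ℝ u (mv A v) = inner ℝ v (mv A u) := by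
    rw [mv_symm A hA, real_inner_comm]
  rw [sy] at h1 h2
  rw [iv] at h1 h2
  rw [norm_add_sq_real, nv] at h1
  rw [norm_sub_sq_real, nv] at h2
  have h1' := (abs_le.1 h1).2
  have h2' := (abs_le.1 h2).1
  have : ‖u‖ * ‖mv A u‖ ≤ ‖u‖ * (C * ‖u‖) := by nlinarith
  exact le_of_mul_le_mul_left this hu'

/-! ### The TAP algorithm in terms of the symmetric matrix -/

namespace Par
variable (p : Par)

structure Alg {N : ℕ} (G : Fin N → Fin N → ℝ) (m φ y : ℕ → EE N) : Prop where
  m0 : m 0 = WithLp.toLp 2 fun _ => √p.q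
  mS : ∀ j, m (j + 1) = WithLp.toLp 2 fun i => Real.tanh (p.h + p.β * ∑ t ∈ Finset.range (j + 1), p.cf j t * (√N * y t i))
  ph : ∀ s, φ s = gs m s
  yy : ∀ s, y s = mv G (φ s) - ∑ t ∈ Finset.range s, (inner ℝ (φ t) (φ s) • y t + inner ℝ (y t) (φ s) • φ t
    - (inner ℝ (y t) (φ t) * inner ℝ (φ t) (φ s)) • φ t)

lemma Alg.unique {N : ℕ} {G : Fin N → Fin N → ℝ} {m φ y m' φ' y' : ℕ → EE N} (h : p.Alg G m φ y)
    (h' : p.Alg G m' φ' y') (s : ℕ) : m s = m' s ∧ φ s = φ' s ∧ y s = y' s := by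
  induction s using Nat.strong_induction_on with
  | _ s ih =>
    have hm : m s = m' s := by
      cases s with
      | zero => rw [h.m0, h'.m0]
      | succ j =>
        rw [h.mS, h'.mS]
        congr 1; funext i
        congr 3
        refine Finset.sum_congr rfl fun t ht => ?_
        rw [(ih t (by simpa using ht)).2.2]
    have hp : φ s = φ' s := by
      rw [h.ph, h'.ph]
      refine gs_congr _ _ _ fun t ht => ?_
      rcases ht.lt_or_eq with h1 | h1
      · exact (ih t h1).1
      · rw [h1, hm]
    refine ⟨hm, hp, ?_⟩
    rw [h.yy, h'.yy, hp]
    congr 1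
    refine Finset.sum_congr rfl fun t ht => ?_
    have := ih t (by simpa using ht)
    rw [this.2.1, this.2.2]

variable {N : ℕ} (W : Fin N → Fin N → ℝ)

abbrev tS (s : ℕ) : TapState N := tapState N p.β p.h p.q W s
def tph (s : ℕ) : EE N := WithLp.toLp 2 ((p.tS W s).phi (s + 1))
def tze (s : ℕ) : EE N := WithLp.toLp 2 ((p.tS W s).zeta (s + 1))
def tmm (s : ℕ) : EE N := WithLp.toLp 2 (p.tS W s).m
def tG (s : ℕ) : Fin N → Fin N → ℝ := symmG N (p.tS W s).W
def ty (s : ℕ) : EE N := mv (p.tG W s) (p.tph W s)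

lemma tS_succ (s : ℕ) : p.tS W (s + 1) = tapStep N p.β p.h p.q (s + 1) (p.tS W s) := rfl

lemma phi_stable (s k : ℕ) (h : s ≤ k) : (p.tS W k).phi (s + 1) = (p.tph W s : Fin N → ℝ) := by
  induction k with
  | zero => obtain rfl : s = 0 := by omega
            rfl
  | succ k ih =>
    rcases h.lt_or_eq with h | h
    · rw [← ih (by omega), tS_succ]
      exact Function.update_of_ne (by omega) _ _
    · rw [h]; rfl

lemma zeta_stable (s k : ℕ) (h : s ≤ k) : (p.tS W k).zeta (s + 1) = (p.tze W s : Fin N → ℝ) := by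
  induction k with
  | zero => obtain rfl : s = 0 := by omega
            rfl
  | succ k ih =>
    rcases h.lt_or_eq with h | h
    · rw [← ih (by omega), tS_succ]
      exact Function.update_of_ne (by omega) _ _
    · rw [h]; rfl

lemma dotp_eq (u v : Fin N → ℝ) : dotp N u v = inner ℝ (WithLp.toLp 2 u : EE N) (WithLp.toLp 2 v) := by
  rw [inner_EE]; rfl

lemma mulVec_eq (A : Fin N → Fin N → ℝ) (u : Fin N → ℝ) : mulVec N A u = (mv A (WithLp.toLp 2 u) : Fin N → ℝ) := rfl

lemma tze_eq (s : ℕ) : p.tze W s = √N • p.ty W s := by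
  have key : ∀ (A : Fin N → Fin N → ℝ) (u : Fin N → ℝ),
      (WithLp.toLp 2 (mulVec N A (fun i => √N * u i)) : EE N) = √N • mv A (WithLp.toLp 2 u) := by
    intro A u
    rw [← mv_smul]; rfl
  cases s with
  | zero => exact key _ _
  | succ s =>
    rw [ty, ← key]
    simp only [tze, tph, tG, tS_succ, tapStep, Function.update_self]

lemma gammaSeq_eq (s : ℕ) : gammaSeq p.β p.h p.q (s + 1) = p.gam s := rfl

lemma GammaSq_eq (s : ℕ) : GammaSq p.β p.h p.q s = p.Sg s := by
  cases s with
  | zero => rfl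
  | succ s => simp [GammaSq, Sg]

lemma sum_Icc (f : ℕ → ℝ) (k : ℕ) : ∑ s ∈ Finset.Icc 1 k, f s = ∑ t ∈ Finset.range k, f (t + 1) := by
  rw [Finset.range_eq_Ico, Finset.sum_Ico_add' f 0 k 1]
  rfl

lemma tmm_succ (j : ℕ) : p.tmm W (j + 1) = WithLp.toLp 2 fun i =>
    Real.tanh (p.h + p.β * ∑ t ∈ Finset.range (j + 1), p.cf j t * (√N * p.ty W t i)) := by
  have e : ∀ t, t ≤ j → ∀ i, (p.tS W j).zeta (t + 1) i = √N * p.ty W t i := by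
    intro t ht i
    rw [p.zeta_stable W t j ht, tze_eq]; rfl
  simp only [tmm, tS_succ, tapStep, sum_Icc, Nat.add_sub_cancel, GammaSq_eq, gammaSeq_eq]
  congr 1; funext i; congr 3
  rw [Finset.sum_range_succ]
  congr 1
  · refine Finset.sum_congr rfl fun t ht => ?_
    have ht' : t < j := by simpa using ht
    rw [e t ht'.le, cf, if_pos ht']
  · rw [e j le_rfl, cf, if_neg (lt_irrefl j), if_pos rfl, eta]

lemma tph_eq (s : ℕ) : p.tph W s = gs (p.tmm W) s := by
  induction s using Nat.strong_induction_on with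
  | _ s ih =>
  cases s with
  | zero =>
    rw [gs_eq]
    have h0 : gsv (p.tmm W) 0 = WithLp.toLp 2 fun _ => √p.q := by simp [gsv, tmm, tS, tapState, tapInit]
    have hq : 0 < √p.q := Real.sqrt_pos.2 p.q0
    have hn : ‖(WithLp.toLp 2 (fun _ => √p.q) : EE N)‖ = √N * √p.q := by
      rw [← Real.sqrt_sq (norm_nonneg _), norm_sq_EE]
      simp only [Finset.sum_const, Finset.card_univ, Fintype.card_fin, nsmul_eq_mul]
      rw [Real.sqrt_mul (by positivity), Real.sqrt_sq hq.le]
    rw [h0, hn]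
    ext i
    simp [tph, tapState, tapInit]
    field_simp
  | succ j =>
    have key : ∀ v : Fin N → ℝ, (WithLp.toLp 2 (fun i => v i / √(dotp N v v)) : EE N)
        = ‖(WithLp.toLp 2 v : EE N)‖⁻¹ • WithLp.toLp 2 v := by
      intro v
      rw [dotp_eq, real_inner_self_eq_norm_sq, Real.sqrt_sq (norm_nonneg _)]
      ext i; simp; ring
    have hv : gsv (p.tmm W) (j + 1) = WithLp.toLp 2 fun i => (p.tS W (j+1)).m i
        - ∑ s ∈ Finset.Icc 1 (j + 1), dotp N (p.tS W (j+1)).m ((p.tS W j).phi s) * (p.tS W j).phi s i := by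
      ext i
      simp only [gsv, sum_Icc, PiLp.sub_apply, WithLp.ofLp_sum, Finset.sum_apply, WithLp.ofLp_smul, Pi.smul_apply, smul_eq_mul]
      congr 1
      refine Finset.sum_congr rfl fun t ht => ?_
      have ht' : t < j + 1 := by simpa using ht
      rw [← ih t ht', p.phi_stable W t j (by omega), dotp_eq]; rfl
    rw [gs_eq, hv, ← key]
    simp only [tph, tS_succ, tapStep, Function.update_self]

lemma symmG_symm (W : Fin N → Fin N → ℝ) (i j : Fin N) : symmG N W i j = symmG N W j i := by
  simp only [symmG, add_comm]

lemma tG_succ (j : ℕ) (u : EE N) : mv (p.tG W (j + 1)) u = mv (p.tG W j) u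
    - (inner ℝ (p.tph W j) u • p.ty W j + inner ℝ (p.ty W j) u • p.tph W j
    - (inner ℝ (p.ty W j) (p.tph W j) * inner ℝ (p.tph W j) u) • p.tph W j) := by
  set w := (p.tS W j).W with hw
  set φ := p.tph W j with hφ
  set y := p.ty W j with hy
  have h2 : √2 * √2 = 2 := Real.mul_self_sqrt (by norm_num)
  have h20 : √2 ≠ 0 := by positivity
  have hyi : ∀ i, y i = ((∑ a, w i a * φ a) + ∑ a, w a i * φ a) / √2 := by
    intro i
    simp only [hy, ty, mv, tG, symmG]
    rw [← Finset.sum_add_distrib, Finset.sum_div]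
    refine Finset.sum_congr rfl fun a _ => ?_
    simp only [← hφ]; ring
  have hd : inner ℝ y φ = √2 * ∑ i, (∑ a, w i a * φ a) * φ i := by
    rw [inner_EE]
    simp only [hyi]
    have : ∑ i, (∑ a, w a i * φ a) * φ i = ∑ i, (∑ a, w i a * φ a) * φ i := by
      simp only [Finset.sum_mul]
      rw [Finset.sum_comm]
      refine Finset.sum_congr rfl fun i _ => Finset.sum_congr rfl fun a _ => by ring
    simp only [div_mul_eq_mul_div, add_mul, add_div, Finset.sum_add_distrib]
    rw [← Finset.sum_div, ← Finset.sum_div, this]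
    field_simp
    rw [sq, h2]; ring
  have hG : ∀ i a, p.tG W (j + 1) i a = p.tG W j i a - (y i * φ a + φ i * y a - inner ℝ y φ * (φ i * φ a)) := by
    intro i a
    have e0 : ∀ i, (p.tS W j).phi (j + 1) i = φ i := fun i => rfl
    have : p.tG W (j + 1) i a = ((w i a - ((∑ b, w i b * φ b) * φ a + φ i * (∑ b, w b a * φ b)
          - (∑ i, (∑ a, w i a * φ a) * φ i) * φ i * φ a)) + (w a i - ((∑ b, w a b * φ b) * φ i + φ a * (∑ b, w b i * φ b)
          - (∑ i, (∑ a, w i a * φ a) * φ i) * φ a * φ i))) / √2 := rfl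
    rw [this, hd, hyi, hyi]
    simp only [tG, symmG, ← hw]
    field_simp
    rw [sq, h2]; ring
  ext i
  simp only [mv, hG, PiLp.sub_apply, PiLp.add_apply, PiLp.smul_apply, smul_eq_mul, sub_mul, add_mul,
    Finset.sum_sub_distrib, Finset.sum_add_distrib]
  rw [inner_EE φ u, inner_EE y u]
  simp only [Finset.mul_sum, Finset.sum_mul]
  congr 2
  · congr 1
    · exact Finset.sum_congr rfl fun a _ => by ring
    · exact Finset.sum_congr rfl fun a _ => by ring
  · exact Finset.sum_congr rfl fun a _ => by ring

lemma tG_eq (k : ℕ) (u : EE N) : mv (p.tG W k) u = mv (symmG N W) u - ∑ t ∈ Finset.range k,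
    (inner ℝ (p.tph W t) u • p.ty W t + inner ℝ (p.ty W t) u • p.tph W t
    - (inner ℝ (p.ty W t) (p.tph W t) * inner ℝ (p.tph W t) u) • p.tph W t) := by
  induction k with
  | zero => simp; rfl
  | succ k ih => rw [tG_succ, ih, Finset.sum_range_succ]; abel

lemma alg : p.Alg (symmG N W) (p.tmm W) (p.tph W) (p.ty W) where
  m0 := rfl
  mS := p.tmm_succ W
  ph := p.tph_eq W
  yy := fun s => by rw [← tG_eq]; rfl

lemma mTAP_eq (k : ℕ) : mTAP N p.β p.h p.q W k = (p.tmm W (k - 1) : Fin N → ℝ) := rfl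

lemma mTAP_congr (W' : Fin N → Fin N → ℝ) (h : symmG N W = symmG N W') (k : ℕ) :
    mTAP N p.β p.h p.q W k = mTAP N p.β p.h p.q W' k := by
  have h1 := p.alg W
  rw [h] at h1
  rw [mTAP_eq, mTAP_eq, ((h1.unique p (p.alg W')) (k - 1)).1]

end Par

lemma Bd.of_app' {Ξ : Type*} {l : Filter Ξ} {V : Ξ → Type*} [∀ e, NormedAddCommGroup (V e)]
    [∀ e, InnerProductSpace ℝ (V e)] {a b : ∀ e, V e} (hb : Bd l b) (h : App l a b) : Bd l a := Bd.of_app h hb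

namespace Par
variable (p : Par)

/-- normalized row function vector -/
def nv (f : (ℕ → ℝ) → ℝ) (e : FS) : EE e.1 := (√e.1)⁻¹ • vec f e.2.1

lemma inner_nv (f g : (ℕ → ℝ) → ℝ) (e : FS) : inner ℝ (nv f e) (nv g e) = av (fun x => f x * g x) (toRow e) := by
  rw [nv, nv, inner_smul_left, inner_smul_right, inner_EE, av]
  simp only [vec, toRow, conj_trivial]
  rw [← mul_assoc, ← mul_inv, Real.mul_self_sqrt (by positivity), div_eq_inv_mul]
  rfl

lemma inner_nv_tendsto {f g : (ℕ → ℝ) → ℝ} (hf : Tame f) (hg : Tame g) :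
    Tendsto (fun e => inner ℝ (nv f e) (nv g e)) fullF (nhds (∫ x, f x * g x ∂(gI ℕ))) := by
  simp only [inner_nv]
  exact (lln (hf.mul hg)).comp toRow_tendsto

lemma bd_nv {f : (ℕ → ℝ) → ℝ} (hf : Tame f) : Bd fullF (nv f) := Bd.of_tendsto (inner_nv_tendsto hf hf)

lemma E_xF (s t : ℕ) (h : t ≤ s) : ∫ x, x s * p.F t x ∂(gI ℕ) = 0 := by
  obtain ⟨C, hC⟩ := p.F_bdd t
  rw [stein_multi s (f := p.F t) (f' := fun _ => 0) (p.measurable_F t) measurable_const C hC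
    (fun x => by simpa using (abs_nonneg _).trans (hC x))]
  · simp
  · intro x z
    have : (fun z => p.F t (Function.update x s z)) = fun _ => p.F t x := by
      funext z
      refine p.F_congr t fun r hr => ?_
      rw [Function.update_of_ne (by omega)]
    rw [this]; exact hasDerivAt_const _ _

lemma nv_M (j : ℕ) (e : FS) : nv (p.M j) e = (∑ t ∈ Finset.range j, p.gam t • nv (p.F t) e) + p.eta j • nv (p.F j) e := by
  have hη := (p.etapos j).ne'
  ext i
  simp only [nv, vec, PiLp.add_apply, WithLp.ofLp_sum, Finset.sum_apply, PiLp.smul_apply, smul_eq_mul]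
  rw [p.F_eq j]
  field_simp
  rw [← Finset.sum_div]; ring

lemma FF_tendsto (s t : ℕ) : Tendsto (fun e => inner ℝ (nv (p.F s) e) (nv (p.F t) e)) fullF (nhds (if s = t then 1 else 0)) := by
  rw [← p.E_FF]; exact inner_nv_tendsto (p.tame_F s) (p.tame_F t)

lemma N_pos : ∀ᶠ e : FS in fullF, 0 < e.1 := whp_fst.eventually (eventually_gt_atTop 0)

lemma Ph_app (j : ℕ) : App fullF (fun e => p.Ph j e.2.1) (nv (p.F j)) := by
  have h := gs_stable (l := fullF) j (fun j e => nv (p.M j) e) (fun j => nv (p.F j)) p.gam p.eta p.etapos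
    (fun i _ => by simp only [nv_M]; exact App.refl _) p.FF_tendsto j le_rfl
  refine Tendsto.congr' ?_ h
  filter_upwards [N_pos] with e he
  have hs : 0 < (√(e.1:ℝ))⁻¹ := inv_pos.2 (Real.sqrt_pos.2 (by exact_mod_cast he))
  have : gs (fun i => nv (p.M i) e) j = p.Ph j e.2.1 := gs_smul (fun i => vec (p.M i) e.2.1) _ hs j
  simp only [this]

/-- the limit matrix with zero diagonal -/
def G0 (K : ℕ) (e : FS) (i j : Fin e.1) : ℝ := if i = j then 0 else p.XX K e i j / √e.1

def W0 (K : ℕ) (e : FS) (i j : Fin e.1) : ℝ := p.G0 K e i j / √2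

lemma G0_symm (K : ℕ) (e : FS) (i j : Fin e.1) : p.G0 K e i j = p.G0 K e j i := by
  simp only [G0, eq_comm (a := i), p.XX_symm K e i j]

lemma symmG_W0 (K : ℕ) (e : FS) : symmG e.1 (p.W0 K e) = p.G0 K e := by
  funext i j
  have h2 : √2 * √2 = 2 := Real.mul_self_sqrt (by norm_num)
  have h20 : √2 ≠ 0 := by positivity
  simp only [symmG, W0, p.G0_symm K e j i]
  field_simp
  rw [sq, h2]; ring

lemma mv_G0 (K : ℕ) (e : FS) (u : EE e.1) : mv (p.G0 K e) u = (√e.1)⁻¹ • mv (p.XX K e) u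
    - WithLp.toLp 2 fun i => p.XX K e i i / √e.1 * u i := by
  ext i
  simp only [mv, G0, PiLp.sub_apply, PiLp.smul_apply, smul_eq_mul, Finset.mul_sum]
  rw [← Finset.add_sum_erase _ _ (Finset.mem_univ i), ← Finset.add_sum_erase (a := i) Finset.univ
    (fun j => (√e.1)⁻¹ * (p.XX K e i j * u j)) (Finset.mem_univ i)]
  rw [if_pos rfl]
  have : ∀ j ∈ Finset.univ.erase i, (if i = j then 0 else p.XX K e i j / √e.1) * u j
      = (√e.1)⁻¹ * (p.XX K e i j * u j) := by
    intro j hj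
    rw [if_neg (Finset.ne_of_mem_erase hj).symm]; ring
  rw [Finset.sum_congr rfl this]
  ring

lemma diag_app (K : ℕ) (u : ∀ e : FS, EE e.1) (hu : Bd fullF u) :
    App fullF (fun e => mv (p.G0 K e) (u e)) (fun e => (√e.1)⁻¹ • mv (p.XX K e) (u e)) := by
  obtain ⟨C, hC, hu⟩ := hu
  unfold App
  rw [Metric.tendsto_nhds]
  intro ε hε
  filter_upwards [hu, N_pos, p.XX_diag K (ε / (C + 1)) (by positivity)] with e h1 h2 h3
  have hs : 0 < √(e.1:ℝ) := Real.sqrt_pos.2 (by exact_mod_cast h2)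
  rw [mv_G0, sub_sub_cancel_left, norm_neg, dist_zero_right, norm_norm]
  have : ‖(WithLp.toLp 2 fun i => p.XX K e i i / √e.1 * u e i : EE e.1)‖ ^ 2 ≤ (ε / (C + 1) * ‖u e‖) ^ 2 := by
    rw [mul_pow, norm_sq_EE, norm_sq_EE, Finset.mul_sum]
    refine Finset.sum_le_sum fun i _ => ?_
    simp only [mul_pow]
    refine mul_le_mul_of_nonneg_right ?_ (sq_nonneg _)
    refine sq_le_sq' ?_ ?_ 
    · rw [le_div_iff₀ hs]; linarith [(abs_le.1 (h3 i)).1]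
    · rw [div_le_iff₀ hs]; linarith [(abs_le.1 (h3 i)).2]
  have h4 := abs_le_of_sq_le_sq this (by positivity)
  rw [abs_of_nonneg (norm_nonneg _)] at h4
  refine h4.trans_lt ?_
  rw [div_mul_eq_mul_div, div_lt_iff₀ (by positivity)]
  nlinarith

lemma XX_op_app (K : ℕ) (u v : ∀ e : FS, EE e.1) (h : App fullF u v) :
    App fullF (fun e => (√e.1)⁻¹ • mv (p.XX K e) (u e)) (fun e => (√e.1)⁻¹ • mv (p.XX K e) (v e)) := by
  refine app_of_le (fun e => 5 * ‖u e - v e‖) (by simpa using Tendsto.const_mul 5 h) ?_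
  filter_upwards [p.XX_qf K, N_pos] with e h1 h2
  have hs : 0 < √(e.1:ℝ) := Real.sqrt_pos.2 (by exact_mod_cast h2)
  rw [← smul_sub, ← mv_sub, norm_smul, norm_inv, Real.norm_of_nonneg hs.le, inv_mul_le_iff₀ hs]
  have := op_of_qf (p.XX K e) (p.XX_symm K e) _ h1 (u e - v e)
  linarith


lemma tame_x (s : ℕ) : Tame (fun x => x s) := Tame.coord s

/-- normalized coordinate column -/
abbrev gg (s : ℕ) : ∀ e : FS, EE e.1 := nv (fun x => x s)

lemma gg_col (s : ℕ) (e : FS) : gg s e = (√e.1)⁻¹ • col e.2.1 s := rfl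

lemma bd_F (s : ℕ) : Bd fullF (nv (p.F s)) := bd_nv (p.tame_F s)
lemma bd_g (s : ℕ) : Bd fullF (gg s) := bd_nv (tame_x s)
lemma bd_Ph (s : ℕ) : Bd fullF (fun e => p.Ph s e.2.1) := (p.bd_F s).of_app' (p.Ph_app s)

lemma gF_tendsto (s t : ℕ) : Tendsto (fun e => inner ℝ (gg s e) (nv (p.F t) e)) fullF
    (nhds (∫ x, x s * p.F t x ∂(gI ℕ))) := inner_nv_tendsto (tame_x s) (p.tame_F t)

lemma gPh_tendsto (s t : ℕ) : Tendsto (fun e => inner ℝ (gg s e) (p.Ph t e.2.1)) fullF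
    (nhds (∫ x, x s * p.F t x ∂(gI ℕ))) :=
  App.inner_tendsto (App.refl _) (p.Ph_app t) (bd_g s) (p.bd_F t) (p.gF_tendsto s t)

lemma Ph_norm (j : ℕ) : ∀ᶠ e in fullF, ‖p.Ph j e.2.1‖ = 1 := by
  have h := App.inner_tendsto (p.Ph_app j) (p.Ph_app j) (p.bd_F j) (p.bd_F j) (p.FF_tendsto j j)
  rw [if_pos rfl] at h
  filter_upwards [h.eventually (lt_mem_nhds (show (0:ℝ) < 1 by norm_num))] with e he
  rcases gs_zero_or (fun j => vec (p.M j) e.2.1) j with h1 | h1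
  · rw [Ph, h1] at he; simp at he
  · exact h1

lemma XXPh_app (K j : ℕ) (hj : j < K) : App fullF (fun e => (√e.1)⁻¹ • mv (p.XX K e) (p.Ph j e.2.1))
    (fun e => gg j e + ∑ s ∈ Finset.range j, (∫ x, x s * p.F j x ∂(gI ℕ)) • nv (p.F s) e) := by
  have h1 : App fullF (fun e => gg j e - (∑ s ∈ Finset.range j, inner ℝ (gg j e) (p.Ph s e.2.1) • p.Ph s e.2.1)
      + (((√2 - 1) * inner ℝ (gg j e) (p.Ph j e.2.1)) • p.Ph j e.2.1
        + ∑ s ∈ Finset.range j, inner ℝ (gg s e) (p.Ph j e.2.1) • p.Ph s e.2.1))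
    (fun e => gg j e - (∑ s ∈ Finset.range j, 0) + (0 + ∑ s ∈ Finset.range j, (∫ x, x s * p.F j x ∂(gI ℕ)) • nv (p.F s) e)) := by
    refine App.add (App.sub (App.refl _) (App.sum _ fun s hs => ?_)) (App.add ?_ (App.sum _ fun s hs => ?_))
    · have hs' : s < j := by simpa using hs
      have := p.gPh_tendsto j s
      rw [p.E_xF j s hs'.le] at this
      exact App.smul_zero this (p.bd_Ph s)
    · have := (p.gPh_tendsto j j).const_mul (√2 - 1)
      rw [p.E_xF j j le_rfl, mul_zero] at this
      exact App.smul_zero this (p.bd_Ph j)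
    · exact App.smul (p.gPh_tendsto s j) (p.Ph_app s) (p.bd_F s)
  simp only [Finset.sum_const_zero, sub_zero, zero_add] at h1
  refine Tendsto.congr' ?_ h1
  filter_upwards [p.Ph_norm j] with e he
  have := mv_Xh_phi (p.Ph_ON e.2.1) (col e.2.1) K j hj (Xmat e.2.2) he
  rw [XX, this]
  congr 2
  simp only [gg_col, smul_add, PK, smul_sub, Finset.smul_sum, smul_smul, inner_smul_left, conj_trivial]
  rw [add_assoc]
  congr 2
  · refine Finset.sum_congr rfl fun s _ => ?_
    rw [real_inner_comm (col e.2.1 j)]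
  · rw [real_inner_comm (col e.2.1 j)]
    congr 1
    rw [mul_left_comm]

/-- normalized TAP iterate -/
def nm (K j : ℕ) (e : FS) : EE e.1 := (√e.1)⁻¹ • p.tmm (p.W0 K e) j

lemma norm_toLp_le {N : ℕ} (a b : EE N) (h : ∀ i, |a i| ≤ |b i|) : ‖a‖ ≤ ‖b‖ := by
  refine abs_le_of_sq_le_sq' ?_ (norm_nonneg _) |>.2
  rw [norm_sq_EE, norm_sq_EE]
  exact Finset.sum_le_sum fun i _ => sq_le_sq.2 (h i)

lemma main_app (K j : ℕ) (hj : j ≤ K) : App fullF (p.nm K j) (nv (p.M j)) ∧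
    App fullF (fun e => p.tph (p.W0 K e) j) (nv (p.F j)) ∧
    (j < K → App fullF (fun e => p.ty (p.W0 K e) j) (gg j)) := by
  induction j using Nat.strong_induction_on with
  | _ j ih =>
    have hm : App fullF (p.nm K j) (nv (p.M j)) := by
      cases j with
      | zero => 
        have : p.nm K 0 = nv (p.M 0) := rfl
        rw [this]; exact App.refl _
      | succ j =>
        have h1 : App fullF (fun e => p.β • ∑ t ∈ Finset.range (j + 1), p.cf j t • p.ty (p.W0 K e) t)
            (fun e => p.β • ∑ t ∈ Finset.range (j + 1), p.cf j t • gg t e) := by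
          refine App.smul tendsto_const_nhds (App.sum _ fun t ht => App.smul tendsto_const_nhds ?_ (bd_g t))
            (Bd.sum _ fun t _ => (bd_g t).smul _)
          have ht' : t < j + 1 := by simpa using ht
          exact (ih t ht' (by omega)).2.2 (by omega)
        refine app_of_le _ h1 ?_
        filter_upwards [N_pos] with e he
        have hs : 0 < √(e.1:ℝ) := Real.sqrt_pos.2 (by exact_mod_cast he)
        refine norm_toLp_le _ _ fun i => ?_
        rw [nm, (p.alg (p.W0 K e)).mS]
        simp only [nv, vec, M, arg, PiLp.sub_apply, PiLp.smul_apply, smul_eq_mul, WithLp.ofLp_sum, Finset.sum_apply]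
        rw [← mul_sub, abs_mul, abs_of_pos (inv_pos.2 hs)]
        refine (mul_le_mul_of_nonneg_left (tanh_lip _ _) (inv_pos.2 hs).le).trans (le_of_eq ?_)
        rw [← abs_of_pos (inv_pos.2 hs), ← abs_mul, abs_of_pos (inv_pos.2 hs)]
        congr 1
        have e1 : ∑ t ∈ Finset.range (j + 1), p.cf j t * (√e.1 * p.ty (p.W0 K e) t i)
            = √e.1 * ∑ t ∈ Finset.range (j + 1), p.cf j t * p.ty (p.W0 K e) t i := by
          rw [Finset.mul_sum]; exact Finset.sum_congr rfl fun t _ => by ring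
        have e2 : ∑ t ∈ Finset.range (j + 1), p.cf j t * ((√e.1)⁻¹ * e.2.1 i t)
            = (√e.1)⁻¹ * ∑ t ∈ Finset.range (j + 1), p.cf j t * e.2.1 i t := by
          rw [Finset.mul_sum]; exact Finset.sum_congr rfl fun t _ => by ring
        rw [e1, e2]
        field_simp
        ring
    have hp : App fullF (fun e => p.tph (p.W0 K e) j) (nv (p.F j)) := by
      have h := gs_stable (l := fullF) j (fun j e => p.nm K j e) (fun j => nv (p.F j)) p.gam p.eta p.etapos
        (fun i hi => by
          have : App fullF (p.nm K i) (nv (p.M i)) := by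
            rcases hi.lt_or_eq with h | h
            · exact (ih i h (by omega)).1
            · rw [h]; exact hm
          rw [show nv (p.M i) = _ from funext (p.nv_M i)] at this
          exact this) p.FF_tendsto j le_rfl
      refine Tendsto.congr' ?_ h
      filter_upwards [N_pos] with e he
      have hs : 0 < (√(e.1:ℝ))⁻¹ := inv_pos.2 (Real.sqrt_pos.2 (by exact_mod_cast he))
      have : gs (fun i => p.nm K i e) j = p.tph (p.W0 K e) j := by
        rw [tph_eq]; exact gs_smul (p.tmm (p.W0 K e)) _ hs j
      simp only [this]
    refine ⟨hm, hp, fun hjK => ?_⟩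
    have bp : ∀ t, t ≤ j → App fullF (fun e => p.tph (p.W0 K e) t) (nv (p.F t)) := by
      intro t ht
      rcases ht.lt_or_eq with h | h
      · exact (ih t h (by omega)).2.1
      · rw [h]; exact hp
    have by' : ∀ t, t < j → App fullF (fun e => p.ty (p.W0 K e) t) (gg t) := fun t ht =>
      (ih t ht (by omega)).2.2 (by omega)
    have h1 : App fullF (fun e => mv (p.G0 K e) (p.tph (p.W0 K e) j))
        (fun e => gg j e + ∑ s ∈ Finset.range j, (∫ x, x s * p.F j x ∂(gI ℕ)) • nv (p.F s) e) :=
      (p.diag_app K _ ((p.bd_F j).of_app' hp)).trans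
        ((p.XX_op_app K _ _ (hp.trans (p.Ph_app j).symm)).trans (p.XXPh_app K j hjK))
    have h2 : App fullF (fun e => ∑ t ∈ Finset.range j, (inner ℝ (p.tph (p.W0 K e) t) (p.tph (p.W0 K e) j) • p.ty (p.W0 K e) t
        + inner ℝ (p.ty (p.W0 K e) t) (p.tph (p.W0 K e) j) • p.tph (p.W0 K e) t
    - (inner ℝ (p.ty (p.W0 K e) t) (p.tph (p.W0 K e) t) * inner ℝ (p.tph (p.W0 K e) t) (p.tph (p.W0 K e) j)) • p.tph (p.W0 K e) t))
        (fun e => ∑ s ∈ Finset.range j, (0 + (∫ x, x s * p.F j x ∂(gI ℕ)) • nv (p.F s) e - 0)) := by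
      refine App.sum _ fun t ht => ?_
      have ht' : t < j := by simpa using ht
      have i1 : Tendsto (fun e => inner ℝ (p.tph (p.W0 K e) t) (p.tph (p.W0 K e) j)) fullF (nhds 0) := by
        have := p.FF_tendsto t j
        rw [if_neg (by omega)] at this
        exact App.inner_tendsto (bp t ht'.le) hp (p.bd_F t) (p.bd_F j) this
      have i2 : Tendsto (fun e => inner ℝ (p.ty (p.W0 K e) t) (p.tph (p.W0 K e) j)) fullF
          (nhds (∫ x, x t * p.F j x ∂(gI ℕ))) :=
        App.inner_tendsto (by' t ht') hp (bd_g t) (p.bd_F j) (p.gF_tendsto t j)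
      have i3 : Tendsto (fun e => inner ℝ (p.ty (p.W0 K e) t) (p.tph (p.W0 K e) t)) fullF
          (nhds (∫ x, x t * p.F t x ∂(gI ℕ))) :=
        App.inner_tendsto (by' t ht') (bp t ht'.le) (bd_g t) (p.bd_F t) (p.gF_tendsto t t)
      refine App.sub (App.add (App.smul_zero i1 ((bd_g t).of_app' (by' t ht'))) (App.smul i2 (bp t ht'.le) (p.bd_F t)))
        (App.smul_zero ?_ ((p.bd_F t).of_app' (bp t ht'.le)))
      simpa using i3.mul i1
    have h3 := h1.sub h2
    simp only [zero_add, sub_zero, add_sub_cancel_right] at h3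
    refine Tendsto.congr' (Eventually.of_forall fun e => ?_) h3
    have := (p.alg (p.W0 K e)).yy j
    rw [symmG_W0] at this
    beta_reduce
    rw [this]

end Par

def wx (x v : ℝ) : ℝ := (1 - v ^ 2) / (1 - x * (1 - v ^ 2))

section wxsec
variable {x v : ℝ}

lemma wx_den (hx : 0 < x) (hx2 : x ≤ 1 / 2) (hv : |v| ≤ 1) :
    0 ≤ 1 - v ^ 2 ∧ 1 - v ^ 2 ≤ 1 ∧ 1 / 2 ≤ 1 - x * (1 - v ^ 2) := by
  have h1 : v ^ 2 ≤ 1 := by rw [← sq_abs]; nlinarith [abs_nonneg v]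
  refine ⟨by linarith, by nlinarith, by nlinarith [sq_nonneg v]⟩

lemma wx_nonneg (hx : 0 < x) (hx2 : x ≤ 1 / 2) (hv : |v| ≤ 1) : 0 ≤ wx x v := by
  obtain ⟨a, b, c⟩ := wx_den hx hx2 hv
  exact div_nonneg a (by linarith)

lemma wx_le_two (hx : 0 < x) (hx2 : x ≤ 1 / 2) (hv : |v| ≤ 1) : wx x v ≤ 2 := by
  obtain ⟨a, b, c⟩ := wx_den hx hx2 hv
  rw [wx, div_le_iff₀ (by linarith)]; linarith

lemma wx_le1 (hx : 0 < x) (hx2 : x ≤ 1 / 2) (hv : |v| ≤ 1) :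
    wx x v ≤ (1 - v ^ 2) + 2 * x := by
  obtain ⟨a, b, c⟩ := wx_den hx hx2 hv
  rw [wx, div_le_iff₀ (by linarith)]
  generalize 1 - v ^ 2 = s at *
  have : x * s ^ 2 ≤ x := by nlinarith [pow_le_one₀ (n := 2) a b]
  nlinarith

lemma wx_le2 (hx : 0 < x) (hx2 : x ≤ 1 / 2) (hv : |v| ≤ 1) :
    wx x v ≤ (1 - v ^ 2) + x * (1 - v ^ 2) ^ 2 + 2 * x ^ 2 := by
  obtain ⟨a, b, c⟩ := wx_den hx hx2 hv
  rw [wx, div_le_iff₀ (by linarith)]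
  generalize 1 - v ^ 2 = s at *
  have h3 : s ^ 3 ≤ 1 := pow_le_one₀ a b
  have : x ^ 2 * s ^ 3 ≤ x ^ 2 := by nlinarith [sq_nonneg x]
  nlinarith [sq_nonneg x]

lemma wx_lip (hx : 0 < x) (hx2 : x ≤ 1 / 2) (hv : |v| ≤ 1) {v' : ℝ} (hv' : |v'| ≤ 1) :
    |wx x v - wx x v'| ≤ 8 * |v - v'| := by
  obtain ⟨a, b, c⟩ := wx_den hx hx2 hv
  obtain ⟨a', b', c'⟩ := wx_den hx hx2 hv'
  have e : wx x v - wx x v' = (v' + v) * (v' - v) / ((1 - x * (1 - v ^ 2)) * (1 - x * (1 - v' ^ 2))) := by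
    rw [wx, wx, div_sub_div _ _ (by linarith) (by linarith)]
    congr 1; ring
  have h4 : (1:ℝ) / 4 ≤ (1 - x * (1 - v ^ 2)) * (1 - x * (1 - v' ^ 2)) := by nlinarith
  rw [e, abs_div, abs_mul, abs_of_pos (by linarith : (0:ℝ) < (1 - x * (1 - v ^ 2)) * (1 - x * (1 - v' ^ 2))),
    div_le_iff₀ (by linarith), abs_sub_comm v' v]
  have h5 : |v' + v| ≤ 2 := (abs_add_le _ _).trans (by linarith)
  have : |v' + v| * |v - v'| ≤ 2 * |v - v'| := by gcongr
  nlinarith [abs_nonneg (v - v')]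

lemma wx_dual (hx : 0 < x) (hx2 : x ≤ 1 / 2) (hv : |v| < 1) (u b : ℝ) :
    x * u ^ 2 + 2 * u * b - wx x v * b ^ 2 ≤ u ^ 2 * (1 - v ^ 2)⁻¹ := by
  obtain ⟨a, b', c⟩ := wx_den hx hx2 hv.le
  have h1 : 0 < 1 - v ^ 2 := by
    have : v ^ 2 < 1 := by rw [← sq_abs]; nlinarith [abs_nonneg v]
    linarith
  rw [wx]
  generalize 1 - v ^ 2 = s at *
  have hd : 0 < 1 - x * s := by linarith
  have : u ^ 2 * s⁻¹ - (x * u ^ 2 + 2 * u * b - s / (1 - x * s) * b ^ 2)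
      = ((1 - x * s) * u - s * b) ^ 2 / (s * (1 - x * s)) := by
    obtain ⟨d, hdd⟩ : ∃ d, d = 1 - x * s := ⟨_, rfl⟩
    rw [← hdd] at hd ⊢
    field_simp
    linear_combination (-u ^ 2 * d) * hdd
  have h2 : 0 ≤ ((1 - x * s) * u - s * b) ^ 2 / (s * (1 - x * s)) := by positivity
  linarith
end wxsec

lemma measurable_wx (x : ℝ) : Measurable (wx x) := by unfold wx; fun_prop

lemma int_pb (n : ℕ) {g : ℝ → ℝ} (hg : Measurable g) (C : ℝ) (hb : ∀ z, |g z| ≤ C) :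
    Integrable (fun z => z ^ n * g z) gm := by
  refine integrable_of_pow_bound (by fun_prop) C n fun z => ?_
  rw [abs_mul, abs_pow, mul_comm]; gcongr; exact hb z

namespace Par
variable (p : Par)

def mz (z : ℝ) : ℝ := Real.tanh (p.h + p.β * (√p.q * z))

lemma measurable_mz : Measurable p.mz := measurable_tanh_comp (by fun_prop)
lemma mz_le (z : ℝ) : |p.mz z| ≤ 1 := tanh_abs_le_one _
lemma mz_sq (z : ℝ) : p.mz z ^ 2 ≤ 1 := tanh_sq_le_one _

lemma mz_deriv (z : ℝ) : HasDerivAt p.mz ((1 - p.mz z ^ 2) * (p.β * √p.q)) z := by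
  have h1 : HasDerivAt (fun z => p.h + p.β * (√p.q * z)) (p.β * √p.q) z := by
    have := (((hasDerivAt_id z).const_mul (√p.q)).const_mul p.β).const_add p.h
    simpa using this
  exact (hasDerivAt_tanh _).comp z h1

lemma int_poly (n i j : ℕ) : Integrable (fun z => z ^ n * ((1 - p.mz z ^ 2) ^ i * p.mz z ^ j)) gm := by
  have := p.measurable_mz
  refine int_pb n (by fun_prop) 1 fun z => ?_
  rw [abs_mul, abs_pow, abs_pow]
  have h2 := p.mz_sq z
  have h3 := p.mz_le z
  have h4 : |1 - p.mz z ^ 2| ≤ 1 := by rw [abs_le]; constructor <;> nlinarith [sq_nonneg (p.mz z)]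
  exact mul_le_one₀ (pow_le_one₀ (abs_nonneg _) h4) (by positivity) (pow_le_one₀ (abs_nonneg _) h3)

lemma E_s : ∫ z, (1 - p.mz z ^ 2) ∂gm = 1 - p.q := by
  have h := qfix p.hq
  have hi := p.int_poly 0 0 2
  simp only [pow_zero, one_mul] at hi
  rw [integral_sub (integrable_const _) hi]
  simp only [integral_const, probReal_univ, smul_eq_mul, mul_one, one_mul]
  rw [← h]; rfl

lemma E_s2 : ∫ z, (1 - p.mz z ^ 2) ^ 2 ∂gm = Bc p.β p.h p.q := rfl

lemma E_zms : ∫ z, z * ((1 - p.mz z ^ 2) * p.mz z) ∂gm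
    = p.β * √p.q * (3 * Bc p.β p.h p.q - 2 * (1 - p.q)) := by
  have h0 := p.int_poly 0 1 1
  have h1 := p.int_poly 1 1 1
  have i1 := p.int_poly 0 2 0
  have i2 := p.int_poly 0 1 0
  simp only [pow_zero, one_mul, mul_one, pow_one] at h0 h1 i1 i2
  have h2 : Integrable (fun z => p.β * √p.q * (3 * (1 - p.mz z ^ 2) ^ 2 - 2 * (1 - p.mz z ^ 2))) gm :=
    ((i1.const_mul 3).sub (i2.const_mul 2)).const_mul _
  rw [stein (f' := fun z => p.β * √p.q * (3 * (1 - p.mz z ^ 2) ^ 2 - 2 * (1 - p.mz z ^ 2))) _ h0 h1 h2]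
  · rw [integral_const_mul, integral_sub (i1.const_mul 3) (i2.const_mul 2), integral_const_mul, integral_const_mul,
      E_s, E_s2]
  · intro z
    have hd := p.mz_deriv z
    refine (((hd.pow 2).const_sub 1).mul hd).congr_deriv ?_
    simp; ring

lemma E_sz2 : ∫ z, z ^ 2 * (1 - p.mz z ^ 2) ∂gm
    = (1 - p.q) - 2 * (p.β * √p.q) * (p.β * √p.q * (3 * Bc p.β p.h p.q - 2 * (1 - p.q))) := by
  have h0 := p.int_poly 1 1 0
  have h1 := p.int_poly 2 1 0
  have i1 := p.int_poly 1 1 1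
  have i2 := p.int_poly 0 1 0
  simp only [pow_zero, one_mul, mul_one, pow_one] at h0 h1 i1 i2
  have h2 : Integrable (fun z => (1 - p.mz z ^ 2) - 2 * (p.β * √p.q) * (z * ((1 - p.mz z ^ 2) * p.mz z))) gm :=
    i2.sub (i1.const_mul _)
  have e : (fun z => z ^ 2 * (1 - p.mz z ^ 2)) = fun z => z * (z * (1 - p.mz z ^ 2)) := by ext; ring
  rw [e] at h1
  rw [e, stein (f' := fun z => (1 - p.mz z ^ 2) - 2 * (p.β * √p.q) * (z * ((1 - p.mz z ^ 2) * p.mz z))) _ h0 h1 h2]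
  · rw [integral_sub i2 (i1.const_mul _), integral_const_mul, E_s, E_zms]
  · intro z
    have hd := p.mz_deriv z
    refine ((hasDerivAt_id z).mul ((hd.pow 2).const_sub 1)).congr_deriv ?_
    simp; ring

lemma E_H0 : ∫ z, (1 - p.mz z ^ 2) * (p.β * z + 2 * p.β ^ 2 * √p.q * p.mz z) ^ 2 ∂gm
    = p.β ^ 2 * (1 - p.q) + 2 * p.β ^ 4 * p.q * Bc p.β p.h p.q := by
  have h1 := p.int_poly 2 1 0
  have i1 := p.int_poly 1 1 1
  have i2 := p.int_poly 0 1 0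
  have i3 := p.int_poly 0 2 0
  simp only [pow_zero, one_mul, mul_one, pow_one] at h1 i1 i2 i3
  have e : (fun z => (1 - p.mz z ^ 2) * (p.β * z + 2 * p.β ^ 2 * √p.q * p.mz z) ^ 2)
    = fun z => p.β ^ 2 * (z ^ 2 * (1 - p.mz z ^ 2)) + 4 * p.β ^ 3 * √p.q * (z * ((1 - p.mz z ^ 2) * p.mz z))
      + (4 * p.β ^ 4 * p.q) * ((1 - p.mz z ^ 2) - (1 - p.mz z ^ 2) ^ 2) := by
    ext z
    have := Real.sq_sqrt p.q0.le
    linear_combination (4 * p.β ^ 4 * (p.mz z ^ 2 - p.mz z ^ 4)) * this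
  have j1 := h1.const_mul (p.β ^ 2)
  have j2 := i1.const_mul (4 * p.β ^ 3 * √p.q)
  have j12 : Integrable (fun z => p.β ^ 2 * (z ^ 2 * (1 - p.mz z ^ 2)) + 4 * p.β ^ 3 * √p.q * (z * ((1 - p.mz z ^ 2) * p.mz z))) gm :=
    j1.add j2
  have j3 : Integrable (fun z => (4 * p.β ^ 4 * p.q) * ((1 - p.mz z ^ 2) - (1 - p.mz z ^ 2) ^ 2)) gm := (i2.sub i3).const_mul _
  rw [e, integral_add j12 j3, integral_add j1 j2,
    integral_const_mul, integral_const_mul, integral_const_mul, integral_sub i2 i3, E_s, E_s2, E_zms, E_sz2]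
  have := Real.sq_sqrt p.q0.le
  linear_combination (2 * p.β ^ 4 * (3 * Bc p.β p.h p.q - 2 * (1 - p.q))) * this

def Ew (x : ℝ) : ℝ := ∫ z, wx x (p.mz z) ∂gm
def Hw (x : ℝ) : ℝ := ∫ z, wx x (p.mz z) * (p.β * z + 2 * p.β ^ 2 * √p.q * p.mz z) ^ 2 ∂gm

lemma wmz_bd {x : ℝ} (hx : 0 < x) (hx2 : x ≤ 1 / 2) (z : ℝ) : |wx x (p.mz z)| ≤ 2 := by
  rw [abs_of_nonneg (wx_nonneg hx hx2 (p.mz_le z))]; exact wx_le_two hx hx2 (p.mz_le z)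

lemma int_w {x : ℝ} (hx : 0 < x) (hx2 : x ≤ 1 / 2) (n j : ℕ) :
    Integrable (fun z => z ^ n * (wx x (p.mz z) * p.mz z ^ j)) gm := by
  have := p.measurable_mz
  have h5 : Measurable (fun z => wx x (p.mz z)) := (measurable_wx x).comp this
  refine int_pb n (by fun_prop) 2 fun z => ?_
  rw [abs_mul, abs_pow, ← mul_one (2:ℝ)]
  exact mul_le_mul (p.wmz_bd hx hx2 z) (pow_le_one₀ (abs_nonneg _) (p.mz_le z)) (by positivity) (by norm_num)

lemma int_Hw {x : ℝ} (hx : 0 < x) (hx2 : x ≤ 1 / 2) :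
    Integrable (fun z => wx x (p.mz z) * (p.β * z + 2 * p.β ^ 2 * √p.q * p.mz z) ^ 2) gm := by
  have i1 := (p.int_w hx hx2 2 0).const_mul (p.β ^ 2)
  have i2 := (p.int_w hx hx2 1 1).const_mul (4 * p.β ^ 3 * √p.q)
  have i3 := (p.int_w hx hx2 0 2).const_mul (4 * p.β ^ 4 * √p.q ^ 2)
  refine ((i1.add i2).add i3).congr ?_
  filter_upwards with z
  simp only [Pi.add_apply]; ring

lemma Ew_le {x : ℝ} (hx : 0 < x) (hx2 : x ≤ 1 / 2) :
    p.Ew x ≤ (1 - p.q) + x * Bc p.β p.h p.q + 2 * x ^ 2 := by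
  have i2 := p.int_poly 0 1 0
  have i3 := p.int_poly 0 2 0
  have i0 := p.int_w hx hx2 0 0
  simp only [pow_zero, one_mul, mul_one, pow_one] at i2 i3 i0
  have h := integral_mono i0 ((i2.add (i3.const_mul x)).add (integrable_const (2 * x ^ 2)))
    (fun z => wx_le2 hx hx2 (p.mz_le z))
  simp only [Pi.add_apply] at h
  have j : Integrable (fun z => (1 - p.mz z ^ 2) + x * (1 - p.mz z ^ 2) ^ 2) gm := i2.add (i3.const_mul x)
  rw [integral_add j (integrable_const _), integral_add i2 (i3.const_mul x),
    integral_const_mul, E_s, E_s2] at h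
  simpa [Ew] using h

lemma Hw_le {x : ℝ} (hx : 0 < x) (hx2 : x ≤ 1 / 2) :
    p.Hw x ≤ p.β ^ 2 * (1 - p.q) + 2 * p.β ^ 4 * p.q * Bc p.β p.h p.q
      + 2 * x * (2 * p.β ^ 2 + 8 * p.β ^ 4 * p.q) := by
  have i1 : Integrable (fun z => (1 - p.mz z ^ 2) * (p.β * z + 2 * p.β ^ 2 * √p.q * p.mz z) ^ 2) gm := by
    have i1 := (p.int_poly 2 1 0).const_mul (p.β ^ 2)
    have i2 := (p.int_poly 1 1 1).const_mul (4 * p.β ^ 3 * √p.q)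
    have i3 := (p.int_poly 0 1 2).const_mul (4 * p.β ^ 4 * √p.q ^ 2)
    refine ((i1.add i2).add i3).congr ?_
    filter_upwards with z
    simp only [Pi.add_apply]; ring
  have hz : Integrable (fun z : ℝ => z ^ 2) gm := by
    have := p.int_poly 2 0 0
    simpa using this
  have h := integral_mono (p.int_Hw hx hx2) (i1.add ((((hz.const_mul (2 * p.β ^ 2))).add
      (integrable_const (8 * p.β ^ 4 * p.q))).const_mul (2 * x)))
    (fun z => by
      have h1 := wx_le1 hx hx2 (p.mz_le z)
      have h2 := p.mz_sq z
      have h3 := Real.sq_sqrt p.q0.le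
      have h4 : (p.β * z + 2 * p.β ^ 2 * √p.q * p.mz z) ^ 2 ≤ 2 * p.β ^ 2 * z ^ 2 + 8 * p.β ^ 4 * p.q := by
        have : (p.β * z + 2 * p.β ^ 2 * √p.q * p.mz z) ^ 2 ≤ 2 * (p.β * z) ^ 2 + 2 * (2 * p.β ^ 2 * √p.q * p.mz z) ^ 2 := by
          nlinarith [sq_nonneg (p.β * z - 2 * p.β ^ 2 * √p.q * p.mz z)]
        have h5 : 2 * (2 * p.β ^ 2 * √p.q * p.mz z) ^ 2 = 8 * p.β ^ 4 * p.q * p.mz z ^ 2 := by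
          rw [mul_pow, mul_pow, h3]; ring
        have h6 : 8 * p.β ^ 4 * p.q * p.mz z ^ 2 ≤ 8 * p.β ^ 4 * p.q * 1 := by
          have := p.q0; gcongr
        nlinarith
      simp only [Pi.add_apply]
      have h7 := mul_le_mul_of_nonneg_right h1 (sq_nonneg (p.β * z + 2 * p.β ^ 2 * √p.q * p.mz z))
      nlinarith)
  simp only [Pi.add_apply] at h
  have j : Integrable (fun z => 2 * x * (2 * p.β ^ 2 * z ^ 2 + 8 * p.β ^ 4 * p.q)) gm := (((hz.const_mul (2 * p.β ^ 2))).add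
      (integrable_const (8 * p.β ^ 4 * p.q))).const_mul (2 * x)
  rw [integral_add i1 j, E_H0, integral_const_mul,
      integral_add (hz.const_mul _) (integrable_const _), integral_const_mul, integral_sq_gm] at h
  simpa [Hw] using h

lemma exists_xc : ∃ x c : ℝ, 0 < x ∧ x ≤ 1 / 2 ∧ 0 < c ∧ c ≤ x + p.β ^ 2 * (1 - p.q) - p.β ^ 2 * p.Ew x ∧
    c ≤ x + p.β ^ 2 * (1 - p.q) + 2 * p.β ^ 2 * p.q - p.Hw x := by
  set B := Bc p.β p.h p.q with hB
  have hAT : 0 < 1 - p.β ^ 2 * B := by have := AT_Bc p.hAT; linarith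
  have hb : 0 < p.β ^ 2 := by have := p.hβ; positivity
  have hq := p.q0
  set d := 1 - p.β ^ 2 * B with hd
  set L := 2 * p.β ^ 2 + 8 * p.β ^ 4 * p.q with hL
  have hLp : 0 < L := by positivity
  obtain ⟨x, hx0, hx1⟩ : ∃ x, 0 < x ∧ x < min (1/2) (min (d / (4 * p.β ^ 2)) (p.β ^ 2 * p.q * d / L)) :=
    exists_between (by positivity)
  rw [lt_min_iff, lt_min_iff] at hx1
  obtain ⟨h1, h2, h3⟩ := hx1
  rw [lt_div_iff₀ (by positivity)] at h2
  rw [lt_div_iff₀ hLp] at h3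
  have e1 := p.Ew_le hx0 h1.le
  have e2 := p.Hw_le hx0 h1.le
  rw [← hB, ← hL] at e2
  rw [← hB] at e1
  have f1 : x * d / 2 ≤ x + p.β ^ 2 * (1 - p.q) - p.β ^ 2 * p.Ew x := by
    have := mul_le_mul_of_nonneg_left e1 hb.le
    have g := mul_le_mul_of_nonneg_left h2.le hx0.le
    rw [hd] at g ⊢
    nlinarith
  have f2 : x ≤ x + p.β ^ 2 * (1 - p.q) + 2 * p.β ^ 2 * p.q - p.Hw x := by
    rw [hd] at h3
    nlinarith
  refine ⟨x, min (x * d / 2) x, hx0, h1.le, by positivity, (min_le_left _ _).trans f1, (min_le_right _ _).trans f2⟩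


lemma pi_sq_le (J : ℕ) (a : ℕ → ℝ) (ha : ∑ s ∈ Finset.range (J + 2), a s ^ 2 = 1) :
    (∑ t ∈ Finset.range (J + 2), p.cf J t * a t) ^ 2 ≤ p.q := by
  have h := Finset.sum_mul_sq_le_sq_mul_sq (Finset.range (J + 2)) (p.cf J) a
  have h2 := p.cf_sq (p.Sg_lt J) (J + 2) (by omega)
  simp only [← sq] at h2
  rwa [ha, h2, mul_one] at h

lemma gm_lin (A B : ℝ) : ∫ ξ, (A + B * ξ) ^ 2 ∂gm = A ^ 2 + B ^ 2 := by
  have hz : Integrable (fun z : ℝ => z ^ 2) gm := by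
    have := int_pb 2 (g := fun _ => 1) measurable_const 1 (by simp)
    simpa using this
  have hz1 : Integrable (fun z : ℝ => z) gm := by
    have := int_pb 1 (g := fun _ => 1) measurable_const 1 (by simp)
    simpa using this
  have e : (fun ξ : ℝ => (A + B * ξ) ^ 2) = fun ξ => (A ^ 2 + 2 * A * B * ξ) + B ^ 2 * ξ ^ 2 := by
    ext; ring
  have j : Integrable (fun ξ : ℝ => A ^ 2 + 2 * A * B * ξ) gm := (integrable_const _).add (hz1.const_mul _)
  rw [e, integral_add j (hz.const_mul _), integral_add (integrable_const _) (hz1.const_mul _),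
    integral_const_mul, integral_const_mul, integral_sq_gm]
  have : ∫ ξ : ℝ, ξ ∂gm = 0 := by simp [gm, integral_id_gaussianReal]
  rw [this]
  simp

lemma lim_formula {x : ℝ} (hx : 0 < x) (hx2 : x ≤ 1 / 2) (J : ℕ) (a : ℕ → ℝ)
    (ha : ∑ s ∈ Finset.range (J + 2), a s ^ 2 = 1) (ρ : ℝ)
    (hρ : ρ = ∑ t ∈ Finset.range (J + 2), p.cf J t * a t) :
    ∫ y, wx x (p.M (J + 1) y) * (p.β * (∑ s ∈ Finset.range (J + 2), a s * y s)
        + 2 * p.β ^ 2 * ρ * p.M (J + 1) y) ^ 2 ∂(gI ℕ)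
      = ρ ^ 2 / p.q * p.Hw x + p.β ^ 2 * (1 - ρ ^ 2 / p.q) * p.Ew x := by
  have hq := p.q0
  have hsq := Real.sq_sqrt hq.le
  have hsp : 0 < √p.q := Real.sqrt_pos.2 hq
  have hρq : ρ ^ 2 ≤ p.q := hρ ▸ p.pi_sq_le J a ha
  obtain ⟨t, ht⟩ : ∃ t, t = ρ / √p.q := ⟨_, rfl⟩
  have htρ : ρ = t * √p.q := by rw [ht]; field_simp
  have ht2 : t ^ 2 = ρ ^ 2 / p.q := by rw [ht, div_pow, hsq]
  have ht1 : t ^ 2 ≤ 1 := by rw [ht2, div_le_one hq]; exact hρq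
  have hr : √(1 - t ^ 2) ^ 2 = 1 - t ^ 2 := Real.sq_sqrt (by linarith)
  have mw := measurable_wx x
  have key := integral_law2 (Finset.range (J + 2)) (Finset.range 2) (p.cf J) a
    (fun n => if n = 0 then √p.q else 0) (fun n => if n = 0 then t else √(1 - t ^ 2))
    (by rw [p.cf_sq (p.Sg_lt J) (J + 2) (by omega)]; simp [Finset.sum_range_succ, Real.mul_self_sqrt hq.le])
    (by simp only [← sq, ha]; simp [Finset.sum_range_succ, hr]) (by rw [← hρ]; simp [Finset.sum_range_succ, htρ, mul_comm])
    (fun y z => wx x (Real.tanh (p.h + p.β * y)) * (p.β * z + 2 * p.β ^ 2 * ρ * Real.tanh (p.h + p.β * y)) ^ 2)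
    (by
      have h1 : Measurable (fun q : ℝ × ℝ => Real.tanh (p.h + p.β * q.1)) := measurable_tanh_comp (by fun_prop)
      have h2 : Measurable (fun q : ℝ × ℝ => wx x (Real.tanh (p.h + p.β * q.1))) := mw.comp h1
      fun_prop)
  have e1 : (fun y => wx x (p.M (J + 1) y) * (p.β * (∑ s ∈ Finset.range (J + 2), a s * y s)
        + 2 * p.β ^ 2 * ρ * p.M (J + 1) y) ^ 2) = fun y => (fun y z => wx x (Real.tanh (p.h + p.β * y)) * (p.β * z + 2 * p.β ^ 2 * ρ * Real.tanh (p.h + p.β * y)) ^ 2)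
        (∑ s ∈ Finset.range (J + 2), p.cf J s * y s) (∑ s ∈ Finset.range (J + 2), a s * y s) := by
    ext y
    rw [M, p.arg_eq (by omega : J < J + 2)]
  rw [e1, key]
  simp only [Finset.sum_range_succ, Finset.sum_range_zero, zero_add, if_true, one_ne_zero, if_false, zero_mul, add_zero]
  have mmz := p.measurable_mz
  have mwz : Measurable (fun z => wx x (p.mz z)) := mw.comp mmz
  have e2 : (fun y : ℕ → ℝ => wx x (Real.tanh (p.h + p.β * (√p.q * y 0))) * (p.β * (t * y 0 + √(1 - t ^ 2) * y 1) +
      2 * p.β ^ 2 * ρ * Real.tanh (p.h + p.β * (√p.q * y 0))) ^ 2)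
      = fun y => wx x (p.mz (y 0)) * (t * (p.β * y 0 + 2 * p.β ^ 2 * √p.q * p.mz (y 0)) + (p.β * √(1 - t ^ 2)) * y 1) ^ 2 := by
    ext y
    rw [mz, htρ]; ring
  rw [e2, integral_update 1]
  · simp only [Function.update_self, ne_eq, zero_ne_one, not_false_eq_true, Function.update_of_ne]
    simp_rw [integral_const_mul, gm_lin]
    have m3 : Measurable (fun z : ℝ => wx x (p.mz z) * ((t * (p.β * z + 2 * p.β ^ 2 * √p.q * p.mz z)) ^ 2 + (p.β * √(1 - t ^ 2)) ^ 2)) := by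
      fun_prop
    rw [integral_coord (ι := ℕ) 0 m3]
    have e3 : (fun z : ℝ => wx x (p.mz z) * ((t * (p.β * z + 2 * p.β ^ 2 * √p.q * p.mz z)) ^ 2 + (p.β * √(1 - t ^ 2)) ^ 2))
        = fun z => t ^ 2 * (wx x (p.mz z) * (p.β * z + 2 * p.β ^ 2 * √p.q * p.mz z) ^ 2) + p.β ^ 2 * (1 - t ^ 2) * wx x (p.mz z) := by
      ext z; rw [mul_pow, mul_pow, hr]; ring
    have i0 := p.int_w hx hx2 0 0
    simp only [pow_zero, one_mul, mul_one] at i0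
    rw [e3, integral_add ((p.int_Hw hx hx2).const_mul _) (i0.const_mul _), integral_const_mul, integral_const_mul,
      ht2]
    rfl
  · have t1 : Tame (fun y : ℕ → ℝ => wx x (p.mz (y 0))) :=
      Tame.of_bdd (by fun_prop) 2 fun y => p.wmz_bd hx hx2 _
    have t2 : Tame (fun y : ℕ → ℝ => p.mz (y 0)) :=
      Tame.of_bdd (by fun_prop) 1 fun y => p.mz_le _
    exact (t1.mul (((((Tame.const t).mul (((Tame.const p.β).mul (Tame.coord 0)).add
      ((Tame.const (2 * p.β ^ 2 * √p.q)).mul t2)))).add ((Tame.const (p.β * √(1 - t ^ 2))).mul (Tame.coord 1))).pow 2)).integrable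

lemma fourth (J : ℕ) (a : ℕ → ℝ)
    (ha : ∑ s ∈ Finset.range (J + 2), a s ^ 2 = 1) (ρ : ℝ) (hρ : ρ ^ 2 ≤ 1) (K : ℕ) :
    ∫ y, (p.β * (∑ s ∈ Finset.range (J + 2), a s * y s) + 2 * p.β ^ 2 * ρ * p.M K y) ^ 4 ∂(gI ℕ)
      ≤ 8 * (p.β ^ 4 * C4 + 16 * p.β ^ 8) := by
  have t1 : Tame (fun y : ℕ → ℝ => ∑ s ∈ Finset.range (J + 2), a s * y s) :=
    Tame.sum _ _ fun s _ => (Tame.const _).mul (Tame.coord s)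
  have hl := integral_law1 (Finset.range (J + 2)) a zero_le_one (by simpa only [← sq] using ha)
    (fun z => z ^ 4) (by fun_prop)
  simp only [Real.sqrt_one, one_mul] at hl
  have h := integral_mono
    (μ := gI ℕ) (f := fun y => (p.β * (∑ s ∈ Finset.range (J + 2), a s * y s) + 2 * p.β ^ 2 * ρ * p.M K y) ^ 4)
    (g := fun y => 8 * p.β ^ 4 * (∑ s ∈ Finset.range (J + 2), a s * y s) ^ 4 + 8 * 16 * p.β ^ 8)
    ((((Tame.const p.β).mul t1).add ((Tame.const (2 * p.β ^ 2 * ρ)).mul (p.tame_M K))).pow 4).integrable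
    (((Tame.const (8 * p.β ^ 4)).mul (t1.pow 4)).add (Tame.const _)).integrable
    (fun y => by
      beta_reduce
      have h4 : ∀ A B : ℝ, (A + B) ^ 4 ≤ 8 * (A ^ 4 + B ^ 4) := by
        intro A B
        have e1 : (A + B) ^ 2 ≤ 2 * (A ^ 2 + B ^ 2) := by nlinarith [sq_nonneg (A - B)]
        have e2 : (A ^ 2 + B ^ 2) ^ 2 ≤ 2 * (A ^ 4 + B ^ 4) := by nlinarith [sq_nonneg (A ^ 2 - B ^ 2)]
        nlinarith [sq_nonneg (A + B), sq_nonneg A, sq_nonneg B]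
      refine (h4 _ _).trans ?_
      have h5 : (2 * p.β ^ 2 * ρ * p.M K y) ^ 4 ≤ 16 * p.β ^ 8 := by
        have e : (2 * p.β ^ 2 * ρ * p.M K y) ^ 4 = 16 * p.β ^ 8 * ((ρ ^ 2) ^ 2 * (|p.M K y|) ^ 4) := by
          rw [show |p.M K y| ^ 4 = (|p.M K y| ^ 2) ^ 2 by ring, sq_abs]; ring
        rw [e]
        have := mul_le_one₀ (pow_le_one₀ (n := 2) (sq_nonneg ρ) hρ) (by positivity)
          (pow_le_one₀ (n := 4) (abs_nonneg _) (p.M_abs_le K y))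
        have h8 : 0 ≤ 16 * p.β ^ 8 := by have := p.hβ; positivity
        nlinarith
      rw [mul_pow]
      linarith)
  refine h.trans (le_of_eq ?_)
  rw [integral_add ((Tame.const (8 * p.β ^ 4)).mul (t1.pow 4)).integrable (integrable_const _), integral_const_mul, hl]
  simp [C4]; ring

end Par

namespace Par
variable (p : Par)

/-- The part of the quadratic form that only depends on the columns `< K`. -/
def TT (K : ℕ) {N : ℕ} (g : Fin N → ℕ → ℝ) (u w : EE N) : ℝ :=
  ∑ i, u i ^ 2 * (1 - (vec (p.M K) g i + w i) ^ 2)⁻¹ + p.β ^ 2 * (1 - p.q)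
    - 2 * p.β ^ 2 / N * inner ℝ u (vec (p.M K) g + w) ^ 2
    - p.β / √N * ∑ s ∈ Finset.range K, (2 * inner ℝ (p.Ph s g) u * inner ℝ (col g s) (PK (fun s => p.Ph s g) s u)
        + (√2 - 2) * inner ℝ (p.Ph s g) (col g s) * inner ℝ (p.Ph s g) u ^ 2)

def bfun (J : ℕ) (a : ℕ → ℝ) (ρ : ℝ) (y : ℕ → ℝ) : ℝ :=
  p.β * (∑ s ∈ Finset.range (J + 2), a s * y s) + 2 * p.β ^ 2 * ρ * p.M (J + 1) y

def errT (J : ℕ) (θ d ε : ℝ) : ℝ :=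
  2 * p.β ^ 2 * θ ^ 2 + 2 * p.β ^ 2 * (2 * √ε + ε) + d + 8 * √(ε * (8 * (p.β ^ 4 * C4 + 16 * p.β ^ 8) + d))
    + 2 * p.β * (J + 2) ^ 2 * d

lemma det1 {N : ℕ} (φ : ℕ → EE N) (hφ : ON φ) (k : ℕ → EE N) (u : EE N) (hu : ‖u‖ = 1) (K : ℕ) (d : ℝ)
    (h1 : ∀ s ≤ K, ∀ t ≤ s, |inner ℝ (k s) (φ t)| ≤ d) (hd : 0 ≤ d) :
    ∑ s ∈ Finset.range K, (2 * inner ℝ (φ s) u * inner ℝ (k s) (PK φ s u)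
        + (√2 - 2) * inner ℝ (φ s) (k s) * inner ℝ (φ s) u ^ 2)
      + 2 * ‖PK φ K u‖ * inner ℝ (k K) (PK φ K u)
    ≤ 2 * (∑ s ∈ Finset.range K, inner ℝ (φ s) u * inner ℝ (k s) u + ‖PK φ K u‖ * inner ℝ (k K) u)
      + 2 * (K + 1) ^ 2 * d := by
  have hn : ∀ t, |inner ℝ (φ t) u| ≤ 1 := by
    intro t
    refine (abs_real_inner_le_norm _ _).trans ?_
    rw [hu, mul_one]
    rcases hφ.z1 t with h | h <;> simp [h]
  have hP : ‖PK φ K u‖ ≤ 1 := by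
    have h := PK_norm_sq hφ K u
    have h2 : 0 ≤ ∑ s ∈ Finset.range K, inner ℝ (φ s) u ^ 2 := Finset.sum_nonneg fun _ _ => sq_nonneg _
    rw [hu] at h
    nlinarith [norm_nonneg (PK φ K u)]
  have hin : ∀ s ≤ K, |inner ℝ (k s) (PK φ s u) - inner ℝ (k s) u| ≤ s * d := by
    intro s hs
    rw [PK, inner_sub_right, inner_sum, sub_sub_cancel_left, abs_neg]
    refine (Finset.abs_sum_le_sum_abs _ _).trans ?_
    refine (Finset.sum_le_sum (g := fun _ => d) fun t ht => ?_).trans (by simp)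
    rw [inner_smul_right, abs_mul]
    have := mul_le_mul (hn t) (h1 s hs t (Finset.mem_range.1 ht).le) (abs_nonneg _) zero_le_one
    simpa using this
  have h2 : |√2 - 2| ≤ 2 := by
    have : √2 ≤ 2 := by rw [Real.sqrt_le_left (by norm_num)]; norm_num
    rw [abs_le]; constructor <;> nlinarith [Real.sqrt_nonneg 2]
  have term : ∀ s ∈ Finset.range K, (2 * inner ℝ (φ s) u * inner ℝ (k s) (PK φ s u)
        + (√2 - 2) * inner ℝ (φ s) (k s) * inner ℝ (φ s) u ^ 2)
      ≤ 2 * (inner ℝ (φ s) u * inner ℝ (k s) u) + 2 * (K + 1) * d := by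
    intro s hs
    have hs' : s < K := by simpa using hs
    have hsK : (s:ℝ) ≤ K := by exact_mod_cast hs'.le
    have a1 : inner ℝ (φ s) u * (inner ℝ (k s) (PK φ s u) - inner ℝ (k s) u) ≤ K * d := by
      refine (le_abs_self _).trans ?_
      rw [abs_mul]
      have := mul_le_mul (hn s) ((hin s hs'.le).trans (mul_le_mul_of_nonneg_right hsK hd)) (abs_nonneg _) zero_le_one
      simpa using this
    have a2 : (√2 - 2) * inner ℝ (φ s) (k s) * inner ℝ (φ s) u ^ 2 ≤ 2 * d := by
      refine (le_abs_self _).trans ?_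
      rw [abs_mul, abs_mul, abs_pow]
      have e1 := h1 s hs'.le s le_rfl
      rw [real_inner_comm] at e1
      have e2 : |inner ℝ (φ s) u| ^ 2 ≤ 1 := pow_le_one₀ (abs_nonneg _) (hn s)
      have e3 := mul_le_mul h2 e1 (abs_nonneg _) zero_le_two
      have := mul_le_mul e3 e2 (by positivity) (by positivity)
      simpa using this
    nlinarith
  have hsum := (Finset.sum_le_sum term).trans_eq Finset.sum_add_distrib
  rw [← Finset.mul_sum] at hsum
  simp only [Finset.sum_const, Finset.card_range, nsmul_eq_mul] at hsum
  have a1 : ‖PK φ K u‖ * (inner ℝ (k K) (PK φ K u) - inner ℝ (k K) u) ≤ K * d := by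
    refine (mul_le_mul_of_nonneg_left ((le_abs_self _).trans (hin K le_rfl)) (norm_nonneg _)).trans ?_
    have : 0 ≤ K * d := by positivity
    nlinarith
  have hK : (0:ℝ) ≤ K := by positivity
  nlinarith

lemma det2 {N : ℕ} (hN : 0 < N) {x : ℝ} (hx : 0 < x) (hx2 : x ≤ 1 / 2) (m b : Fin N → ℝ) (u w : EE N) (hu : ‖u‖ = 1)
    (hm : ∀ i, |m i| ≤ 1) (hv : ∀ i, |m i + w i| < 1) (ε : ℝ) (hw : ‖w‖ ^ 2 ≤ N * ε) (D E : ℝ)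
    (hD : (∑ i, wx x (m i) * b i ^ 2) / N ≤ D) (hE : (∑ i, b i ^ 4) / N ≤ E) :
    x + 2 * ((√N)⁻¹ * ∑ i, u i * b i) - D - 8 * √(ε * E) ≤ ∑ i, u i ^ 2 * (1 - (m i + w i) ^ 2)⁻¹ := by
  have hN' : (0:ℝ) < N := by exact_mod_cast hN
  have hs : √(N:ℝ) ^ 2 = N := Real.sq_sqrt hN'.le
  have hsp : 0 < √(N:ℝ) := Real.sqrt_pos.2 hN'
  have h1 : ∀ i ∈ Finset.univ, x * u i ^ 2 + 2 * ((√N)⁻¹ * (u i * b i)) - wx x (m i) * b i ^ 2 / N - 8 * (|w i| * b i ^ 2) / N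
      ≤ u i ^ 2 * (1 - (m i + w i) ^ 2)⁻¹ := by
    intro i _
    have := wx_dual hx hx2 (hv i) (u i) ((√N)⁻¹ * b i)
    have l := wx_lip hx hx2 (hv i).le (hm i)
    rw [add_sub_cancel_left] at l
    have l2 := (le_abs_self _).trans l
    have e : ((√N)⁻¹ * b i) ^ 2 = b i ^ 2 / N := by rw [mul_pow, inv_pow, hs]; ring
    rw [e] at this
    have h0 : 0 ≤ b i ^ 2 / N := by positivity
    have l3 := mul_le_mul_of_nonneg_right l2 h0
    have e2 : 8 * (|w i| * b i ^ 2) / N = 8 * |w i| * (b i ^ 2 / N) := by ring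
    have e3 : wx x (m i) * b i ^ 2 / N = wx x (m i) * (b i ^ 2 / N) := by ring
    rw [e2, e3]
    nlinarith
  have h2 := Finset.sum_le_sum h1
  rw [Finset.sum_sub_distrib, Finset.sum_sub_distrib, Finset.sum_add_distrib, ← Finset.mul_sum, ← norm_sq_EE, hu,
    ← Finset.mul_sum, ← Finset.mul_sum, ← Finset.sum_div, ← Finset.sum_div, ← Finset.mul_sum] at h2
  have cs := Finset.sum_mul_sq_le_sq_mul_sq Finset.univ (fun i => |w i|) (fun i => b i ^ 2)
  simp only [sq_abs] at cs
  rw [← norm_sq_EE] at cs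
  have e4 : ∀ i, (b i ^ 2) ^ 2 = b i ^ 4 := fun i => by ring
  simp only [e4] at cs
  have h3 : (∑ i, |w i| * b i ^ 2) / N ≤ √(ε * E) := by
    refine Real.le_sqrt_of_sq_le ?_
    rw [div_pow, div_le_iff₀ (by positivity)]
    refine cs.trans ?_
    rw [div_le_iff₀ hN'] at hE
    have := mul_le_mul hw hE (Finset.sum_nonneg fun i _ => by positivity) ((sq_nonneg _).trans hw)
    refine this.trans (le_of_eq (by ring))
  have e5 : 8 * (∑ i, |w i| * b i ^ 2) / N = 8 * ((∑ i, |w i| * b i ^ 2) / N) := by ring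
  rw [e5] at h2
  linarith


set_option maxHeartbeats 1600000 in
lemma det3 {N : ℕ} (hN : 0 < N) {x c : ℝ} (hx : 0 < x) (hx2 : x ≤ 1 / 2)
    (hc1 : c ≤ x + p.β ^ 2 * (1 - p.q) - p.β ^ 2 * p.Ew x)
    (hc2 : c ≤ x + p.β ^ 2 * (1 - p.q) + 2 * p.β ^ 2 * p.q - p.Hw x)
    (J : ℕ) (g : Fin N → ℕ → ℝ) (θ d ε : ℝ) (hd : 0 ≤ d) (hε : 0 ≤ ε)
    (h1 : ∀ s ≤ J + 1, ∀ t ≤ s, |inner ℝ ((√N)⁻¹ • col g s) (p.Ph t g)| ≤ d)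
    (h2 : ‖(√N)⁻¹ • vec (p.M (J + 1)) g - ∑ t ∈ Finset.range (J + 1), p.cf J t • p.Ph t g‖ ≤ θ)
    (h3 : ∀ a : ℕ → ℝ, ∑ s ∈ Finset.range (J + 2), a s ^ 2 = 1 → ∀ ρ,
      ρ = ∑ t ∈ Finset.range (J + 2), p.cf J t * a t →
      av (fun y => wx x (p.M (J + 1) y) * p.bfun J a ρ y ^ 2) ⟨N, g⟩
        ≤ ρ ^ 2 / p.q * p.Hw x + p.β ^ 2 * (1 - ρ ^ 2 / p.q) * p.Ew x + d ∧
      av (fun y => p.bfun J a ρ y ^ 4) ⟨N, g⟩ ≤ 8 * (p.β ^ 4 * C4 + 16 * p.β ^ 8) + d)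
    (u w : EE N) (hu : ‖u‖ = 1) (hv : ∀ i, |vec (p.M (J + 1)) g i + w i| < 1) (hw : ‖w‖ ^ 2 ≤ N * ε) :
    c - p.errT J θ d ε ≤ p.TT (J + 1) g u w - 2 * (p.β / √N) * ‖PK (fun s => p.Ph s g) (J + 1) u‖
      * inner ℝ (col g (J + 1)) (PK (fun s => p.Ph s g) (J + 1) u) := by
  have hN' : (0:ℝ) < N := by exact_mod_cast hN
  have hs : √(N:ℝ) ^ 2 = N := Real.sq_sqrt hN'.le
  have hsp : 0 < √(N:ℝ) := Real.sqrt_pos.2 hN'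
  have hφ := p.Ph_ON g
  have hq := p.q0
  set φ : ℕ → EE N := fun s => p.Ph s g with hφd
  set K := J + 1 with hK
  set m : EE N := vec (p.M K) g with hm
  obtain ⟨a, ha⟩ : ∃ a : ℕ → ℝ, a = fun s => if s < K then inner ℝ (φ s) u else ‖PK φ K u‖ := ⟨_, rfl⟩
  have haK : a K = ‖PK φ K u‖ := by rw [ha]; simp
  have has : ∀ s ∈ Finset.range K, a s = inner ℝ (φ s) u := by
    intro s hs; rw [ha]; simp [Finset.mem_range.1 hs]
  have ha1 : ∑ s ∈ Finset.range (J + 2), a s ^ 2 = 1 := by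
    rw [Finset.sum_range_succ, ← hK, haK, Finset.sum_congr rfl fun s hs => by rw [has s hs]]
    have := PK_norm_sq hφ K u
    rw [hu] at this; linarith
  obtain ⟨ρ, hρ⟩ : ∃ ρ, ρ = ∑ t ∈ Finset.range (J + 2), p.cf J t * a t := ⟨_, rfl⟩
  have hρq : ρ ^ 2 ≤ p.q := hρ ▸ p.pi_sq_le J a ha1
  obtain ⟨hA, hB⟩ := h3 a ha1 ρ hρ
  set D := ρ ^ 2 / p.q * p.Hw x + p.β ^ 2 * (1 - ρ ^ 2 / p.q) * p.Ew x + d with hD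
  set E := 8 * (p.β ^ 4 * C4 + 16 * p.β ^ 8) + d with hE
  have key := det2 hN hx hx2 m (fun i => p.bfun J a ρ (g i)) u w hu (fun i => p.M_abs_le K (g i)) hv ε hw D E hA hB
  -- inner product with b
  have hb : (√N)⁻¹ * ∑ i, u i * p.bfun J a ρ (g i)
      = p.β * (∑ s ∈ Finset.range K, inner ℝ (φ s) u * inner ℝ ((√N)⁻¹ • col g s) u
          + ‖PK φ K u‖ * inner ℝ ((√N)⁻¹ • col g K) u) + 2 * p.β ^ 2 * ρ * inner ℝ u ((√N)⁻¹ • m) := by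
    have e1 : ∀ s, inner ℝ ((√N)⁻¹ • col g s) u = (√N)⁻¹ * ∑ i, u i * g i s := by
      intro s
      rw [inner_smul_left, inner_EE]; simp [col, mul_comm]
    have e2 : inner ℝ u ((√N)⁻¹ • m) = (√N)⁻¹ * ∑ i, u i * p.M K (g i) := by
      rw [inner_smul_right, inner_EE]; rfl
    rw [e2]
    simp only [e1]
    have e3 : ∑ s ∈ Finset.range K, inner ℝ (φ s) u * ((√N)⁻¹ * ∑ i, u i * g i s) + ‖PK φ K u‖ * ((√N)⁻¹ * ∑ i, u i * g i K)
        = (√N)⁻¹ * ∑ i, u i * ∑ s ∈ Finset.range (J + 2), a s * g i s := by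
      rw [show J + 2 = K + 1 from rfl]
      simp only [Finset.mul_sum]
      rw [Finset.sum_comm, Finset.sum_comm (s := Finset.univ) (t := Finset.range (K + 1)), Finset.sum_range_succ, haK,
        Finset.sum_comm]
      congr 1
      · refine Finset.sum_congr rfl fun s hs => Finset.sum_congr rfl fun i _ => ?_
        rw [has s hs]; ring
      · exact Finset.sum_congr rfl fun i _ => by ring
    have e4 : ∑ i, u i * p.bfun J a ρ (g i) = p.β * (∑ i, u i * ∑ s ∈ Finset.range (J + 2), a s * g i s)
        + 2 * p.β ^ 2 * ρ * ∑ i, u i * p.M K (g i) := by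
      rw [Finset.mul_sum, Finset.mul_sum, ← Finset.sum_add_distrib]
      refine Finset.sum_congr rfl fun i _ => ?_
      rw [bfun]; ring
    rw [e3, e4]; ring
  have d1 := det1 φ hφ (fun s => (√N)⁻¹ • col g s) u hu K d h1 hd
  have e5 : p.β / √N * ∑ s ∈ Finset.range K, (2 * inner ℝ (φ s) u * inner ℝ (col g s) (PK φ s u)
        + (√2 - 2) * inner ℝ (φ s) (col g s) * inner ℝ (φ s) u ^ 2)
      + 2 * (p.β / √N) * ‖PK φ K u‖ * inner ℝ (col g K) (PK φ K u)
      = p.β * (∑ s ∈ Finset.range K, (2 * inner ℝ (φ s) u * inner ℝ ((√N)⁻¹ • col g s) (PK φ s u)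
        + (√2 - 2) * inner ℝ (φ s) ((√N)⁻¹ • col g s) * inner ℝ (φ s) u ^ 2)
      + 2 * ‖PK φ K u‖ * inner ℝ ((√N)⁻¹ • col g K) (PK φ K u)) := by
    rw [mul_add, Finset.mul_sum, Finset.mul_sum]
    congr 1
    · refine Finset.sum_congr rfl fun s _ => ?_
      rw [real_inner_smul_left, real_inner_smul_right]; ring
    · rw [real_inner_smul_left]; ring
  obtain ⟨r, hr⟩ : ∃ r, r = inner ℝ u ((√N)⁻¹ • m) := ⟨_, rfl⟩
  obtain ⟨y, hy⟩ : ∃ y, y = (√N)⁻¹ * inner ℝ u w := ⟨_, rfl⟩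
  have hmN : ‖m‖ ^ 2 ≤ N := by
    rw [norm_sq_EE]
    refine (Finset.sum_le_sum (g := fun _ => (1:ℝ)) fun i _ => ?_).trans (by simp)
    rw [← sq_abs]
    exact pow_le_one₀ (abs_nonneg _) (p.M_abs_le K (g i))
  have hr1 : |r| ≤ 1 := by
    rw [hr, inner_smul_right, abs_mul, abs_of_pos (inv_pos.2 hsp), inv_mul_le_iff₀ hsp, mul_one]
    refine (abs_real_inner_le_norm _ _).trans ?_
    rw [hu, one_mul]
    exact Real.le_sqrt_of_sq_le hmN
  have hy1 : |y| ≤ √ε := by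
    rw [hy, abs_mul, abs_of_pos (inv_pos.2 hsp), inv_mul_le_iff₀ hsp]
    refine (abs_real_inner_le_norm _ _).trans ?_
    rw [hu, one_mul, ← Real.sqrt_mul hN'.le]
    exact Real.le_sqrt_of_sq_le hw
  have e6 : 2 * p.β ^ 2 / N * inner ℝ u (m + w) ^ 2 = 2 * p.β ^ 2 * (r + y) ^ 2 := by
    rw [hr, hy, inner_smul_right, inner_add_right, ← mul_add, mul_pow, inv_pow, hs]
    field_simp
  have e7 : (r + y) ^ 2 ≤ r ^ 2 + (2 * √ε + ε) := by
    have a1 : r * y ≤ √ε := by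
      refine (le_abs_self _).trans ?_
      rw [abs_mul]
      have := mul_le_mul hr1 hy1 (abs_nonneg _) zero_le_one
      simpa using this
    have a2 : y ^ 2 ≤ ε := by
      rw [← sq_abs, ← Real.sq_sqrt hε]; exact pow_le_pow_left₀ (abs_nonneg _) hy1 2
    nlinarith
  have e8 : (r - ρ) ^ 2 ≤ θ ^ 2 := by
    have : r - ρ = inner ℝ u ((√N)⁻¹ • m - ∑ t ∈ Finset.range (J + 1), p.cf J t • p.Ph t g) := by
      rw [inner_sub_right, ← hr, hρ, inner_sum, Finset.sum_range_succ, cf, if_neg (by omega), if_neg (by omega), zero_mul, add_zero]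
      congr 1
      refine Finset.sum_congr rfl fun t ht => ?_
      rw [has t ht, inner_smul_right, real_inner_comm]
    rw [← sq_abs (r - ρ)]
    refine pow_le_pow_left₀ (abs_nonneg _) ?_ 2
    rw [this]
    refine (abs_real_inner_le_norm _ _).trans ?_
    rw [hu, one_mul]; exact h2
  have hβ := p.hβ
  have hfin : c ≤ x + p.β ^ 2 * (1 - p.q) + 2 * p.β ^ 2 * ρ ^ 2 - (D - d) := by
    obtain ⟨τ, hτ⟩ : ∃ τ, τ = ρ ^ 2 / p.q := ⟨_, rfl⟩
    have hτ1 : τ ≤ 1 := by rw [hτ, div_le_one hq]; exact hρq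
    have hτ0 : 0 ≤ τ := by rw [hτ]; positivity
    have hτq : ρ ^ 2 = τ * p.q := by rw [hτ]; field_simp
    rw [hD, ← hτ, hτq]
    nlinarith [mul_le_mul_of_nonneg_left hc2 hτ0, mul_le_mul_of_nonneg_left hc1 (sub_nonneg.2 hτ1)]
  have d2 := mul_le_mul_of_nonneg_left d1 hβ.le
  rw [← e5, mul_add, ← mul_assoc p.β 2, mul_comm p.β 2, mul_assoc 2 p.β] at d2
  rw [hb, ← hr] at key
  have hKc : ((K:ℕ):ℝ) + 1 = J + 2 := by rw [hK]; push_cast; ring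
  rw [hKc] at d2
  have e9 := mul_le_mul_of_nonneg_left e7 (by positivity : 0 ≤ 2 * p.β ^ 2)
  have e10 := mul_le_mul_of_nonneg_left e8 (by positivity : 0 ≤ 2 * p.β ^ 2)
  have e11 : 2 * (2 * p.β ^ 2 * ρ * r) - 2 * p.β ^ 2 * r ^ 2 = 2 * p.β ^ 2 * ρ ^ 2 - 2 * p.β ^ 2 * (r - ρ) ^ 2 := by ring
  rw [TT, errT, e6, ← hE]
  linarith

end Par

namespace Par
variable (p : Par)

lemma ev_h1 (K : ℕ) (d : ℝ) (hd : 0 < d) : ∀ᶠ e : FS in fullF,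
    ∀ s ≤ K, ∀ t ≤ s, |inner ℝ ((√e.1)⁻¹ • col e.2.1 s) (p.Ph t e.2.1)| ≤ d := by
  have h : ∀ᶠ e : FS in fullF, ∀ s ∈ Finset.range (K + 1), ∀ t ∈ Finset.range (s + 1),
      |inner ℝ (gg s e) (p.Ph t e.2.1)| ≤ d := by
    rw [Filter.eventually_all_finset]
    intro s hs
    rw [Filter.eventually_all_finset]
    intro t ht
    have h1 := p.gPh_tendsto s t
    rw [p.E_xF s t (by simpa [Nat.lt_succ_iff] using ht)] at h1
    have h2 := h1.abs
    rw [abs_zero] at h2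
    filter_upwards [h2.eventually (gt_mem_nhds hd)] with e he using he.le
  filter_upwards [h] with e he s hs t ht
  exact he s (by simpa [Nat.lt_succ_iff] using hs) t (by simpa [Nat.lt_succ_iff] using ht)

lemma gam_le_eta (J : ℕ) : |p.gam J| ≤ p.eta J := by
  have h1 := p.Sg_lt (J + 1)
  rw [p.Sg_succ] at h1
  rw [← abs_of_pos (p.etapos J)]
  refine sq_le_sq.1 ?_
  rw [p.etasq]; linarith

lemma eta_anti (J : ℕ) : p.eta (J + 1) ≤ p.eta J := by
  refine Real.sqrt_le_sqrt ?_
  rw [p.Sg_succ]; nlinarith [sq_nonneg (p.gam J)]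

lemma nvF_norm (J : ℕ) : Tendsto (fun e => ‖nv (p.F J) e‖) fullF (nhds 1) := by
  have h := p.FF_tendsto J J
  rw [if_pos rfl] at h
  have h2 := h.sqrt
  rw [Real.sqrt_one] at h2
  refine h2.congr fun e => ?_
  rw [real_inner_self_eq_norm_sq, Real.sqrt_sq (norm_nonneg _)]

lemma ev_h2 (J : ℕ) (d : ℝ) (hd : 0 < d) : ∀ᶠ e : FS in fullF,
    ‖(√e.1)⁻¹ • vec (p.M (J + 1)) e.2.1 - ∑ t ∈ Finset.range (J + 1), p.cf J t • p.Ph t e.2.1‖ ≤ 3 * p.eta J + d := by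
  have hb : Tendsto (fun e => ∑ t ∈ Finset.range (J + 1), |p.cf J t| * ‖p.Ph t e.2.1 - nv (p.F t) e‖
      + (|p.gam J - p.eta J| * ‖nv (p.F J) e‖ + p.eta (J + 1) * ‖nv (p.F (J + 1)) e‖)) fullF
      (nhds (∑ t ∈ Finset.range (J + 1), |p.cf J t| * 0 + (|p.gam J - p.eta J| * 1 + p.eta (J + 1) * 1))) := by
    refine (tendsto_finsetSum _ fun t _ => (p.Ph_app t).const_mul _).add
      (((p.nvF_norm J).const_mul _).add ((p.nvF_norm (J + 1)).const_mul _))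
  have hlt : ∑ t ∈ Finset.range (J + 1), |p.cf J t| * 0 + (|p.gam J - p.eta J| * 1 + p.eta (J + 1) * 1) < 3 * p.eta J + d := by
    have h1 := p.gam_le_eta J
    have h2 := p.eta_anti J
    have h3 := abs_sub (p.gam J) (p.eta J)
    rw [abs_of_pos (p.etapos J)] at h3
    simp only [mul_zero, Finset.sum_const_zero]
    linarith
  filter_upwards [hb.eventually (gt_mem_nhds hlt)] with e he
  refine le_trans ?_ he.le
  have e1 : (√e.1)⁻¹ • vec (p.M (J + 1)) e.2.1 - ∑ t ∈ Finset.range (J + 1), p.cf J t • p.Ph t e.2.1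
      = (∑ t ∈ Finset.range (J + 1), p.cf J t • (nv (p.F t) e - p.Ph t e.2.1))
        + ((p.gam J - p.eta J) • nv (p.F J) e + p.eta (J + 1) • nv (p.F (J + 1)) e) := by
    have h := p.nv_M (J + 1) e
    change nv (p.M (J + 1)) e - _ = _
    rw [h]
    simp only [smul_sub, Finset.sum_sub_distrib]
    have e2 : ∑ t ∈ Finset.range (J + 1), p.cf J t • nv (p.F t) e
        = ∑ t ∈ Finset.range (J + 1), p.gam t • nv (p.F t) e - (p.gam J - p.eta J) • nv (p.F J) e := by
      rw [Finset.sum_range_succ, Finset.sum_range_succ]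
      have : ∑ t ∈ Finset.range J, p.cf J t • nv (p.F t) e = ∑ t ∈ Finset.range J, p.gam t • nv (p.F t) e :=
        Finset.sum_congr rfl fun t ht => by rw [cf, if_pos (Finset.mem_range.1 ht)]
      rw [this, cf, if_neg (by omega), if_pos rfl, sub_smul]; abel
    rw [e2]; abel
  rw [e1]
  refine (norm_add_le _ _).trans (add_le_add ?_ ?_)
  · refine (norm_sum_le _ _).trans (Finset.sum_le_sum fun t _ => ?_)
    rw [norm_smul, Real.norm_eq_abs, norm_sub_rev]
  · refine (norm_add_le _ _).trans (le_of_eq ?_)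
    rw [norm_smul, norm_smul, Real.norm_eq_abs, Real.norm_eq_abs, abs_of_pos (p.etapos (J + 1))]

lemma bfun_eq (J : ℕ) (a : ℕ → ℝ) (ρ : ℝ) (y : ℕ → ℝ) :
    (∑ s : Fin (J + 3), (if (s:ℕ) < J + 2 then p.β * a s else 2 * p.β ^ 2 * ρ) *
      (if (s:ℕ) < J + 2 then y s else p.M (J + 1) y)) = p.bfun J a ρ y := by
  rw [Fin.sum_univ_eq_sum_range (fun s => (if s < J + 2 then p.β * a s else 2 * p.β ^ 2 * ρ) *
      (if s < J + 2 then y s else p.M (J + 1) y)) (J + 3), Finset.sum_range_succ, if_neg (by omega), if_neg (by omega),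
    bfun, Finset.mul_sum]
  congr 1
  refine Finset.sum_congr rfl fun s hs => ?_
  rw [if_pos (by simpa using hs), if_pos (by simpa using hs)]; ring

lemma ev_h3 {x : ℝ} (hx : 0 < x) (hx2 : x ≤ 1 / 2) (J : ℕ) (d : ℝ) (hd : 0 < d) : ∀ᶠ e in rowF,
    ∀ a : ℕ → ℝ, ∑ s ∈ Finset.range (J + 2), a s ^ 2 = 1 → ∀ ρ,
      ρ = ∑ t ∈ Finset.range (J + 2), p.cf J t * a t →
      av (fun y => wx x (p.M (J + 1) y) * p.bfun J a ρ y ^ 2) e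
        ≤ ρ ^ 2 / p.q * p.Hw x + p.β ^ 2 * (1 - ρ ^ 2 / p.q) * p.Ew x + d ∧
      av (fun y => p.bfun J a ρ y ^ 4) e ≤ 8 * (p.β ^ 4 * C4 + 16 * p.β ^ 8) + d := by
  have t1 : Tame (fun y => wx x (p.M (J + 1) y)) := by
    refine Tame.of_bdd ((measurable_wx x).comp (p.measurable_M _)) 2 fun y => ?_
    rw [abs_of_nonneg (wx_nonneg hx hx2 (p.M_abs_le _ y))]
    exact wx_le_two hx hx2 (p.M_abs_le _ y)
  have tf : ∀ s : Fin (J + 3), Tame (fun y : ℕ → ℝ => if (s:ℕ) < J + 2 then y s else p.M (J + 1) y) := by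
    intro s
    by_cases h : (s:ℕ) < J + 2
    · simp only [h, if_true]; exact Tame.coord _
    · simp only [h, if_false]; exact p.tame_M _
  have hβ := p.hβ
  filter_upwards [ulln 2 _ t1 _ tf (p.β + 2 * p.β ^ 2) d hd,
    ulln 4 _ (Tame.const 1) _ tf (p.β + 2 * p.β ^ 2) d hd] with e h1 h2 a ha ρ hρ
  have hρq : ρ ^ 2 ≤ p.q := hρ ▸ p.pi_sq_le J a ha
  have hρ1 : ρ ^ 2 ≤ 1 := hρq.trans p.hq.2.1.le
  have hbd : ∀ s : Fin (J + 3), |if (s:ℕ) < J + 2 then p.β * a s else 2 * p.β ^ 2 * ρ| ≤ p.β + 2 * p.β ^ 2 := by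
    intro s
    split_ifs with h
    · have : a s ^ 2 ≤ 1 := by
        rw [← ha]; exact Finset.single_le_sum (f := fun s => a s ^ 2) (fun _ _ => sq_nonneg _) (by simpa using h)
      have h3 : |a s| ≤ 1 := by rwa [← sq_le_one_iff_abs_le_one]
      rw [abs_mul, abs_of_pos hβ]; nlinarith [sq_nonneg p.β]
    · have h3 : |ρ| ≤ 1 := by rwa [← sq_le_one_iff_abs_le_one]
      rw [abs_mul, abs_of_pos (by positivity)]; nlinarith [sq_nonneg p.β]
  have g1 := h1 _ hbd
  have g2 := h2 _ hbd
  simp only [bfun_eq, one_mul] at g1 g2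
  have f1 := p.lim_formula hx hx2 J a ha ρ hρ
  have f2 := p.fourth J a ha ρ hρ1 (J + 1)
  constructor
  · have := (abs_le.1 g1).2
    change _ - ∫ y, wx x (p.M (J + 1) y) * (p.β * (∑ s ∈ Finset.range (J + 2), a s * y s)
        + 2 * p.β ^ 2 * ρ * p.M (J + 1) y) ^ 2 ∂(gI ℕ) ≤ _ at this
    rw [f1] at this
    linarith
  · have := (abs_le.1 g2).2
    change _ - ∫ y, (p.β * (∑ s ∈ Finset.range (J + 2), a s * y s)
        + 2 * p.β ^ 2 * ρ * p.M (J + 1) y) ^ 4 ∂(gI ℕ) ≤ _ at this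
    linarith

lemma rowF_of_fullF {P : (Σ N : ℕ, (Fin N → ℕ → ℝ)) → Prop} (h : ∀ᶠ e in fullF, P (toRow e)) : ∀ᶠ e in rowF, P e := by
  rw [rowF, eventually_whp]
  rw [fullF, eventually_whp] at h
  refine h.congr fun n => ?_
  have : {x : (Fin n → ℕ → ℝ) × (Fin n × Fin n → ℝ) | ¬P (toRow ⟨n, x⟩)} = {g : Fin n → ℕ → ℝ | ¬ P ⟨n, g⟩} ×ˢ Set.univ := by
    ext x; simp [toRow]
  rw [this, fullM, Measure.prod_prod]
  simp

/-- inequality (C) -/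
lemma ev_C {x c : ℝ} (hx : 0 < x) (hx2 : x ≤ 1 / 2)
    (hc1 : c ≤ x + p.β ^ 2 * (1 - p.q) - p.β ^ 2 * p.Ew x)
    (hc2 : c ≤ x + p.β ^ 2 * (1 - p.q) + 2 * p.β ^ 2 * p.q - p.Hw x)
    (J : ℕ) (ε c' : ℝ) (hε : 0 ≤ ε) (hc' : c' < c - p.errT J (3 * p.eta J) 0 ε) :
    ∀ᶠ e in rowF, ∀ u w : EE e.1, ‖u‖ = 1 → (∀ i, |vec (p.M (J + 1)) e.2 i + w i| < 1) → ‖w‖ ^ 2 ≤ e.1 * ε →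
      2 * (p.β / √e.1) * ‖PK (fun s => p.Ph s e.2) (J + 1) u‖
      * inner ℝ (col e.2 (J + 1)) (PK (fun s => p.Ph s e.2) (J + 1) u) ≤ p.TT (J + 1) e.2 u w - c' := by
  have hcont : ∀ᶠ d in nhdsWithin 0 (Set.Ioi 0), c' < c - p.errT J (3 * p.eta J + d) d ε := by
    have : Continuous (fun d => c - p.errT J (3 * p.eta J + d) d ε) := by unfold errT; fun_prop
    have h0 := this.tendsto 0
    simp only [add_zero] at h0
    exact (h0.mono_left nhdsWithin_le_nhds).eventually (lt_mem_nhds hc')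
  obtain ⟨d, hd1, hd⟩ := (hcont.and self_mem_nhdsWithin).exists
  have hd : 0 < d := hd
  refine rowF_of_fullF ?_
  filter_upwards [p.ev_h1 (J + 1) d hd, p.ev_h2 J d hd, toRow_tendsto.eventually (p.ev_h3 hx hx2 J d hd), N_pos]
    with e h1 h2 h3 h4 u w hu hv hw
  have := p.det3 h4 hx hx2 hc1 hc2 J e.2.1 (3 * p.eta J + d) d ε hd.le hε h1 h2 h3 u w hu hv hw
  change _ ≤ p.TT (J + 1) e.2.1 u w - c'
  change 2 * (p.β / √e.1) * ‖PK (fun s => p.Ph s e.2.1) (J + 1) u‖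
      * inner ℝ (col e.2.1 (J + 1)) (PK (fun s => p.Ph s e.2.1) (J + 1) u) ≤ _
  linarith

end Par

/-! ### Conditional comparison -/

lemma cond_slepian {N : ℕ} (K : ℕ) (X : ℕ → (Fin N → ℕ → ℝ) → EE N) (τ : ℕ → (Fin N → ℕ → ℝ) → ℝ)
    (Q : ℕ → (Fin N → ℕ → ℝ) → Prop) (hX : ∀ n, Measurable (X n)) (hτ : ∀ n, Measurable (τ n))
    (hQ : ∀ n, MeasurableSet {g | Q n g}) (hX1 : ∀ n g, ‖X n g‖ ≤ 1)
    (iX : ∀ n g z, X n (updc K g z) = X n g) (iτ : ∀ n g z, τ n (updc K g z) = τ n g)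
    (iQ : ∀ n g z, Q n (updc K g z) ↔ Q n g) (r δ : ℝ) (hδ : 0 < δ) :
    fullM N {e | ∃ n, Q n e.1 ∧ τ n e.1 + 2 * δ < r * qf (Xmat e.2) (X n e.1)}
      ≤ rowM N {g | ∃ n, Q n g ∧ τ n g < 2 * r * ‖X n g‖ * inner ℝ (col g K) (X n g)}
        + gm {ξ | δ < √2 * |r| * |ξ|} := by
  have hnorm : ∀ n g, √(∑ k, X n g k ^ 2) = ‖X n g‖ := fun n g => by
    rw [← norm_sq_EE, Real.sqrt_sq (norm_nonneg _)]
  have mc : ∀ n k, Measurable fun g => X n g k := fun n k => measurable_EE_apply (hX n) k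
  have m1 : MeasurableSet {e : (Fin N → ℕ → ℝ) × (Fin N × Fin N → ℝ) |
      ∃ n, Q n e.1 ∧ τ n e.1 + 2 * δ < r * qf (Xmat e.2) (X n e.1)} := by
    rw [Set.setOf_exists]
    refine MeasurableSet.iUnion fun n => ?_
    refine (measurable_fst (hQ n)).inter (measurableSet_lt (((hτ n).comp measurable_fst).add_const _) ?_)
    simp only [qf_Xmat]
    refine (Finset.measurable_fun_sum _ fun p _ => ?_).const_mul _
    exact ((((mc n p.1).comp measurable_fst).const_mul _).mul ((mc n p.2).comp measurable_fst)).mul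
      ((measurable_pi_apply p).comp measurable_snd)
  have m2 : MeasurableSet {g : (Fin N → ℕ → ℝ) | ∃ n, Q n g ∧ τ n g < 2 * r * ‖X n g‖ * inner ℝ (col g K) (X n g)} := by
    rw [Set.setOf_exists]
    refine MeasurableSet.iUnion fun n => ?_
    exact (hQ n).inter (measurableSet_lt (hτ n) (((hX n).norm.const_mul _).mul ((measurable_col K).inner (hX n))))
  rw [fullM, Measure.prod_apply m1]
  have e2 := congrArg (fun μ => μ {g : (Fin N → ℕ → ℝ) | ∃ n, Q n g ∧ τ n g < 2 * r * ‖X n g‖ * inner ℝ (col g K) (X n g)})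
    (col_update (N := N) K)
  beta_reduce at e2
  rw [← e2, Measure.map_apply (measurable_updc K) m2, Measure.prod_apply (measurable_updc K m2)]
  calc _ ≤ ∫⁻ g, (gI (Fin N) (Prod.mk g ⁻¹' ((fun p : (Fin N → ℕ → ℝ) × (Fin N → ℝ) => updc K p.1 p.2) ⁻¹'
            {g | ∃ n, Q n g ∧ τ n g < 2 * r * ‖X n g‖ * inner ℝ (col g K) (X n g)}))
          + gm {ξ | δ < √2 * |r| * |ξ|}) ∂(rowM N) := by
        refine lintegral_mono fun g => ?_
        refine (slepian_goe (fun n => WithLp.ofLp (X n g)) (fun n => Q n g)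
          (fun n => by rw [← norm_sq_EE]; have := hX1 n g; have := norm_nonneg (X n g); nlinarith)
          (fun n => τ n g) r δ hδ).trans (add_le_add_left (measure_mono fun z hz => ?_) _)
        obtain ⟨n, h1, h2⟩ := hz
        refine ⟨n, (iQ n g z).2 h1, ?_⟩
        rw [iτ, iX, col_updc_self, inner_EE]
        rw [hnorm] at h2
        exact h2
    _ = _ := by
        rw [lintegral_add_right _ measurable_const, lintegral_const, measure_univ, mul_one]

namespace Par
variable (p : Par)

lemma PK_cont {N : ℕ} (φ : ℕ → EE N) (K : ℕ) : Continuous (PK φ K) := by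
  unfold PK; fun_prop

lemma PK_meas {N : ℕ} (K : ℕ) (u : EE N) : Measurable fun g : Fin N → ℕ → ℝ => PK (fun s => p.Ph s g) K u := by
  unfold PK
  refine measurable_const.sub (Finset.measurable_fun_sum _ fun s _ => ?_)
  exact (Measurable.inner (𝕜 := ℝ) (p.measurable_Ph s) measurable_const).smul (p.measurable_Ph s)

lemma TT_meas {N : ℕ} (K : ℕ) (u w : EE N) : Measurable fun g : Fin N → ℕ → ℝ => p.TT K g u w := by
  unfold TT
  have hM : Measurable fun g : Fin N → ℕ → ℝ => vec (p.M K) g := measurable_vec (p.measurable_M K)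
  refine Measurable.sub (Measurable.sub (Measurable.add_const (Finset.measurable_fun_sum _ fun i _ => ?_) _)
    (Measurable.const_mul ((measurable_const.inner (hM.add_const w)).pow_const 2) _))
    (Measurable.const_mul (Finset.measurable_fun_sum _ fun s _ => ?_) _)
  · have := measurable_EE_apply hM i
    exact ((((this.add_const _).pow_const 2).const_sub 1).inv).const_mul _
  · have h := p.measurable_Ph s (N := N)
    exact (((h.inner measurable_const).const_mul 2).mul ((measurable_col s).inner (p.PK_meas s u))).add
      (((h.inner (measurable_col s)).const_mul _).mul ((h.inner measurable_const).pow_const 2))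

lemma updc_lt {N : ℕ} (K : ℕ) (g : Fin N → ℕ → ℝ) (z : Fin N → ℝ) (i : Fin N) (t : ℕ) (ht : t < K) :
    updc K g z i t = g i t := by
  simp [updc, Function.update_of_ne ht.ne]

lemma Ph_updc {N : ℕ} (K : ℕ) (g : Fin N → ℕ → ℝ) (z : Fin N → ℝ) (s : ℕ) (hs : s ≤ K) :
    p.Ph s (updc K g z) = p.Ph s g :=
  p.Ph_congr s _ _ fun i t ht => updc_lt K g z i t (ht.trans_le hs)

lemma PK_updc {N : ℕ} (K : ℕ) (g : Fin N → ℕ → ℝ) (z : Fin N → ℝ) (s : ℕ) (hs : s ≤ K) (u : EE N) :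
    PK (fun s => p.Ph s (updc K g z)) s u = PK (fun s => p.Ph s g) s u := by
  unfold PK
  congr 1
  refine Finset.sum_congr rfl fun t ht => ?_
  beta_reduce
  rw [p.Ph_updc K g z t ((Finset.mem_range.1 ht).le.trans hs)]

lemma vecM_updc {N : ℕ} (K : ℕ) (g : Fin N → ℕ → ℝ) (z : Fin N → ℝ) :
    vec (p.M K) (updc K g z) = vec (p.M K) g := by
  ext i
  exact p.M_congr K fun t ht => updc_lt K g z i t ht

lemma TT_updc {N : ℕ} (K : ℕ) (g : Fin N → ℕ → ℝ) (z : Fin N → ℝ) (u w : EE N) :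
    p.TT K (updc K g z) u w = p.TT K g u w := by
  unfold TT
  rw [vecM_updc]
  congr 2
  refine Finset.sum_congr rfl fun s hs => ?_
  have hs := Finset.mem_range.1 hs
  rw [p.Ph_updc K g z s hs.le, p.PK_updc K g z s hs.le, col_updc_ne K g z s hs.ne]

lemma PK_le {N : ℕ} (g : Fin N → ℕ → ℝ) (K : ℕ) (u : EE N) : ‖PK (fun s => p.Ph s g) K u‖ ≤ ‖u‖ := by
  have h := PK_norm_sq (p.Ph_ON g) K u
  have h2 : 0 ≤ ∑ s ∈ Finset.range K, inner ℝ (p.Ph s g) u ^ 2 := Finset.sum_nonneg fun s _ => sq_nonneg _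
  exact (sq_le_sq₀ (norm_nonneg _) (norm_nonneg _)).1 (by linarith)

lemma TT_cont {N : ℕ} (K : ℕ) (g : Fin N → ℕ → ℝ) :
    ContinuousOn (fun x : EE N × EE N => p.TT K g x.1 x.2) {x | ∀ i, |vec (p.M K) g i + x.2 i| < 1} := by
  unfold TT
  refine ContinuousOn.sub (ContinuousOn.sub (ContinuousOn.add ?_ continuousOn_const) ?_) ?_
  · refine continuousOn_finsetSum _ fun i _ => ContinuousOn.mul (by fun_prop) (ContinuousOn.inv₀ (by fun_prop) ?_)
    intro x hx
    have h := (sq_lt_one_iff_abs_lt_one _).2 (hx i)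
    exact (sub_pos.2 h).ne'
  · exact Continuous.continuousOn (by fun_prop)
  · refine Continuous.continuousOn ?_
    have : ∀ s, Continuous fun x : EE N × EE N => PK (fun s => p.Ph s g) s x.1 := fun s => (PK_cont _ s).comp continuous_fst
    refine continuous_const.mul (continuous_finsetSum _ fun s _ => ?_)
    have h2 := this s
    fun_prop

lemma dense_lift {N : ℕ} (K : ℕ) (g : Fin N → ℕ → ℝ) (A : Fin N → Fin N → ℝ) (r c ε : ℝ)
    (d : ℕ → Metric.sphere (0 : EE N) 1 × EE N) (hd : DenseRange d)
    (h : ∀ n, ((∀ i, |vec (p.M K) g i + (d n).2 i| < 1) ∧ ‖(d n).2‖ ^ 2 < ε) →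
      r * qf A (PK (fun s => p.Ph s g) K (d n).1) ≤ p.TT K g (d n).1 (d n).2 - c)
    (u w : EE N) (hu : ‖u‖ = 1) (h1 : ∀ i, |vec (p.M K) g i + w i| < 1) (h2 : ‖w‖ ^ 2 < ε) :
    r * qf A (PK (fun s => p.Ph s g) K u) ≤ p.TT K g u w - c := by
  by_contra hc
  rw [not_le] at hc
  set U : Set (EE N × EE N) := {x | ∀ i, |vec (p.M K) g i + x.2 i| < 1} ∩ {x | ‖x.2‖ ^ 2 < ε} with hU
  have hUo : IsOpen U := by
    refine IsOpen.inter ?_ (isOpen_lt (by fun_prop) (by fun_prop))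
    rw [Set.setOf_forall]
    exact isOpen_iInter_of_finite fun i => isOpen_lt (by fun_prop) (by fun_prop)
  have hf : ContinuousOn (fun x : EE N × EE N => r * qf A (PK (fun s => p.Ph s g) K x.1) - (p.TT K g x.1 x.2 - c)) U := by
    refine ContinuousOn.sub (Continuous.continuousOn ?_) (((p.TT_cont K g).mono Set.inter_subset_left).sub continuousOn_const)
    have : Continuous fun x : EE N × EE N => PK (fun s => p.Ph s g) K x.1 := (PK_cont _ K).comp continuous_fst
    simp only [qf]
    fun_prop
  have hV := hf.isOpen_inter_preimage hUo (isOpen_Ioi (a := (0:ℝ)))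
  have hι : Continuous fun x : Metric.sphere (0 : EE N) 1 × EE N => ((x.1 : EE N), x.2) := by fun_prop
  obtain ⟨n, hn⟩ := hd.exists_mem_open (hV.preimage hι) ⟨(⟨u, by simpa using hu⟩, w), ⟨h1, h2⟩, by
    simpa using hc⟩
  obtain ⟨⟨a1, a2⟩, a3⟩ := hn
  have := h n ⟨a1, a2⟩
  simp only [Set.mem_preimage, Set.mem_Ioi] at a3
  linarith

lemma ev_B0 {c1 c2 ε : ℝ} (hc : c2 < c1) (K : ℕ)
    (hC : ∀ᶠ e : (Σ N : ℕ, (Fin N → ℕ → ℝ)) in rowF, ∀ u w : EE e.1, ‖u‖ = 1 → (∀ i, |vec (p.M K) e.2 i + w i| < 1) →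
      ‖w‖ ^ 2 ≤ e.1 * ε →
      2 * (p.β / √e.1) * ‖PK (fun s => p.Ph s e.2) K u‖ * inner ℝ (col e.2 K) (PK (fun s => p.Ph s e.2) K u)
        ≤ p.TT K e.2 u w - c1) :
    ∀ᶠ e : FS in fullF, ∀ u w : EE e.1, ‖u‖ = 1 → (∀ i, |vec (p.M K) e.2.1 i + w i| < 1) →
      ‖w‖ ^ 2 < e.1 * ε →
      p.β / √e.1 * qf (Xmat e.2.2) (PK (fun s => p.Ph s e.2.1) K u) ≤ p.TT K e.2.1 u w - c2 := by
  rw [rowF, eventually_whp] at hC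
  rw [fullF, eventually_whp]
  have hl := hC.add (gm_small p.β ((c1 - c2) / 2) (by linarith))
  rw [add_zero] at hl
  refine tendsto_of_tendsto_of_tendsto_of_le_of_le' tendsto_const_nhds hl
    (Filter.Eventually.of_forall fun _ => zero_le) ?_
  filter_upwards [eventually_gt_atTop 0] with N hN
  have : Nonempty (Metric.sphere (0 : EE N) 1) :=
    ⟨⟨EuclideanSpace.single ⟨0, hN⟩ 1, by simp⟩⟩
  set d := TopologicalSpace.denseSeq (Metric.sphere (0 : EE N) 1 × EE N) with hdd
  have hd : DenseRange d := TopologicalSpace.denseRange_denseSeq _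
  have hs := cond_slepian (N := N) K (fun n g => PK (fun s => p.Ph s g) K (d n).1)
    (fun n g => p.TT K g (d n).1 (d n).2 - c1)
    (fun n g => (∀ i, |vec (p.M K) g i + (d n).2 i| < 1) ∧ ‖(d n).2‖ ^ 2 < N * ε)
    (fun n => p.PK_meas K _) (fun n => (p.TT_meas K _ _).sub_const _) (fun n => ?_)
    (fun n g => (p.PK_le g K _).trans (by simp)) (fun n g z => p.PK_updc K g z K le_rfl _)
    (fun n g z => by rw [p.TT_updc]) (fun n g z => by rw [p.vecM_updc]) (p.β / √N) ((c1 - c2) / 2) (by linarith)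
  · refine (measure_mono ?_).trans (hs.trans (add_le_add_left (measure_mono ?_) _))
    · intro e he
      by_contra hne
      apply he
      intro u w hu h1 h2
      refine p.dense_lift K e.1 (Xmat e.2) _ c2 _ d hd (fun n hn => ?_) u w hu h1 h2
      by_contra h3
      apply hne
      exact ⟨n, hn, by rw [not_le] at h3; linarith⟩
    · intro g hg hn
      obtain ⟨n, ⟨h1, h2⟩, h3⟩ := hg
      have := hn (d n).1 (d n).2 (by simp) h1 h2.le
      linarith
  · rw [Set.setOf_and, Set.setOf_forall]
    refine MeasurableSet.inter ?_ (MeasurableSet.const _)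
    refine MeasurableSet.iInter fun i => measurableSet_lt ?_ measurable_const
    exact ((measurable_EE_apply (measurable_vec (p.measurable_M K)) i).add_const _).abs

end Par

/-! ### The good event -/

lemma hess_expand {N : ℕ} (b q : ℝ) (G : Fin N → Fin N → ℝ) (u v : Fin N → ℝ) :
    dotp N u (mulVec N (fun i j =>
                  (if i = j then (1 - v i ^ 2)⁻¹ else 0)
                    + b ^ 2 * (1 - q) * (if i = j then 1 else 0)
                    - 2 * b ^ 2 / N * (v i * v j)
                    - b * G i j) u)
    = ∑ i, u i ^ 2 * (1 - v i ^ 2)⁻¹ + b ^ 2 * (1 - q) * ∑ i, u i ^ 2 - 2 * b ^ 2 / N * (∑ i, u i * v i) ^ 2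
      - b * qf G u := by
  have e1 : (∑ i, u i * v i) ^ 2 = ∑ i, ∑ j, (u i * v i) * (u j * v j) := by
    rw [pow_two, Finset.sum_mul_sum]
  rw [e1]
  simp only [dotp, mulVec, qf, Finset.mul_sum, ← Finset.sum_add_distrib, ← Finset.sum_sub_distrib]
  refine Finset.sum_congr rfl fun i _ => ?_
  have e2 : u i ^ 2 * (1 - v i ^ 2)⁻¹ + b ^ 2 * (1 - q) * u i ^ 2
      = ∑ j, u i * (((if i = j then (1 - v i ^ 2)⁻¹ else 0) + b ^ 2 * (1 - q) * (if i = j then 1 else 0)) * u j) := by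
    rw [Finset.sum_eq_single i]
    · simp; ring
    · intro j _ hj; simp [hj.symm]
    · simp
  rw [e2, ← Finset.sum_sub_distrib, ← Finset.sum_sub_distrib]
  refine Finset.sum_congr rfl fun j _ => ?_
  ring

namespace Par
variable (p : Par)

/-- The event of the theorem, as a property of the matrix `W`. -/
def Good (k : ℕ) (ε c' : ℝ) {N : ℕ} (W : Fin N → Fin N → ℝ) : Prop :=
  ∀ u v : Fin N → ℝ,
              (∑ i, u i ^ 2) = 1 →
              (∀ i, |v i| < 1) →
              (∑ i, (v i - mTAP N p.β p.h p.q W k i) ^ 2) ≤ N * ε →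
              c' ≤ dotp N u (mulVec N (fun i j =>
                  (if i = j then (1 - v i ^ 2)⁻¹ else 0)
                    + p.β ^ 2 * (1 - p.q) * (if i = j then 1 else 0)
                    - 2 * p.β ^ 2 / N * (v i * v j)
                    - p.β * symmG N W i j) u)

lemma Good_congr (k : ℕ) (ε c' : ℝ) {N : ℕ} (W W' : Fin N → Fin N → ℝ) (h : symmG N W = symmG N W') :
    p.Good k ε c' W ↔ p.Good k ε c' W' := by
  unfold Good
  rw [p.mTAP_congr W W' h k, h]

lemma qf_G0 (K : ℕ) (e : FS) (u : Fin e.1 → ℝ) :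
    qf (p.G0 K e) u = qf (p.XX K e) u / √e.1 - ∑ i, p.XX K e i i / √e.1 * u i ^ 2 := by
  simp only [qf, Finset.sum_div, ← Finset.sum_sub_distrib]
  refine Finset.sum_congr rfl fun i _ => ?_
  rw [← Finset.sum_div]
  have : p.XX K e i i / √e.1 * u i ^ 2 = ∑ j, if i = j then p.XX K e i j / √e.1 * u i * u j else 0 := by
    rw [Finset.sum_ite_eq]; simp; ring
  rw [this, Finset.sum_div, ← Finset.sum_sub_distrib]
  refine Finset.sum_congr rfl fun j _ => ?_
  unfold G0
  split_ifs <;> ring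

lemma ev_good {c1 c' ε : ℝ} (hc : c' < c1) (hε : 0 < ε) (K : ℕ)
    (hC : ∀ᶠ e : (Σ N : ℕ, (Fin N → ℕ → ℝ)) in rowF, ∀ u w : EE e.1, ‖u‖ = 1 → (∀ i, |vec (p.M K) e.2 i + w i| < 1) →
      ‖w‖ ^ 2 ≤ e.1 * (5 * ε) →
      2 * (p.β / √e.1) * ‖PK (fun s => p.Ph s e.2) K u‖ * inner ℝ (col e.2 K) (PK (fun s => p.Ph s e.2) K u)
        ≤ p.TT K e.2 u w - c1) :
    ∀ᶠ e : FS in fullF, p.Good (K + 1) ε c' (p.W0 K e) := by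
  set c2 := (c' + c1) / 2 with hc2
  have hβ := p.hβ
  filter_upwards [p.ev_B0 (c2 := c2) (by linarith) K hC, p.XX_diag K ((c2 - c') / p.β) (div_pos (by linarith) hβ),
    (p.main_app K K le_rfl).1.eventually (gt_mem_nhds (Real.sqrt_pos.2 hε)), N_pos] with e hB hdiag happ hN
  intro u v hu hv hm
  have hN' : (0:ℝ) < e.1 := by exact_mod_cast hN
  have hs : 0 < √(e.1:ℝ) := Real.sqrt_pos.2 hN'
  rw [p.mTAP_eq, Nat.add_sub_cancel] at hm
  set u' : EE e.1 := WithLp.toLp 2 u with hu'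
  set m := vec (p.M K) e.2.1 with hmd
  set w : EE e.1 := WithLp.toLp 2 v - m with hw
  have hvw : ∀ i, m i + w i = v i := fun i => by simp [hw]
  have hmw : m + w = WithLp.toLp 2 v := by simp [hw]
  have hu1 : ‖u'‖ = 1 := by
    have : ‖u'‖ ^ 2 = 1 := by rw [norm_sq_EE]; exact hu
    nlinarith [norm_nonneg u']
  have n1 : ‖WithLp.toLp 2 v - p.tmm (p.W0 K e) K‖ ≤ √e.1 * √ε := by
    rw [← Real.sqrt_mul hN'.le]
    apply Real.le_sqrt_of_sq_le
    rw [norm_sq_EE]; simpa using hm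
  have n2 : ‖p.tmm (p.W0 K e) K - m‖ ≤ √e.1 * √ε := by
    have : p.nm K K e - nv (p.M K) e = (√(e.1:ℝ))⁻¹ • (p.tmm (p.W0 K e) K - m) := by
      simp only [nm, nv, smul_sub, hmd]
    rw [this, norm_smul, norm_inv, Real.norm_of_nonneg hs.le, inv_mul_lt_iff₀ hs] at happ
    exact happ.le
  have n3 : ‖w‖ ^ 2 < e.1 * (5 * ε) := by
    have : ‖w‖ ≤ 2 * (√e.1 * √ε) := by
      have : w = (WithLp.toLp 2 v - p.tmm (p.W0 K e) K) + (p.tmm (p.W0 K e) K - m) := by rw [hw]; abel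
      rw [this]
      exact (norm_add_le _ _).trans (by linarith)
    calc ‖w‖ ^ 2 ≤ (2 * (√e.1 * √ε)) ^ 2 := by gcongr
      _ = 4 * (√e.1 ^ 2 * √ε ^ 2) := by ring
      _ = 4 * (e.1 * ε) := by rw [Real.sq_sqrt hN'.le, Real.sq_sqrt hε.le]
      _ < _ := by nlinarith [mul_pos hN' hε]
  have hb := hB u' w hu1 (fun i => by rw [hvw]; exact hv i) n3
  have hq := qf_Xh (p.Ph_ON e.2.1) (col e.2.1) K (Xmat e.2.2) u'
  change qf (p.XX K e) u = _ at hq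
  unfold TT at hb
  rw [← hmd, hmw] at hb
  simp only [hvw] at hb
  rw [inner_EE] at hb
  simp only [hu'] at hb
  rw [hess_expand, hu, p.symmG_W0, p.qf_G0]
  have hd : -(c2 - c') / p.β ≤ ∑ i, p.XX K e i i / √e.1 * u i ^ 2 := by
    calc -(c2 - c') / p.β = ∑ i, -(c2 - c') / p.β * u i ^ 2 := by rw [← Finset.mul_sum, hu, mul_one]
      _ ≤ _ := by
        refine Finset.sum_le_sum fun i _ => mul_le_mul_of_nonneg_right ?_ (sq_nonneg _)
        rw [le_div_iff₀ hs]
        have := (abs_le.1 (hdiag i)).1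
        rw [neg_div]; linarith
  have hd2 : -(c2 - c') ≤ p.β * ∑ i, p.XX K e i i / √e.1 * u i ^ 2 := by
    rw [div_le_iff₀ hβ] at hd; linarith
  have hq2 : p.β * (qf (p.XX K e) u / √e.1) = p.β / √e.1 * qf (Xmat e.2.2) (PK (fun s => p.Ph s e.2.1) K u')
    + p.β / √e.1 * ∑ s ∈ Finset.range K, (2 * inner ℝ (p.Ph s e.2.1) u' * inner ℝ (col e.2.1 s) (PK (fun s => p.Ph s e.2.1) s u')
        + (√2 - 2) * inner ℝ (p.Ph s e.2.1) (col e.2.1 s) * inner ℝ (p.Ph s e.2.1) u' ^ 2) := by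
    rw [hq]; ring
  simp only [hu'] at hq2
  rw [mul_sub p.β (_ / _), hq2]
  linarith

/-- the choice of constants -/
lemma exists_const : ∃ c : ℝ, 0 < c ∧ ∀ c' : ℝ, c' < c → ∃ ε₀ : ℝ, 0 < ε₀ ∧
      ∀ ε : ℝ, 0 < ε → ε ≤ ε₀ → ∃ k₀ : ℕ, ∀ k, k₀ ≤ k → ∃ K, k = K + 1 ∧
        ∀ᶠ e : FS in fullF, p.Good k ε c' (p.W0 K e) := by
  obtain ⟨x, c, hx, hx2, hc, hc1, hc2⟩ := p.exists_xc
  refine ⟨c, hc, fun c' hc' => ?_⟩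
  set f : ℝ → ℝ := fun ε => 2 * p.β ^ 2 * (2 * √(5 * ε) + (5 * ε)) + 8 * √((5 * ε) * (8 * (p.β ^ 4 * C4 + 16 * p.β ^ 8) + 0)) with hf
  have hfc : Continuous f := by rw [hf]; fun_prop
  have hf0 : f 0 = 0 := by simp [hf]
  have h1 : ∀ᶠ ε in nhds (0:ℝ), f ε < (c - c') / 2 := by
    refine hfc.continuousAt.eventually (gt_mem_nhds ?_)
    rw [hf0]; linarith
  obtain ⟨ε₁, hε₁, h1⟩ := Metric.eventually_nhds_iff.1 h1
  refine ⟨ε₁ / 2, by positivity, fun ε hε hεe => ?_⟩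
  have h2 := h1 (y := ε) (by rw [Real.dist_eq, sub_zero, abs_of_pos hε]; linarith)
  have h3 : Tendsto (fun J => 2 * p.β ^ 2 * (3 * p.eta J) ^ 2) atTop (nhds 0) := by
    have := ((p.eta_tendsto.const_mul 3).pow 2).const_mul (2 * p.β ^ 2)
    simpa using this
  obtain ⟨J₀, hJ⟩ := eventually_atTop.1 (h3.eventually (gt_mem_nhds (show 0 < (c - c') / 4 by linarith)))
  refine ⟨J₀ + 2, fun k hk => ⟨k - 2 + 1, by omega, ?_⟩⟩
  have h4 := hJ (k - 2) (by omega)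
  have hlt : (c' + (c - c') / 8) < c - p.errT (k - 2) (3 * p.eta (k - 2)) 0 (5 * ε) := by
    simp only [hf] at h2
    unfold errT
    linarith
  have := p.ev_good (c1 := c' + (c - c') / 8) (c' := c') (by linarith) hε (k - 2 + 1)
    (p.ev_C hx hx2 hc1 hc2 (k - 2) (5 * ε) _ (by positivity) hlt)
  rwa [show k - 2 + 1 + 1 = k by omega] at this

end Par

/-! ### Transfer to the law of `W` -/

lemma measurable_mulVec {N : ℕ} {A : (Fin N → Fin N → ℝ) → Fin N → Fin N → ℝ} {u : (Fin N → Fin N → ℝ) → Fin N → ℝ}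
    (hA : ∀ i j, Measurable fun W => A W i j) (hu : ∀ i, Measurable fun W => u W i) (i : Fin N) :
    Measurable fun W => mulVec N (A W) (u W) i := by
  unfold mulVec
  exact Finset.measurable_fun_sum _ fun j _ => (hA i j).mul (hu j)

lemma measurable_dotp {N : ℕ} {u v : (Fin N → Fin N → ℝ) → Fin N → ℝ}
    (hu : ∀ i, Measurable fun W => u W i) (hv : ∀ i, Measurable fun W => v W i) :
    Measurable fun W => dotp N (u W) (v W) := by
  unfold dotp
  exact Finset.measurable_fun_sum _ fun j _ => (hu j).mul (hv j)

lemma measurable_symmG {N : ℕ} {A : (Fin N → Fin N → ℝ) → Fin N → Fin N → ℝ}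
    (hA : ∀ i j, Measurable fun W => A W i j) (i j : Fin N) : Measurable fun W => symmG N (A W) i j := by
  unfold symmG
  exact ((hA i j).add (hA j i)).div_const _

lemma measurable_tapState {N : ℕ} (b h q : ℝ) (k : ℕ) :
    (∀ i j, Measurable fun W : Fin N → Fin N → ℝ => (tapState N b h q W k).W i j) ∧
    (∀ s i, Measurable fun W : Fin N → Fin N → ℝ => (tapState N b h q W k).phi s i) ∧
    (∀ s i, Measurable fun W : Fin N → Fin N → ℝ => (tapState N b h q W k).zeta s i) ∧
    (∀ i, Measurable fun W : Fin N → Fin N → ℝ => (tapState N b h q W k).m i) := by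
  induction k with
  | zero =>
    have hid : ∀ i j, Measurable fun W : Fin N → Fin N → ℝ => W i j := fun i j => by fun_prop
    refine ⟨fun i j => ?_, fun s i => ?_, fun s i => ?_, fun i => ?_⟩
    · exact hid i j
    · exact measurable_const
    · by_cases hs : s = 1
      · have e : ∀ W : Fin N → Fin N → ℝ, (tapState N b h q W 0).zeta s i
          = mulVec N (symmG N W) (fun i => Real.sqrt N * (Real.sqrt N)⁻¹) i := fun W => by
          simp [tapState, tapInit, hs]
        simp only [e]
        exact measurable_mulVec (A := fun W => symmG N W) (u := fun _ _ => √N * (√N)⁻¹)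
          (measurable_symmG hid) (fun _ => measurable_const) i
      · have e : ∀ W : Fin N → Fin N → ℝ, (tapState N b h q W 0).zeta s i = 0 := fun W => by
          simp [tapState, tapInit, hs]
        simp only [e]
        exact measurable_const
    · exact measurable_const
  | succ k ih =>
    obtain ⟨hW, hφ, hζ, hm⟩ := ih
    have m1 : ∀ i, Measurable fun W : Fin N → Fin N → ℝ => (tapState N b h q W (k + 1)).m i := fun i => by
      have : Measurable fun W : Fin N → Fin N → ℝ => (∑ s ∈ Finset.Icc 1 (k + 1 - 1), gammaSeq b h q s * (tapState N b h q W k).zeta s i)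
          + Real.sqrt (q - GammaSq b h q (k + 1 - 1)) * (tapState N b h q W k).zeta (k + 1) i :=
        (Finset.measurable_fun_sum _ fun s _ => (hζ s i).const_mul _).add ((hζ _ i).const_mul _)
      exact measurable_tanh.comp (measurable_const.add (this.const_mul b))
    have m2 : ∀ i, Measurable fun W : Fin N → Fin N → ℝ => (tapState N b h q W (k + 1)).m i
        - ∑ s ∈ Finset.Icc 1 (k + 1), dotp N (tapState N b h q W (k + 1)).m ((tapState N b h q W k).phi s)
          * (tapState N b h q W k).phi s i := fun i =>
      (m1 i).sub (Finset.measurable_fun_sum _ fun s _ => (measurable_dotp (u := fun W => (tapState N b h q W (k + 1)).m)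
        (v := fun W => (tapState N b h q W k).phi s) m1 (hφ s)).mul (hφ s i))
    have m3 : ∀ i, Measurable fun W : Fin N → Fin N → ℝ => (tapState N b h q W (k + 1)).phi (k + 2) i := fun i => by
      have := (m2 i).div (Real.continuous_sqrt.measurable.comp (measurable_dotp m2 m2))
      have e : ∀ W : Fin N → Fin N → ℝ, (tapState N b h q W (k + 1)).phi (k + 2) i
          = ((tapState N b h q W (k + 1)).m i
            - ∑ s ∈ Finset.Icc 1 (k + 1), dotp N (tapState N b h q W (k + 1)).m ((tapState N b h q W k).phi s)
              * (tapState N b h q W k).phi s i) / √(dotp N (fun i => (tapState N b h q W (k + 1)).m i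
            - ∑ s ∈ Finset.Icc 1 (k + 1), dotp N (tapState N b h q W (k + 1)).m ((tapState N b h q W k).phi s)
              * (tapState N b h q W k).phi s i) (fun i => (tapState N b h q W (k + 1)).m i
            - ∑ s ∈ Finset.Icc 1 (k + 1), dotp N (tapState N b h q W (k + 1)).m ((tapState N b h q W k).phi s)
              * (tapState N b h q W k).phi s i)) := fun W => by
        simp [tapState, tapStep]
      simp only [e]
      exact this
    have m4 : ∀ i j, Measurable fun W : Fin N → Fin N → ℝ => (tapState N b h q W (k + 1)).W i j := fun i j => by
      have a1 := fun i => measurable_mulVec (A := fun W => (tapState N b h q W k).W) hW (hφ (k + 1)) i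
      have a2 := fun i => measurable_mulVec (A := fun W i j => (tapState N b h q W k).W j i) (fun i j => hW j i) (hφ (k + 1)) i
      have a3 := measurable_dotp a1 (hφ (k + 1))
      exact (hW i j).sub ((((a1 i).mul (hφ (k + 1) j)).add ((hφ (k + 1) i).mul (a2 j))).sub
        ((a3.mul (hφ (k + 1) i)).mul (hφ (k + 1) j)))
    refine ⟨m4, fun s i => ?_, fun s i => ?_, m1⟩
    · by_cases hs : s = k + 2
      · subst hs; exact m3 i
      · have e : ∀ W : Fin N → Fin N → ℝ, (tapState N b h q W (k + 1)).phi s i = (tapState N b h q W k).phi s i := fun W => by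
          have : s ≠ k + 1 + 1 := hs
          simp [tapState, tapStep, Function.update_of_ne this]
        simp only [e]; exact hφ s i
    · by_cases hs : s = k + 2
      · have e : ∀ W : Fin N → Fin N → ℝ, (tapState N b h q W (k + 1)).zeta s i
          = mulVec N (symmG N (tapState N b h q W (k + 1)).W) (fun i => √N * (tapState N b h q W (k + 1)).phi (k + 2) i) i := fun W => by
          subst hs
          simp [tapState, tapStep]
        simp only [e]
        exact measurable_mulVec (A := fun W => symmG N (tapState N b h q W (k + 1)).W)
          (u := fun W i => √N * (tapState N b h q W (k + 1)).phi (k + 2) i)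
          (measurable_symmG m4) (fun i => (m3 i).const_mul _) i
      · have e : ∀ W : Fin N → Fin N → ℝ, (tapState N b h q W (k + 1)).zeta s i = (tapState N b h q W k).zeta s i := fun W => by
          have : s ≠ k + 1 + 1 := hs
          simp [tapState, tapStep, Function.update_of_ne this]
        simp only [e]; exact hζ s i

/-- off-diagonal embedding -/
def offd {N : ℕ} (w : {p : Fin N × Fin N // p.1 ≠ p.2} → ℝ) : Fin N → Fin N → ℝ :=
  fun i j => if hij : i ≠ j then w ⟨(i, j), hij⟩ else 0

lemma measurable_offd {N : ℕ} : Measurable (offd (N := N)) := by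
  refine measurable_pi_lambda _ fun i => measurable_pi_lambda _ fun j => ?_
  unfold offd
  split_ifs
  · exact measurable_pi_apply _
  · exact measurable_const

lemma law_W {N : ℕ} {Ω : Type} [MeasurableSpace Ω] (P : Measure Ω) [IsProbabilityMeasure P]
    (W : Ω → Fin N → Fin N → ℝ) (hW : IsWGauss N P W) (B : Set (Fin N → Fin N → ℝ)) (hB : MeasurableSet B) :
    P {ω | W ω ∈ B} = gI (Fin N × Fin N) {Y | (fun i j => if i = j then 0 else Y (i, j) / √N) ∈ B} := by
  obtain ⟨h0, hi, hg⟩ := hW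
  have hae : ∀ s : {p : Fin N × Fin N // p.1 ≠ p.2}, AEMeasurable (fun ω => W ω s.1.1 s.1.2) P := fun s => by
    apply AEMeasurable.of_map_ne_zero
    rw [hg s]
    exact IsProbabilityMeasure.ne_zero _
  have l1 := hi.map_fun_eq_pi_map hae
  simp only [hg] at l1
  have hi2 : iIndepFun (fun (s : Fin N × Fin N) (Y : Fin N × Fin N → ℝ) => Y s / √N) (gI (Fin N × Fin N)) := by
    rw [gI_fin_eq]
    exact iIndepFun_pi (X := fun _ x => x / √N) fun i => by fun_prop
  have hi3 := hi2.precomp (g := fun s : {p : Fin N × Fin N // p.1 ≠ p.2} => s.1) Subtype.val_injective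
  have l2 := hi3.map_fun_eq_pi_map fun s =>
    (Measurable.div_const (measurable_pi_apply s.1) _).aemeasurable
  have hg2 : ∀ s : Fin N × Fin N, Measure.map (fun Y : Fin N × Fin N → ℝ => Y s / √N) (gI (Fin N × Fin N))
      = gaussianReal 0 (N : NNReal)⁻¹ := fun s => by
    have e := Measure.infinitePi_map_eval (fun _ : Fin N × Fin N => gm) s
    have e2 : gm.map (fun x => x / √(N:ℝ)) = _ := gaussianReal_map_div_const (μ := 0) (v := 1) (√(N:ℝ))
    rw [← e, Measure.map_map (by fun_prop) (by fun_prop)] at e2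
    refine Eq.trans e2 ?_
    congr 1
    · simp
    · ext; simp
  simp only [hg2] at l2
  have s1 : {ω | W ω ∈ B} = (fun ω (s : {p : Fin N × Fin N // p.1 ≠ p.2}) => W ω s.1.1 s.1.2) ⁻¹' (offd ⁻¹' B) := by
    ext ω
    have : W ω = offd (fun s : {p : Fin N × Fin N // p.1 ≠ p.2} => W ω s.1.1 s.1.2) := by
      funext i j
      unfold offd
      split_ifs with hij
      · rfl
      · rw [not_not] at hij; rw [hij]; exact h0 ω j
    simp only [Set.mem_preimage, Set.mem_setOf_eq, ← this]
  have s2 : {Y : Fin N × Fin N → ℝ | (fun i j => if i = j then 0 else Y (i, j) / √N) ∈ B}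
      = (fun (Y : Fin N × Fin N → ℝ) (s : {p : Fin N × Fin N // p.1 ≠ p.2}) => Y s.1 / √N) ⁻¹' (offd ⁻¹' B) := by
    ext Y
    have : (fun i j => if i = j then 0 else Y (i, j) / √N) = offd (fun s : {p : Fin N × Fin N // p.1 ≠ p.2} => Y s.1 / √N) := by
      funext i j
      unfold offd
      by_cases hij : i = j <;> simp [hij]
    simp only [Set.mem_preimage, Set.mem_setOf_eq, ← this]
  rw [s1, s2, ← Measure.map_apply_of_aemeasurable (aemeasurable_pi_lambda _ hae) (measurable_offd hB), l1,
    ← Measure.map_apply (by fun_prop) (measurable_offd hB), l2]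

namespace Par
variable (p : Par)

/-- rescaled off-diagonal part -/
def Dm {N : ℕ} (A : Fin N → Fin N → ℝ) : Fin N → Fin N → ℝ := fun i j => (if i = j then 0 else A i j / √N) / √2

lemma measurable_Dm {N : ℕ} : Measurable (Dm (N := N)) := by
  refine measurable_pi_lambda _ fun i => measurable_pi_lambda _ fun j => ?_
  unfold Dm
  split_ifs
  · exact measurable_const
  · fun_prop

lemma law_W0 (K N : ℕ) (B : Set (Fin N → Fin N → ℝ)) (hB : MeasurableSet B)
    (hsym : ∀ W W', symmG N W = symmG N W' → (W ∈ B ↔ W' ∈ B)) :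
    fullM N {x | p.W0 K ⟨N, x⟩ ∈ B} = gI (Fin N × Fin N) {Y | (fun i j => if i = j then 0 else Y (i, j) / √N) ∈ B} := by
  have hl := law_Xh (N := N) (fun s g => p.Ph s g) (fun s => p.measurable_Ph s)
    (fun s g g' => p.Ph_congr s g g') (fun s g => (p.Ph_ON g).z1 s) K
  have mX : Measurable (fun e : (Fin N → ℕ → ℝ) × (Fin N × Fin N → ℝ) =>
      Xh (fun s => p.Ph s e.1) (col e.1) K (Xmat e.2)) :=
    measurable_Xh (φ := fun s (e : (Fin N → ℕ → ℝ) × (Fin N × Fin N → ℝ)) => p.Ph s e.1)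
      (c := fun s (e : (Fin N → ℕ → ℝ) × (Fin N × Fin N → ℝ)) => col e.1 s)
      (fun s => (p.measurable_Ph s).comp measurable_fst) (fun s => (measurable_col s).comp measurable_fst)
      K (measurable_Xmat.comp measurable_snd)
  have h := congrArg (fun μ => μ (Dm ⁻¹' B)) hl
  beta_reduce at h
  rw [Measure.map_apply mX (measurable_Dm hB), Measure.map_apply measurable_Xmat (measurable_Dm hB)] at h
  refine Eq.trans ?_ (h.trans ?_)
  · rfl
  · congr 1
    ext Y
    refine hsym _ _ ?_
    have h2 : √2 * √2 = (2:ℝ) := Real.mul_self_sqrt (by norm_num)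
    have h0 : √2 ≠ (0:ℝ) := by positivity
    funext i j
    unfold symmG Dm Xmat
    by_cases hij : i = j
    · simp [hij]
    · simp only [hij, Ne.symm hij, if_false]
      have : (Y (i, j) + Y (j, i)) / √2 / √N / √2 + (Y (j, i) + Y (i, j)) / √2 / √N / √2
          = (Y (i, j) + Y (j, i)) * 2 / (√2 * √2) / √N := by
        field_simp; ring
      rw [this, h2]; ring

/-- the violation event along a sequence of pairs `(u, v)` -/
def BadD (k : ℕ) (ε c' : ℝ) {N : ℕ} (d : ℕ → (Fin N → ℝ) × (Fin N → ℝ)) : Set (Fin N → Fin N → ℝ) :=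
  {W | ∃ n, (∀ i, |(d n).2 i| < 1) ∧ (∑ i, ((d n).2 i - mTAP N p.β p.h p.q W k i) ^ 2) < N * ε ∧
    ∑ i, (d n).1 i ^ 2 * (1 - (d n).2 i ^ 2)⁻¹ + p.β ^ 2 * (1 - p.q) * ∑ i, (d n).1 i ^ 2
      - 2 * p.β ^ 2 / N * (∑ i, (d n).1 i * (d n).2 i) ^ 2
      - p.β * qf (symmG N W) (d n).1 < c'}

lemma measurable_BadD (k : ℕ) (ε c' : ℝ) {N : ℕ} (d : ℕ → (Fin N → ℝ) × (Fin N → ℝ)) :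
    MeasurableSet (p.BadD k ε c' d) := by
  unfold BadD
  rw [Set.setOf_exists]
  refine MeasurableSet.iUnion fun n => ?_
  rw [Set.setOf_and, Set.setOf_and]
  refine (MeasurableSet.const _).inter ((measurableSet_lt ?_ measurable_const).inter (measurableSet_lt ?_ measurable_const))
  · refine Finset.measurable_fun_sum _ fun i _ => ?_
    exact (measurable_const.sub ((measurable_tapState p.β p.h p.q (k - 1)).2.2.2 i)).pow_const 2
  · refine measurable_const.sub (Measurable.const_mul ?_ _)
    unfold qf
    refine Finset.measurable_fun_sum _ fun i _ => Finset.measurable_fun_sum _ fun j _ => ?_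
    exact ((measurable_symmG (A := fun W => W) (fun i j => by fun_prop) i j).mul_const _).mul_const _

lemma BadD_congr (k : ℕ) (ε c' : ℝ) {N : ℕ} (d : ℕ → (Fin N → ℝ) × (Fin N → ℝ)) (W W' : Fin N → Fin N → ℝ)
    (h : symmG N W = symmG N W') : W ∈ p.BadD k ε c' d ↔ W' ∈ p.BadD k ε c' d := by
  unfold BadD
  simp only [Set.mem_setOf_eq]
  rw [p.mTAP_congr W W' h k, h]

lemma BadD_of_not_Good (k : ℕ) {ε ε' c' : ℝ} {N : ℕ} (hN : 0 < N) (hε : ε < ε')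
    (d : ℕ → {x : (Fin N → ℝ) × (Fin N → ℝ) // ∑ i, x.1 i ^ 2 = 1}) (hd : DenseRange d)
    (W : Fin N → Fin N → ℝ) (h : ¬ p.Good k ε c' W) : W ∈ p.BadD k ε' c' (fun n => (d n).1) := by
  unfold Good at h
  push Not at h
  obtain ⟨u, v, hu, hv, hm, hc⟩ := h
  rw [hess_expand] at hc
  have hN' : (0:ℝ) < N := by exact_mod_cast hN
  have hm' : (∑ i, (v i - mTAP N p.β p.h p.q W k i) ^ 2) < N * ε' := hm.trans_lt (by nlinarith)
  set U : Set ((Fin N → ℝ) × (Fin N → ℝ)) := {x | ∀ i, |x.2 i| < 1}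
    ∩ {x | (∑ i, (x.2 i - mTAP N p.β p.h p.q W k i) ^ 2) < N * ε'} with hU
  have hUo : IsOpen U := by
    refine IsOpen.inter ?_ (isOpen_lt (by fun_prop) (by fun_prop))
    rw [Set.setOf_forall]
    exact isOpen_iInter_of_finite fun i => isOpen_lt (by fun_prop) (by fun_prop)
  have hf : ContinuousOn (fun x : (Fin N → ℝ) × (Fin N → ℝ) =>
      ∑ i, x.1 i ^ 2 * (1 - x.2 i ^ 2)⁻¹ + p.β ^ 2 * (1 - p.q) * ∑ i, x.1 i ^ 2
      - 2 * p.β ^ 2 / N * (∑ i, x.1 i * x.2 i) ^ 2 - p.β * qf (symmG N W) x.1) U := by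
    refine ContinuousOn.sub (ContinuousOn.sub (ContinuousOn.add ?_ ?_) ?_) ?_
    · refine continuousOn_finsetSum _ fun i _ => ContinuousOn.mul (by fun_prop) (ContinuousOn.inv₀ (by fun_prop) ?_)
      intro x hx
      have h := (sq_lt_one_iff_abs_lt_one _).2 (hx.1 i)
      exact (sub_pos.2 h).ne'
    · exact Continuous.continuousOn (by fun_prop)
    · exact Continuous.continuousOn (by fun_prop)
    · simp only [qf]; exact Continuous.continuousOn (by fun_prop)
  have hV := hf.isOpen_inter_preimage hUo (isOpen_Iio (a := c'))
  obtain ⟨n, ⟨⟨a1, a2⟩, a3⟩⟩ := hd.exists_mem_open (hV.preimage continuous_subtype_val) ⟨⟨(u, v), hu⟩, ⟨hv, hm'⟩, hc⟩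
  exact ⟨n, a1, a2, a3⟩

lemma not_Good_of_BadD (k : ℕ) {ε' c' : ℝ} {N : ℕ}
    (d : ℕ → {x : (Fin N → ℝ) × (Fin N → ℝ) // ∑ i, x.1 i ^ 2 = 1})
    (W : Fin N → Fin N → ℝ) (h : W ∈ p.BadD k ε' c' (fun n => (d n).1)) : ¬ p.Good k ε' c' W := by
  intro hg
  obtain ⟨n, h1, h2, h3⟩ := h
  have := hg (d n).1.1 (d n).1.2 (d n).2 h1 h2.le
  rw [hess_expand] at this
  linarith

lemma final_tendsto (k K : ℕ) {ε c' : ℝ} (hε : 0 < ε)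
    (Ω : ℕ → Type) [∀ N, MeasurableSpace (Ω N)] (P : ∀ N, Measure (Ω N))
    (hP : ∀ N, IsProbabilityMeasure (P N))
    (W : ∀ N, Ω N → Fin N → Fin N → ℝ) (hW : ∀ N, IsWGauss N (P N) (W N))
    (h : ∀ᶠ e : FS in fullF, p.Good k (2 * ε) c' (p.W0 K e)) :
    Tendsto (fun N => ((P N) {ω | p.Good k ε c' (W N ω)}).toReal) atTop (nhds 1) := by
  rw [fullF, eventually_whp] at h
  have h0 : Tendsto (fun N => P N {ω | ¬ p.Good k ε c' (W N ω)}) atTop (nhds 0) := by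
    refine tendsto_of_tendsto_of_tendsto_of_le_of_le' tendsto_const_nhds h
      (Filter.Eventually.of_forall fun _ => zero_le) ?_
    filter_upwards [eventually_gt_atTop 0] with N hN
    have : Nonempty {x : (Fin N → ℝ) × (Fin N → ℝ) // ∑ i, x.1 i ^ 2 = 1} :=
      ⟨⟨(Pi.single ⟨0, hN⟩ 1, 0), by
        rw [Finset.sum_eq_single ⟨0, hN⟩]
        · simp
        · intro j _ hj; simp [hj]
        · simp⟩⟩
    set d := TopologicalSpace.denseSeq {x : (Fin N → ℝ) × (Fin N → ℝ) // ∑ i, x.1 i ^ 2 = 1} with hdd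
    have hd : DenseRange d := TopologicalSpace.denseRange_denseSeq _
    have := hP N
    calc P N {ω | ¬ p.Good k ε c' (W N ω)} ≤ P N {ω | W N ω ∈ p.BadD k (2 * ε) c' (fun n => (d n).1)} :=
          measure_mono fun ω hω => p.BadD_of_not_Good k hN (by linarith) d hd _ hω
      _ = fullM N {x | p.W0 K ⟨N, x⟩ ∈ p.BadD k (2 * ε) c' (fun n => (d n).1)} := by
          rw [law_W (P N) (W N) (hW N) _ (p.measurable_BadD _ _ _ _),
            p.law_W0 K N _ (p.measurable_BadD _ _ _ _) (p.BadD_congr _ _ _ _)]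
      _ ≤ _ := measure_mono fun x hx => p.not_Good_of_BadD k d _ hx
  have h1 : Tendsto (fun N => (P N {ω | ¬ p.Good k ε c' (W N ω)}).toReal) atTop (nhds 0) := by
    have := (ENNReal.tendsto_toReal ENNReal.zero_ne_top).comp h0
    rw [ENNReal.toReal_zero] at this
    exact this
  have h2 := h1.const_sub 1
  rw [sub_zero] at h2
  refine tendsto_of_tendsto_of_tendsto_of_le_of_le h2 tendsto_const_nhds (fun N => ?_) (fun N => ?_)
  · have := hP N
    have hu : (1 : ENNReal) ≤ P N {ω | p.Good k ε c' (W N ω)} + P N {ω | ¬ p.Good k ε c' (W N ω)} := by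
      rw [← measure_univ (μ := P N)]
      refine (measure_mono ?_).trans (measure_union_le _ _)
      intro ω _
      exact em _
    have := ENNReal.toReal_mono (by finiteness) hu
    rw [ENNReal.toReal_add (by finiteness) (by finiteness)] at this
    simp only [ENNReal.toReal_one] at this
    linarith
  · have := hP N
    exact ENNReal.toReal_le_of_le_ofReal zero_le_one (by simpa using prob_le_one)

end Par

/-- Assume `(β,h)` satisfy the AT condition. With
`S_{N,ε,k} = {(u,v) : ‖u‖² = 1, v ∈ (-1,1)^N, ‖v - m^{(k)}‖² ≤ Nε}`, there is a constant
`c = c_{β,h} > 0`, independent of `N`, such that for every `c' < c` there is `ε₀ > 0` so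
that for every `0 < ε ≤ ε₀` there is `k₀` with: for every `k ≥ k₀`,
`ℙ( inf_{(u,v) ∈ S_{N,ε,k}} (u, (D_v + β²(1-q) - (2β²/N) v⊗v - βG) u) ≥ c' ) → 1`
as `N → ∞`. -/
theorem uniform_TAP_Hessian_lower_bound_near_iterates
    (β h q : ℝ) (hβ : 0 < β) (hh : 0 < h)
    (hq : isFixedq β h q) (hAT : ATcond β h q)
    (Ω : ℕ → Type) [∀ N, MeasurableSpace (Ω N)] (P : ∀ N, Measure (Ω N))
    (hP : ∀ N, IsProbabilityMeasure (P N))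
    (W : ∀ N, Ω N → Fin N → Fin N → ℝ) (hW : ∀ N, IsWGauss N (P N) (W N)) :
    ∃ c : ℝ, 0 < c ∧ ∀ c' : ℝ, c' < c → ∃ ε₀ : ℝ, 0 < ε₀ ∧
      ∀ ε : ℝ, 0 < ε → ε ≤ ε₀ → ∃ k₀ : ℕ, ∀ k, k₀ ≤ k →
        Tendsto (fun N => ((P N) {ω |
            ∀ u v : Fin N → ℝ,
              (∑ i, u i ^ 2) = 1 →
              (∀ i, |v i| < 1) →
              (∑ i, (v i - mTAP N β h q (W N ω) k i) ^ 2) ≤ N * ε →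
              c' ≤ dotp N u (mulVec N (fun i j =>
                  (if i = j then (1 - v i ^ 2)⁻¹ else 0)
                    + β ^ 2 * (1 - q) * (if i = j then 1 else 0)
                    - 2 * β ^ 2 / N * (v i * v j)
                    - β * symmG N (W N ω) i j) u)}).toReal)
          atTop (nhds 1) := by
  set p : Par := ⟨β, h, q, hβ, hh, hq, hAT⟩ with hp
  obtain ⟨c, hc, H⟩ := p.exists_const
  refine ⟨c, hc, fun c' hc' => ?_⟩
  obtain ⟨ε₁, hε₁, H1⟩ := H c' hc'
  refine ⟨ε₁ / 2, by positivity, fun ε hε hεe => ?_⟩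
  obtain ⟨k₀, H2⟩ := H1 (2 * ε) (by positivity) (by linarith)
  refine ⟨k₀, fun k hk => ?_⟩
  obtain ⟨K, _, H3⟩ := H2 k hk
  exact p.final_tendsto k K hε Ω P hP W hW H3

end SK
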